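/- Let 𝐟 : ℝ² → ℝ be a C² function on the open unit disk D = {(u,v) : u² + v² < 1} satisfying the minimal surface equation on D. Then the Gaussian curvature K of the graph of 𝐟 at the point above the origin satisfies |K| < 5.7. -/

import Mathlib

open Real Set

/-- Partial derivative in the `u` (first coordinate) direction. -/
noncomputable def pdu (f : ℝ × ℝ → ℝ) (p : ℝ × ℝ) : ℝ := lineDeriv ℝ f p (1, 0)

/-- Partial derivative in the `v` (second coordinate) direction. -/
noncomputable def pdv (f : ℝ × ℝ → ℝ) (p : ℝ × ℝ) : ℝ := lineDeriv ℝ f p (0, 1)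

/-- The open unit disk in `ℝ²`. -/
def unitDisk : Set (ℝ × ℝ) := {p | p.1 ^ 2 + p.2 ^ 2 < 1}

/-- The Gaussian curvature of the graph of `f` at the point above `p`. -/
noncomputable def gaussCurv (f : ℝ × ℝ → ℝ) (p : ℝ × ℝ) : ℝ :=
  (pdu (pdu f) p * pdv (pdv f) p - (pdv (pdu f) p) ^ 2) /
    (1 + (pdu f p) ^ 2 + (pdv f p) ^ 2) ^ 2

/-- `f` satisfies the minimal surface equation on `D`. -/
def MinimalSurfaceEq (f : ℝ × ℝ → ℝ) (D : Set (ℝ × ℝ)) : Prop :=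
  ∀ p ∈ D, (1 + (pdv f p) ^ 2) * pdu (pdu f) p
      - 2 * pdu f p * pdv f p * pdv (pdu f) p
      + (1 + (pdu f p) ^ 2) * pdv (pdv f) p = 0

/-- `ζ` is an `h`-symmetric point of `f`: `h` is a unit vector,
`∇ₕ f(ζ) = 0` and `∇²_{h, ih} f(ζ) = 0` where `ih = (-h₂, h₁)`. -/
def IsSymmetricPt (f : ℝ × ℝ → ℝ) (ζ : ℝ × ℝ) (h : ℝ × ℝ) : Prop :=
  h.1 ^ 2 + h.2 ^ 2 = 1 ∧ lineDeriv ℝ f ζ h = 0 ∧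
    lineDeriv ℝ (fun p => lineDeriv ℝ f p h) ζ (-h.2, h.1) = 0

theorem cos_le_quartic {x : ℝ} (hx : 0 ≤ x) : cos x ≤ 1 - x ^ 2 / 2 + x ^ 4 / 24 := by
  have key : MonotoneOn (fun t : ℝ => 1 - t ^ 2 / 2 + t ^ 4 / 24 - cos t) (Ici 0) := by
    apply monotoneOn_of_deriv_nonneg (convex_Ici 0) (by fun_prop) (by fun_prop)
    intro t ht
    rw [interior_Ici] at ht
    have hd : HasDerivAt (fun t : ℝ => 1 - t ^ 2 / 2 + t ^ 4 / 24 - cos t)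
        (-t + t ^ 3 / 6 + sin t) t := by
      have := ((((hasDerivAt_id t).pow 2).div_const 2).const_sub 1).add
        (((hasDerivAt_id t).pow 4).div_const 24) |>.sub (hasDerivAt_cos t)
      convert! this using 1
      simp; ring
    rw [hd.deriv]
    linarith [sin_gt_sub_cube ht]
  have := key (mem_Ici.2 le_rfl) (mem_Ici.2 hx) hx
  simp at this
  linarith

theorem sin_le_quintic {x : ℝ} (hx : 0 ≤ x) : sin x ≤ x - x ^ 3 / 6 + x ^ 5 / 120 := by
  have key : MonotoneOn (fun t : ℝ => t - t ^ 3 / 6 + t ^ 5 / 120 - sin t) (Ici 0) := by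
    apply monotoneOn_of_deriv_nonneg (convex_Ici 0) (by fun_prop) (by fun_prop)
    intro t ht
    rw [interior_Ici] at ht
    have hd : HasDerivAt (fun t : ℝ => t - t ^ 3 / 6 + t ^ 5 / 120 - sin t)
        (1 - t ^ 2 / 2 + t ^ 4 / 24 - cos t) t := by
      have := ((hasDerivAt_id t).sub (((hasDerivAt_id t).pow 3).div_const 6)).add
        (((hasDerivAt_id t).pow 5).div_const 120) |>.sub (hasDerivAt_sin t)
      convert! this using 1
      simp; ring
    rw [hd.deriv]
    linarith [cos_le_quartic (le_of_lt ht)]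
  have := key (mem_Ici.2 le_rfl) (mem_Ici.2 hx) hx
  simp at this
  linarith

/-- A quadratic majorant of the sine that is nearly exact around `0.55`. -/
theorem sin_le_quadratic {y : ℝ} (hy : 0 ≤ y) (hy' : y ≤ π / 2) :
    sin y ≤ 0.004 + 1.034 * y - 0.164 * y ^ 2 := by
  have h1 := sin_le_quintic hy
  have h2 : y ≤ 1.5708 := by linarith [pi_lt_d6]
  have h3 : 0 ≤ 0.004 + 0.034 * y - 0.164 * y ^ 2 + y ^ 3 / 6 - y ^ 5 / 120 := by
    rcases le_total y 0.9 with h | h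
    · nlinarith [mul_nonneg hy (sq_nonneg (y - 0.55)), mul_nonneg hy (sub_nonneg.2 h),
        mul_nonneg (pow_nonneg hy 3) (sub_nonneg.2 h), sq_nonneg (y-0.55),
        mul_nonneg (mul_nonneg hy (sub_nonneg.2 h)) (sq_nonneg (y-0.55)),
        mul_nonneg (mul_nonneg hy hy) (mul_nonneg hy (sq_nonneg (y-0.55)))]
    · nlinarith [mul_nonneg (sub_nonneg.2 h) (sub_nonneg.2 h2),
        mul_nonneg (mul_nonneg (sub_nonneg.2 h) (sub_nonneg.2 h2)) hy,
        mul_nonneg (mul_nonneg (sub_nonneg.2 h) (sub_nonneg.2 h2)) (pow_nonneg hy 2),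
        mul_nonneg (mul_nonneg (sub_nonneg.2 h) (sub_nonneg.2 h2)) (pow_nonneg hy 3),
        pow_nonneg hy 3]
  linarith

/-- The affine minorant of `D ↦ cos (D + ψ)` on `[0, 2 π]` through the left endpoint. -/
theorem cos_add_ge_affine {ψ D : ℝ} (hψ : 0 ≤ ψ) (hψ' : ψ ≤ π / 4) (hD : 0 ≤ D)
    : cos ψ - (0.74 + 0.27 * ψ) * D ≤ cos (D + ψ) := by
  have hpi1 := pi_gt_d6
  have hpi2 := pi_lt_d6
  have hψb : ψ ≤ 0.7854 := by linarith
  rcases le_total (D + ψ) (π / 2) with h | h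
  · -- the region where the cosine is concave
    have e : cos ψ - cos (D + ψ) = 2 * sin (D / 2) * sin (D / 2 + ψ) := by
      have := cos_sub_cos (ψ) (D + ψ)
      rw [this]
      have e1 : (ψ + (D + ψ)) / 2 = D / 2 + ψ := by ring
      have e2 : (ψ - (D + ψ)) / 2 = - (D / 2) := by ring
      rw [e1, e2, sin_neg]; ring
    have s1 : sin (D / 2) ≤ D / 2 := sin_le (by linarith)
    have s0 : 0 ≤ sin (D / 2 + ψ) := sin_nonneg_of_nonneg_of_le_pi (by linarith) (by linarith)
    have s2 : sin (D / 2 + ψ) ≤ sin (π / 4 + ψ / 2) := by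
      apply sin_le_sin_of_le_of_le_pi_div_two <;> linarith
    have s3 : sin (π / 4 + ψ / 2) ≤ 0.74 + 0.27 * ψ := by
      rw [sin_add, sin_pi_div_four, cos_pi_div_four]
      have c1 := cos_le_quartic (x := ψ / 2) (by linarith)
      have c2 := sin_le (x := ψ / 2) (by linarith)
      have r : √2 ≤ 1.41422 := by
        rw [sqrt_le_left (by norm_num)]; norm_num
      have r0 := sqrt_nonneg 2
      have c3 : cos (ψ / 2) + sin (ψ / 2) ≤ 1 + ψ / 2 - 0.1217 * ψ ^ 2 := by
        nlinarith [mul_nonneg (sq_nonneg ψ) (mul_nonneg hψ (sub_nonneg.2 hψb)),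
          mul_nonneg (sq_nonneg ψ) (sub_nonneg.2 hψb)]
      have c5 : 0 ≤ 1 + ψ / 2 - 0.1217 * ψ ^ 2 := by nlinarith
      have c4 : √2 / 2 * (cos (ψ / 2) + sin (ψ / 2)) ≤ 0.70711 * (1 + ψ / 2 - 0.1217 * ψ ^ 2) := by
        apply mul_le_mul (by linarith) c3 _ (by norm_num)
        apply add_nonneg
        · exact cos_nonneg_of_neg_pi_div_two_le_of_le (by linarith) (by linarith)
        · exact sin_nonneg_of_nonneg_of_le_pi (by linarith) (by linarith)
      nlinarith
    nlinarith [mul_nonneg hD s0, mul_le_mul_of_nonneg_left (s2.trans s3) hD]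
  · have c1 := cos_le_quartic hψ
    have c2 : cos ψ ≤ 1 - 0.474 * ψ ^ 2 := by
      nlinarith [mul_nonneg (sq_nonneg ψ) (mul_nonneg hψ (sub_nonneg.2 hψb)),
        mul_nonneg (sq_nonneg ψ) (sub_nonneg.2 hψb)]
    rcases le_total (D + ψ) π with h' | h'
    · have s := sin_le_quadratic (y := D + ψ - π / 2) (by linarith) (by linarith)
      rw [sin_sub_pi_div_two] at s
      set y := D + ψ - π / 2 with hy
      have hy0 : 0 ≤ y := by linarith
      have hDy : D = y + π / 2 - ψ := by rw [hy]; ring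
      have hD' : y + 1.57079 - ψ ≤ D := by linarith
      have hm : (0.74 + 0.27 * ψ) * (y + 1.57079 - ψ) ≤ (0.74 + 0.27 * ψ) * D :=
        mul_le_mul_of_nonneg_left hD' (by linarith)
      have hq : 0 ≤ (0.74 + 0.27 * ψ) * (y + 1.57079 - ψ) - 1 + 0.474 * ψ ^ 2
          - (0.004 + 1.034 * y - 0.164 * y ^ 2) := by
        clear_value y
        clear * -
        nlinarith [sq_nonneg (y + 0.823 * ψ - 0.8963), sq_nonneg (ψ - 0.4)]
      linarith
    · have := neg_one_le_cos (D + ψ)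
      have hD' : π - ψ ≤ D := by linarith
      have : (0.74 + 0.27 * ψ) * (π - ψ) ≤ (0.74 + 0.27 * ψ) * D :=
        mul_le_mul_of_nonneg_left hD' (by linarith)
      nlinarith [cos_le_one ψ, mul_nonneg hψ (sub_nonneg.2 hψb)]

theorem one_sub_cos_ge {u : ℝ} (hu : 0 ≤ u) (hu' : u ≤ 2 * π / 3) : u - sin u ≤ 1 - cos u := by
  have hpi1 := pi_gt_d6
  have hpi2 := pi_lt_d6
  rcases le_total u (π / 2) with h | h
  · have h2 := cos_le_quartic hu
    have h3 : sin u ≥ u - u ^ 3 / 6 := by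
      rcases hu.eq_or_lt with rfl | h0
      · simp
      · exact (sin_gt_sub_cube h0).le
    have h5 : u ≤ 1.6 := by linarith
    nlinarith [mul_nonneg (mul_nonneg hu hu) (sub_nonneg.2 h5), mul_nonneg hu hu,
      mul_nonneg (mul_nonneg hu hu) (mul_nonneg hu (sub_nonneg.2 h5))]
  · have h1 := mul_le_sin (x := u - π / 2) (by linarith) (by linarith)
    rw [sin_sub_pi_div_two] at h1
    have h2 := one_sub_sq_div_two_le_cos (x := u - π / 2)
    rw [cos_sub_pi_div_two] at h2
    have h4 : 0.6 ≤ 2 / π := by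
      rw [le_div_iff₀ (by positivity)]; linarith
    have h5 := mul_le_mul_of_nonneg_right h4 (show 0 ≤ u - π / 2 by linarith)
    have h6 : u - π / 2 ≤ 0.524 := by linarith
    nlinarith

/-- The tangent line to the cosine at `3 ψ` stays below the cosine to the right of `ψ`. -/
theorem cos_add_ge_tangent {ψ D : ℝ} (hψ : π / 4 ≤ ψ) (hψ' : ψ ≤ π / 3) (hD : 0 ≤ D) :
    cos (3 * ψ) - sin (3 * ψ) * (D - 2 * ψ) ≤ cos (D + ψ) := by
  have hpi := pi_pos
  obtain ⟨u, hu⟩ : ∃ u, u = 2 * ψ - D := ⟨_, rfl⟩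
  have e : D + ψ = 3 * ψ - u := by rw [hu]; ring
  have hc : sin (3 * ψ) ≤ - cos (3 * ψ) := by
    have : 0 ≤ sin (3 * ψ - 3 * π / 4) := by
      apply sin_nonneg_of_nonneg_of_le_pi <;> linarith
    have e4 : 3 * π / 4 = π - π / 4 := by ring
    rw [sin_sub, e4, sin_pi_sub, cos_pi_sub, sin_pi_div_four, cos_pi_div_four] at this
    have : 0 < √2 := by positivity
    nlinarith
  have hs : 0 ≤ sin (3 * ψ) := by apply sin_nonneg_of_nonneg_of_le_pi <;> linarith
  rw [e, cos_sub, show D - 2 * ψ = - u by rw [hu]; ring]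
  have h1 := cos_le_one u
  rcases le_total 0 u with h | h
  · have := one_sub_cos_ge h (by linarith)
    nlinarith [mul_le_mul_of_nonneg_right hc (sub_nonneg.2 h1), mul_le_mul_of_nonneg_left this hs]
  · have h2 : u ≤ sin u := by
      have := sin_le (x := -u) (by linarith)
      rw [sin_neg] at this; linarith
    nlinarith [mul_nonneg hs (sub_nonneg.2 h2), mul_le_mul_of_nonneg_right hc (sub_nonneg.2 h1),
      mul_nonneg hs (sub_nonneg.2 h1)]

/-- The kernel `∑ κ_n cos (n s + s / 2)` at `s = 2 ψ` for the weights `1, 1 + √3, 1 + √3, 1`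
on the frequencies `1, 0, -1, -2`. -/
noncomputable def heinzKernel (ψ : ℝ) : ℝ := 2 * (1 + √3) * cos ψ + 2 * cos (3 * ψ)

theorem heinzKernel_eq (ψ : ℝ) : heinzKernel ψ = 2 * cos ψ * (√3 + 2 * cos (2 * ψ)) := by
  rw [heinzKernel, cos_three_mul, cos_two_mul]; ring

theorem heinzKernel_nonneg {ψ : ℝ} (h0 : 0 ≤ ψ) (h1 : ψ ≤ 5 * π / 12) : 0 ≤ heinzKernel ψ := by
  have hpi := pi_pos
  rw [heinzKernel_eq]
  have c1 : 0 ≤ cos ψ := cos_nonneg_of_neg_pi_div_two_le_of_le (by linarith) (by linarith)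
  have c2 : cos (π - π / 6) ≤ cos (2 * ψ) :=
    cos_le_cos_of_nonneg_of_le_pi (by linarith) (by linarith) (by linarith)
  rw [cos_pi_sub, cos_pi_div_six] at c2
  exact mul_nonneg (by linarith) (by linarith)

theorem heinzKernel_nonpos {ψ : ℝ} (h0 : 5 * π / 12 ≤ ψ) (h1 : ψ ≤ π / 2) :
    heinzKernel ψ ≤ 0 := by
  have hpi := pi_pos
  rw [heinzKernel_eq]
  have c1 : 0 ≤ cos ψ := cos_nonneg_of_neg_pi_div_two_le_of_le (by linarith) (by linarith)
  have c2 : cos (2 * ψ) ≤ cos (π - π / 6) :=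
    cos_le_cos_of_nonneg_of_le_pi (by linarith) (by linarith) (by linarith)
  rw [cos_pi_sub, cos_pi_div_six] at c2
  exact mul_nonpos_of_nonneg_of_nonpos (by linarith) (by linarith)

theorem continuous_heinzKernel : Continuous heinzKernel := by
  unfold heinzKernel; fun_prop

theorem hasDerivAt_sin_const_mul (c x : ℝ) :
    HasDerivAt (fun x : ℝ => sin (c * x)) (cos (c * x) * c) x := by
  convert! ((hasDerivAt_id x).const_mul c).sin using 1; simp

theorem hasDerivAt_cos_const_mul (c x : ℝ) :
    HasDerivAt (fun x : ℝ => cos (c * x)) (-sin (c * x) * c) x := by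
  convert! ((hasDerivAt_id x).const_mul c).cos using 1; simp

theorem integral_heinzKernel (a b : ℝ) : ∫ ψ in a..b, heinzKernel ψ =
    (2 * (1 + √3) * sin b + 2 / 3 * sin (3 * b)) - (2 * (1 + √3) * sin a + 2 / 3 * sin (3 * a)) := by
  apply intervalIntegral.integral_eq_sub_of_hasDerivAt
  · intro x _
    have h3 := hasDerivAt_sin_const_mul 3 x
    convert! ((hasDerivAt_sin x).const_mul (2 * (1 + √3))).add (h3.const_mul (2 / 3)) using 1
    rw [heinzKernel]; ring
  · exact continuous_heinzKernel.intervalIntegrable _ _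

theorem integral_heinzKernel_mul_cos (a b : ℝ) : ∫ ψ in a..b, heinzKernel ψ * cos (3 * ψ) =
    ((1 + √3) * (sin (4 * b) / 4 + sin (2 * b) / 2) + b + sin (6 * b) / 6) -
    ((1 + √3) * (sin (4 * a) / 4 + sin (2 * a) / 2) + a + sin (6 * a) / 6) := by
  apply intervalIntegral.integral_eq_sub_of_hasDerivAt (f := fun x => (1 + √3) * (sin (4 * x) / 4 + sin (2 * x) / 2) + x + sin (6 * x) / 6)
  · intro x _
    have h (c : ℝ) := hasDerivAt_sin_const_mul c x
    convert! (((((h 4).div_const 4).add ((h 2).div_const 2)).const_mul (1 + √3)).add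
      (hasDerivAt_id x)).add ((h 6).div_const 6) using 1
    rw [heinzKernel, show 4 * x = 3 * x + x by ring, show 6 * x = 2 * (3 * x) by ring,
      show cos (2 * x) = cos (3 * x - x) by ring_nf, cos_add, cos_sub, cos_two_mul (3 * x)]
    ring
  · exact (continuous_heinzKernel.mul (by fun_prop)).intervalIntegrable _ _

theorem integral_heinzKernel_mul_affine (b : ℝ) :
    ∫ ψ in (0:ℝ)..b, heinzKernel ψ * (cos ψ - (0.74 + 0.27 * ψ) * (2 * ψ)) =
    ((1 + √3) * b + (2 + √3) * sin (2 * b) / 2 + sin (4 * b) / 4)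
    - 1.48 * (2 * (1 + √3) * (b * sin b + cos b - 1)
        + 2 * (b * sin (3 * b) / 3 + cos (3 * b) / 9 - 1 / 9))
    - 0.54 * (2 * (1 + √3) * (b ^ 2 * sin b + 2 * b * cos b - 2 * sin b)
        + 2 * (b ^ 2 * sin (3 * b) / 3 + 2 * b * cos (3 * b) / 9 - 2 * sin (3 * b) / 27)) := by
  rw [intervalIntegral.integral_eq_sub_of_hasDerivAt (f := fun b =>
    ((1 + √3) * b + (2 + √3) * sin (2 * b) / 2 + sin (4 * b) / 4)
    - 1.48 * (2 * (1 + √3) * (b * sin b + cos b - 1)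
        + 2 * (b * sin (3 * b) / 3 + cos (3 * b) / 9 - 1 / 9))
    - 0.54 * (2 * (1 + √3) * (b ^ 2 * sin b + 2 * b * cos b - 2 * sin b)
        + 2 * (b ^ 2 * sin (3 * b) / 3 + 2 * b * cos (3 * b) / 9 - 2 * sin (3 * b) / 27)))]
  · simp
  · intro x _
    have h (c : ℝ) := hasDerivAt_sin_const_mul c x
    have h' (c : ℝ) := hasDerivAt_cos_const_mul c x
    have hx := hasDerivAt_id x
    have hx2 := (hasDerivAt_id x).pow 2
    have s := hasDerivAt_sin x
    have c := hasDerivAt_cos x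
    convert! (((hx.const_mul (1 + √3)).add (((h 2).const_mul (2 + √3)).div_const 2)).add
      ((h 4).div_const 4)).sub (((((hx.mul s).add c).sub_const 1).const_mul (2 * (1 + √3))).add
      (((((hx.mul (h 3)).div_const 3).add ((h' 3).div_const 9)).sub_const (1 / 9)).const_mul 2)
      |>.const_mul 1.48) |>.sub
      ((((((hx2.mul s).add ((hx.const_mul 2).mul c)).sub (s.const_mul 2)).const_mul
        (2 * (1 + √3))).add
      ((((hx2.mul (h 3)).div_const 3).add (((hx.const_mul 2).mul (h' 3)).div_const 9)).sub
        (((h 3).const_mul 2).div_const 27) |>.const_mul 2)).const_mul 0.54) using 1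
    simp only [id, Pi.pow_apply]
    rw [heinzKernel, show cos (4 * x) = cos (3 * x + x) by ring_nf,
      show cos (2 * x) = cos (3 * x - x) by ring_nf, cos_add, cos_sub]
    have e : sin (3 * x) * sin x = cos (3 * x - x) - cos (3 * x) * cos x := by rw [cos_sub]; ring
    have e2 : sin (3 * x) * sin x =  cos (3 * x) * cos x - cos (3 * x + x) := by rw [cos_add]; ring
    have e3 : cos (2 * x) = 2 * cos x ^ 2 - 1 := cos_two_mul x
    rw [show 3 * x - x = 2 * x by ring, e3] at e
    push_cast
    linear_combination (-(1 + √3)) * e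
  · exact (continuous_heinzKernel.mul (by fun_prop)).intervalIntegrable _ _

theorem heinz_numeric_bound : 0.705 * (π / 2) ≤
    ((1 + √3) * (π / 4) + (2 + √3) * 1 / 2 + 0 / 4 -
      1.48 * (2 * (1 + √3) * (π / 4 * (√2 / 2) + √2 / 2 - 1) +
        2 * (π / 4 * (√2 / 2) / 3 + -(√2 / 2) / 9 - 1 / 9)) -
      0.54 * (2 * (1 + √3) * ((π / 4) ^ 2 * (√2 / 2) + 2 * (π / 4) * (√2 / 2) - 2 * (√2 / 2)) +
        2 * ((π / 4) ^ 2 * (√2 / 2) / 3 + 2 * (π / 4) * -(√2 / 2) / 9 - 2 * (√2 / 2) / 27))) +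
    ((1 + √3) * (-(√3 / 2) / 4 + √3 / 2 / 2) + π / 3 + 0 / 6 -
      ((1 + √3) * (0 / 4 + 1 / 2) + π / 4 + -1 / 6)) +
    -(2 * (1 + √3) * (√2 * √3 / 4 + √2 / 4) + 2 / 3 * -(√2 / 2) -
      (2 * (1 + √3) * (√3 / 2) + 2 / 3 * 0)) +
    (2 * (1 + √3) * 1 + 2 / 3 * -1 -
      (2 * (1 + √3) * (√2 * √3 / 4 + √2 / 4) + 2 / 3 * -(√2 / 2))) := by
  obtain ⟨x, hx⟩ : ∃ x, x = √2 := ⟨_, rfl⟩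
  obtain ⟨y, hy⟩ : ∃ y, y = √3 := ⟨_, rfl⟩
  have x1 : 1.41421 ≤ x := by rw [hx]; apply le_sqrt_of_sq_le; norm_num
  have x2 : x ≤ 1.41422 := by rw [hx, sqrt_le_left (by norm_num)]; norm_num
  have y1 : 1.73205 ≤ y := by rw [hy]; apply le_sqrt_of_sq_le; norm_num
  have y2 : y ≤ 1.73206 := by rw [hy, sqrt_le_left (by norm_num)]; norm_num
  have ysq : y ^ 2 = 3 := by rw [hy]; norm_num
  rw [← hx, ← hy]
  have p1 := pi_gt_d6
  have p2 := pi_lt_d6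
  clear hx hy
  generalize π = p at *
  have x0 : 0 ≤ x := by linarith
  have y0 : 0 ≤ y := by linarith
  have p0 : 0 ≤ p := by linarith
  have xy1 : 2.4494 ≤ x * y :=
    (by norm_num : (2.4494 : ℝ) ≤ 1.41421 * 1.73205).trans (mul_le_mul x1 y1 (by norm_num) x0)
  have xy2 : x * y ≤ 2.4496 :=
    (mul_le_mul x2 y2 y0 (by norm_num)).trans (by norm_num)
  have yp1 : 5.4413 ≤ y * p :=
    (by norm_num : (5.4413 : ℝ) ≤ 1.73205 * 3.141592).trans (mul_le_mul y1 p1.le (by norm_num) y0)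
  have xp2 : x * p ≤ 4.443 :=
    (mul_le_mul x2 p2.le p0 (by norm_num)).trans (by norm_num)
  have xyp2 : (x * y) * p ≤ 7.6957 :=
    (mul_le_mul xy2 p2.le p0 (by norm_num)).trans (by norm_num)
  have xpp2 : (x * p) * p ≤ 13.959 :=
    (mul_le_mul xp2 p2.le p0 (by norm_num)).trans (by norm_num)
  have xypp2 : ((x * y) * p) * p ≤ 24.1768 :=
    (mul_le_mul xyp2 p2.le p0 (by norm_num)).trans (by norm_num)
  have xyy : x * y * y = 3 * x := by linear_combination x * ysq
  linarith

theorem integral_ge_of_heinzKernel {Φ : ℝ → ℝ} (hIntg : IntervalIntegrable Φ MeasureTheory.volume 0 (π / 2))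
    (h1 : ∀ ψ ∈ Icc 0 (π / 4), heinzKernel ψ * (cos ψ - (0.74 + 0.27 * ψ) * (2 * ψ)) ≤ Φ ψ)
    (h2 : ∀ ψ ∈ Icc (π / 4) (π / 3), heinzKernel ψ * cos (3 * ψ) ≤ Φ ψ)
    (h3 : ∀ ψ ∈ Icc (π / 3) (5 * π / 12), - heinzKernel ψ ≤ Φ ψ)
    (h4 : ∀ ψ ∈ Icc (5 * π / 12) (π / 2), heinzKernel ψ ≤ Φ ψ) :
    0.705 * (π / 2) ≤ ∫ ψ in (0:ℝ)..(π / 2), Φ ψ := by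
  have hpi := pi_pos
  have sub : ∀ a b, 0 ≤ a → a ≤ b → b ≤ π / 2 →
      IntervalIntegrable Φ MeasureTheory.volume a b := by
    intro a b ha hab hb
    apply hIntg.mono_set
    rw [uIcc_of_le hab, uIcc_of_le (by linarith)]
    exact Icc_subset_Icc ha hb
  have i1 := sub 0 (π / 4) le_rfl (by linarith) (by linarith)
  have i2 := sub (π / 4) (π / 3) (by linarith) (by linarith) (by linarith)
  have i3 := sub (π / 3) (5 * π / 12) (by linarith) (by linarith) (by linarith)
  have i4 := sub (5 * π / 12) (π / 2) (by linarith) (by linarith) (by linarith)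
  rw [← intervalIntegral.integral_add_adjacent_intervals i1 (i2.trans (i3.trans i4)),
    ← intervalIntegral.integral_add_adjacent_intervals i2 (i3.trans i4),
    ← intervalIntegral.integral_add_adjacent_intervals i3 i4]
  have m1 := intervalIntegral.integral_mono_on (by linarith)
    ((continuous_heinzKernel.mul (by fun_prop)).intervalIntegrable _ _) i1 h1
  have m2 := intervalIntegral.integral_mono_on (by linarith)
    ((continuous_heinzKernel.mul (by fun_prop)).intervalIntegrable _ _) i2 h2
  have m3 := intervalIntegral.integral_mono_on (by linarith)
    (continuous_heinzKernel.neg.intervalIntegrable _ _) i3 h3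
  have m4 := intervalIntegral.integral_mono_on (by linarith)
    (continuous_heinzKernel.intervalIntegrable _ _) i4 h4
  simp only [Pi.mul_apply, Pi.neg_apply] at m1 m2 m3
  rw [integral_heinzKernel_mul_affine] at m1
  rw [integral_heinzKernel_mul_cos] at m2
  simp only [intervalIntegral.integral_neg] at m3
  rw [integral_heinzKernel] at m3 m4
  have t1 : sin (3 * (π / 4)) = √2 / 2 := by
    rw [show 3 * (π / 4) = π - π / 4 by ring, sin_pi_sub, sin_pi_div_four]
  have t2 : cos (3 * (π / 4)) = - (√2 / 2) := by
    rw [show 3 * (π / 4) = π - π / 4 by ring, cos_pi_sub, cos_pi_div_four]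
  have t3 : sin (2 * (π / 4)) = 1 := by rw [show 2 * (π / 4) = π / 2 by ring, sin_pi_div_two]
  have t4 : sin (4 * (π / 4)) = 0 := by rw [show 4 * (π / 4) = π by ring, sin_pi]
  have t5 : sin (6 * (π / 4)) = -1 := by
    rw [show 6 * (π / 4) = π / 2 + π by ring, sin_add_pi, sin_pi_div_two]
  have t6 : sin (4 * (π / 3)) = - (√3 / 2) := by
    rw [show 4 * (π / 3) = π / 3 + π by ring, sin_add_pi, sin_pi_div_three]
  have t7 : sin (2 * (π / 3)) = √3 / 2 := by
    rw [show 2 * (π / 3) = π - π / 3 by ring, sin_pi_sub, sin_pi_div_three]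
  have t8 : sin (6 * (π / 3)) = 0 := by rw [show 6 * (π / 3) = 2 * π by ring, sin_two_pi]
  have t9 : sin (3 * (π / 3)) = 0 := by rw [show 3 * (π / 3) = π by ring, sin_pi]
  have t10 : sin (3 * (π / 2)) = -1 := by
    rw [show 3 * (π / 2) = π / 2 + π by ring, sin_add_pi, sin_pi_div_two]
  have t11 : sin (3 * (5 * π / 12)) = - (√2 / 2) := by
    rw [show 3 * (5 * π / 12) = π / 4 + π by ring, sin_add_pi, sin_pi_div_four]
  have t12 : sin (5 * π / 12) = √2 * √3 / 4 + √2 / 4 := by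
    rw [show 5 * π / 12 = π / 4 + π / 6 by ring, sin_add, sin_pi_div_four, cos_pi_div_four,
      sin_pi_div_six, cos_pi_div_six]; ring
  rw [t1, t2, t3, t4, sin_pi_div_four, cos_pi_div_four] at m1
  rw [t3, t4, t5, t6, t7, t8] at m2
  rw [sin_pi_div_three, t9, t11, t12] at m3
  rw [sin_pi_div_two, t10, t11, t12] at m4
  have := heinz_numeric_bound
  linarith

section

open MeasureTheory

theorem intervalIntegrable_of_measurable_of_abs_le {f : ℝ → ℝ} (hf : Measurable f) {C : ℝ}
    (hC : ∀ x, |f x| ≤ C) (a b : ℝ) : IntervalIntegrable f volume a b :=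
  (intervalIntegrable_const (c := C)).mono_fun' hf.aestronglyMeasurable
    (Filter.Eventually.of_forall fun x => by simpa using hC x)

/-- The autocorrelation at shift `s` of the circle-valued function `exp (i (θ t - n t))`. -/
noncomputable def autocorr (θ : ℝ → ℝ) (n : ℤ) (s : ℝ) : ℝ :=
  ∫ t in (0:ℝ)..(2 * π), cos (θ (t + s) - θ t - n * s)

/-- Fourier coefficients of the circle-valued function `exp (i θ)`. -/
noncomputable def circleCoeff (θ : ℝ → ℝ) (n : ℤ) : ℂ :=
  (2 * π : ℝ)⁻¹ • ∫ t in (0:ℝ)..(2 * π), Complex.exp (((θ t - n * t : ℝ) : ℂ) * Complex.I)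

section
variable {θ : ℝ → ℝ}

theorem autocorr_neg (hper : ∀ t, θ (t + 2 * π) = θ t + 2 * π) (n : ℤ) (s : ℝ) :
    autocorr θ n (-s) = autocorr θ n s := by
  unfold autocorr
  have hp : Function.Periodic (fun t => cos (θ (t + -s) - θ t - n * -s)) (2 * π) := by
    intro t
    have e : t + 2 * π + -s = (t + -s) + 2 * π := by ring
    simp only [e, hper]
    congr 1; ring
  have h1 := hp.intervalIntegral_add_eq s 0
  rw [zero_add] at h1
  rw [← h1, show s + 2 * π = 2 * π + s by ring]
  have h2 := intervalIntegral.integral_comp_add_right (a := 0) (b := 2 * π)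
    (fun t => cos (θ (t + -s) - θ t - n * -s)) s
  rw [zero_add] at h2
  rw [← h2]
  congr 1; ext t
  rw [← cos_neg]
  congr 1
  rw [add_neg_cancel_right]; ring

theorem integrable_autocorr_kernel (hm : Measurable θ) (n : ℤ) (a b c d : ℝ) :
    Integrable (Function.uncurry fun t s => cos (θ (t + s) - θ t - n * s))
      ((volume.restrict (Ioc a b)).prod (volume.restrict (Ioc c d))) := by
  refine (integrable_const (1 : ℝ)).mono' ?_ (Filter.Eventually.of_forall fun x => ?_)
  · apply Measurable.aestronglyMeasurable
    unfold Function.uncurry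
    fun_prop
  · rw [Real.norm_eq_abs]
    exact abs_cos_le_one _

theorem intervalIntegrable_autocorr (hm : Measurable θ) (n : ℤ) (a b : ℝ) :
    IntervalIntegrable (autocorr θ n) volume a b := by
  have h (c d : ℝ) : IntegrableOn (autocorr θ n) (Ioc c d) volume := by
    have := (integrable_autocorr_kernel hm n 0 (2 * π) c d).integral_prod_right
    refine this.congr (Filter.Eventually.of_forall fun s => ?_)
    simp only [Function.uncurry, autocorr]
    rw [intervalIntegral.integral_of_le (by positivity)]
  exact ⟨h a b, h b a⟩

theorem sq_integral_cos_add_sq_integral_sin (hm : Measurable θ)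
    (hper : ∀ t, θ (t + 2 * π) = θ t + 2 * π) (n : ℤ) :
    (∫ t in (0:ℝ)..(2 * π), cos (θ t - n * t)) ^ 2 + (∫ t in (0:ℝ)..(2 * π), sin (θ t - n * t)) ^ 2
      = 4 * ∫ ψ in (0:ℝ)..(π / 2), autocorr θ n (2 * ψ) := by
  have hpi := pi_pos
  have ic (a b : ℝ) : IntervalIntegrable (fun t => cos (θ t - n * t)) volume a b :=
    intervalIntegrable_of_measurable_of_abs_le (by fun_prop) (fun x => abs_cos_le_one _) a b
  have is (a b : ℝ) : IntervalIntegrable (fun t => sin (θ t - n * t)) volume a b :=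
    intervalIntegrable_of_measurable_of_abs_le (by fun_prop) (fun x => abs_sin_le_one _) a b
  have shift (f : ℝ → ℝ) (hf : Function.Periodic f (2 * π)) (t : ℝ) :
      ∫ x in (0:ℝ)..(2 * π), f x = ∫ s in (-π)..π, f (t + s) := by
    rw [intervalIntegral.integral_comp_add_left (fun x => f x) t,
      show t + π = (t + -π) + 2 * π by ring, hf.intervalIntegral_add_eq (t + -π) 0, zero_add]
  have pc : Function.Periodic (fun t => cos (θ t - n * t)) (2 * π) := by
    intro t
    simp only [hper]
    rw [show θ t + 2 * π - n * (t + 2 * π) = θ t - n * t - (n - 1 : ℤ) * (2 * π) by push_cast; ring,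
      cos_sub_int_mul_two_pi]
  have ps : Function.Periodic (fun t => sin (θ t - n * t)) (2 * π) := by
    intro t
    simp only [hper]
    rw [show θ t + 2 * π - n * (t + 2 * π) = θ t - n * t - (n - 1 : ℤ) * (2 * π) by push_cast; ring,
      sin_sub_int_mul_two_pi]
  set C := ∫ t in (0:ℝ)..(2 * π), cos (θ t - n * t) with hC
  set S := ∫ t in (0:ℝ)..(2 * π), sin (θ t - n * t) with hS
  have e1 : C ^ 2 + S ^ 2 =
      ∫ t in (0:ℝ)..(2 * π), (cos (θ t - n * t) * C + sin (θ t - n * t) * S) := by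
    rw [intervalIntegral.integral_add ((ic _ _).mul_const _) ((is _ _).mul_const _),
      intervalIntegral.integral_mul_const, intervalIntegral.integral_mul_const, ← hC, ← hS]
    ring
  have e2 (t : ℝ) : cos (θ t - n * t) * C + sin (θ t - n * t) * S =
      ∫ s in (-π)..π, cos (θ (t + s) - θ t - n * s) := by
    rw [hC, hS, shift _ pc t, shift _ ps t, ← intervalIntegral.integral_const_mul,
      ← intervalIntegral.integral_const_mul, ← intervalIntegral.integral_add]
    · congr 1; ext s
      rw [show θ (t + s) - θ t - n * s = (θ (t + s) - n * (t + s)) - (θ t - n * t) by ring,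
        cos_sub (θ (t + s) - n * (t + s))]
      ring
    · exact (intervalIntegrable_of_measurable_of_abs_le (by fun_prop)
        (fun x => abs_cos_le_one _) _ _).const_mul _
    · exact (intervalIntegrable_of_measurable_of_abs_le (by fun_prop)
        (fun x => abs_sin_le_one _) _ _).const_mul _
  rw [e1]
  simp only [e2]
  have e3 : ∫ t in (0:ℝ)..(2 * π), ∫ s in (-π)..π, cos (θ (t + s) - θ t - n * s) =
      ∫ s in (-π)..π, autocorr θ n s := by
    unfold autocorr
    simp only [intervalIntegral.integral_of_le (show (0:ℝ) ≤ 2 * π by positivity),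
      intervalIntegral.integral_of_le (show -π ≤ π by linarith)]
    exact integral_integral_swap (integrable_autocorr_kernel hm n _ _ _ _)
  rw [e3, ← intervalIntegral.integral_add_adjacent_intervals
    (intervalIntegrable_autocorr hm n _ 0) (intervalIntegrable_autocorr hm n 0 _)]
  have e4 : ∫ s in (-π)..0, autocorr θ n s = ∫ s in (0:ℝ)..π, autocorr θ n s := by
    have := intervalIntegral.integral_comp_neg (a := 0) (b := π) (autocorr θ n)
    rw [neg_zero] at this
    rw [← this]
    simp only [autocorr_neg hper]
  have e5 := intervalIntegral.mul_integral_comp_mul_left (a := 0) (b := π / 2)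
    (f := autocorr θ n) 2
  rw [mul_zero, show 2 * (π / 2) = π by ring] at e5
  rw [e4, ← e5]
  ring

theorem norm_sq_circleCoeff (hm : Measurable θ)
    (hper : ∀ t, θ (t + 2 * π) = θ t + 2 * π) (n : ℤ) :
    ‖circleCoeff θ n‖ ^ 2 = (π ^ 2)⁻¹ * ∫ ψ in (0:ℝ)..(π / 2), autocorr θ n (2 * ψ) := by
  have hi : IntervalIntegrable (fun t => Complex.exp (((θ t - n * t : ℝ) : ℂ) * Complex.I))
      volume 0 (2 * π) := by
    refine (intervalIntegrable_const (c := (1 : ℝ))).mono_fun' ?_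
      (Filter.Eventually.of_forall fun x => ?_)
    · apply Measurable.aestronglyMeasurable; fun_prop
    · simp only [Complex.norm_exp_ofReal_mul_I, le_refl]
  have hre : (∫ t in (0:ℝ)..(2 * π), Complex.exp (((θ t - n * t : ℝ) : ℂ) * Complex.I)).re =
      ∫ t in (0:ℝ)..(2 * π), cos (θ t - n * t) := by
    have := Complex.reCLM.intervalIntegral_comp_comm hi
    simp only [Complex.reCLM_apply, Complex.exp_ofReal_mul_I_re] at this
    exact this.symm
  have him : (∫ t in (0:ℝ)..(2 * π), Complex.exp (((θ t - n * t : ℝ) : ℂ) * Complex.I)).im =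
      ∫ t in (0:ℝ)..(2 * π), sin (θ t - n * t) := by
    have := Complex.imCLM.intervalIntegral_comp_comm hi
    simp only [Complex.imCLM_apply, Complex.exp_ofReal_mul_I_im] at this
    exact this.symm
  rw [circleCoeff, norm_smul, mul_pow, Complex.sq_norm, Complex.normSq_apply, hre, him,
    ← sq, ← sq, sq_integral_cos_add_sq_integral_sin hm hper]
  rw [norm_inv, norm_of_nonneg (by positivity)]
  field_simp
  ring

theorem norm_circleCoeff_le_one (n : ℤ) : ‖circleCoeff θ n‖ ≤ 1 := by
  have h := intervalIntegral.norm_integral_le_of_norm_le_const (a := 0) (b := 2 * π) (C := 1)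
    (f := fun t => Complex.exp (((θ t - n * t : ℝ) : ℂ) * Complex.I))
    (fun x _ => by simp only [Complex.norm_exp_ofReal_mul_I, le_refl])
  have hp : (0 : ℝ) < 2 * π := by positivity
  rw [sub_zero, abs_of_pos hp, one_mul] at h
  rw [circleCoeff, norm_smul, norm_inv, norm_of_nonneg hp.le, inv_mul_le_iff₀ hp, mul_one]
  exact h

theorem integral_shift_sub (hm : Monotone θ) (hper : ∀ t, θ (t + 2 * π) = θ t + 2 * π) (s : ℝ) :
    ∫ t in (0:ℝ)..(2 * π), (θ (t + s) - θ t) = 2 * π * s := by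
  have hp : Function.Periodic (fun t => θ t - t) (2 * π) := by
    intro t; simp only [hper]; ring
  have i1 (a b : ℝ) : IntervalIntegrable θ volume a b := hm.intervalIntegrable
  have h1 := hp.intervalIntegral_add_eq s 0
  rw [zero_add] at h1
  have h2 := intervalIntegral.integral_comp_add_right (a := 0) (b := 2 * π) θ s
  rw [zero_add, add_comm (2 * π) s] at h2
  have i2 : IntervalIntegrable (fun t => θ (t + s)) volume 0 (2 * π) :=
    Monotone.intervalIntegrable fun x y h => hm (by linarith)
  rw [intervalIntegral.integral_sub i2 (i1 _ _), h2]
  rw [intervalIntegral.integral_sub (i1 _ _) intervalIntegral.intervalIntegrable_id,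
    intervalIntegral.integral_sub (i1 _ _) intervalIntegral.intervalIntegrable_id,
    integral_id, integral_id] at h1
  linarith

theorem shift_sub_nonneg (hm : Monotone θ) {s : ℝ} (hs : 0 ≤ s) (t : ℝ) : 0 ≤ θ (t + s) - θ t :=
  sub_nonneg.2 (hm (by linarith))

/-- A lower bound for the low-frequency Fourier coefficients of a monotone circle map. -/
theorem circleCoeff_lower_bound (hm : Monotone θ) (hper : ∀ t, θ (t + 2 * π) = θ t + 2 * π) :
    0.705 ≤ ‖circleCoeff θ 1‖ ^ 2 + (1 + √3) * ‖circleCoeff θ 0‖ ^ 2 +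
      (1 + √3) * ‖circleCoeff θ (-1)‖ ^ 2 + ‖circleCoeff θ (-2)‖ ^ 2 := by
  have hpi := pi_pos
  have hmm := hm.measurable
  set Φ : ℝ → ℝ := fun ψ => (2 * π)⁻¹ * (autocorr θ 1 (2 * ψ) + (1 + √3) * autocorr θ 0 (2 * ψ) +
    (1 + √3) * autocorr θ (-1) (2 * ψ) + autocorr θ (-2) (2 * ψ)) with hΦ
  have ia (n : ℤ) : IntervalIntegrable (fun ψ => autocorr θ n (2 * ψ)) volume 0 (π / 2) := by
    have := (intervalIntegrable_autocorr hmm n 0 π).comp_mul_left (c := 2)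
    simpa using this
  have hΦi : IntervalIntegrable Φ volume 0 (π / 2) :=
    ((((ia 1).add ((ia 0).const_mul _)).add ((ia (-1)).const_mul _)).add (ia (-2))).const_mul _
  have icos (n : ℤ) (s : ℝ) : IntervalIntegrable (fun t => cos (θ (t + s) - θ t - n * s)) volume
      0 (2 * π) :=
    intervalIntegrable_of_measurable_of_abs_le (by fun_prop) (fun x => abs_cos_le_one _) _ _
  have hΦ' (ψ : ℝ) : Φ ψ = (2 * π)⁻¹ *
      ∫ t in (0:ℝ)..(2 * π), heinzKernel ψ * cos ((θ (t + 2 * ψ) - θ t) + ψ) := by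
    simp only [hΦ, autocorr]
    rw [← intervalIntegral.integral_const_mul, ← intervalIntegral.integral_const_mul,
      ← intervalIntegral.integral_add (icos 1 _) ((icos 0 _).const_mul _),
      ← intervalIntegral.integral_add ((icos 1 _).add ((icos 0 _).const_mul _))
        ((icos (-1) _).const_mul _),
      ← intervalIntegral.integral_add (((icos 1 _).add ((icos 0 _).const_mul _)).add
        ((icos (-1) _).const_mul _)) (icos (-2) _)]
    congr 2; ext t
    generalize θ (t + 2 * ψ) - θ t = d
    have a1 : cos (d - (1 : ℤ) * (2 * ψ)) = cos ((d + ψ) - 3 * ψ) := by push_cast; ring_nf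
    have a2 : cos (d - (-2 : ℤ) * (2 * ψ)) = cos ((d + ψ) + 3 * ψ) := by push_cast; ring_nf
    have a3 : cos (d - (0 : ℤ) * (2 * ψ)) = cos ((d + ψ) - ψ) := by push_cast; ring_nf
    have a4 : cos (d - (-1 : ℤ) * (2 * ψ)) = cos ((d + ψ) + ψ) := by push_cast; ring_nf
    rw [a1, a2, a3, a4, cos_add (d + ψ), cos_sub (d + ψ), cos_add (d + ψ), cos_sub (d + ψ),
      heinzKernel]
    ring
  have ik (ψ : ℝ) : IntervalIntegrable (fun t => heinzKernel ψ *
      cos ((θ (t + 2 * ψ) - θ t) + ψ)) volume 0 (2 * π) :=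
    (intervalIntegrable_of_measurable_of_abs_le (by fun_prop)
      (fun x => abs_cos_le_one _) _ _).const_mul _
  have id (s : ℝ) : IntervalIntegrable (fun t => θ (t + s) - θ t) volume 0 (2 * π) :=
    IntervalIntegrable.sub (Monotone.intervalIntegrable fun x y h => hm (by linarith))
      hm.intervalIntegrable
  have avg (ψ A B : ℝ) (h : ∀ t, A + B * ((θ (t + 2 * ψ) - θ t) - 2 * ψ) ≤
      heinzKernel ψ * cos ((θ (t + 2 * ψ) - θ t) + ψ)) : A ≤ Φ ψ := by
    rw [hΦ']
    have i1 : IntervalIntegrable (fun t => A + B * ((θ (t + 2 * ψ) - θ t) - 2 * ψ)) volume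
      0 (2 * π) := intervalIntegrable_const.add (((id _).sub intervalIntegrable_const).const_mul _)
    have := intervalIntegral.integral_mono_on (by positivity) i1 (ik ψ) (fun t _ => h t)
    rw [intervalIntegral.integral_add intervalIntegrable_const
      (((id _).sub intervalIntegrable_const).const_mul _), intervalIntegral.integral_const_mul,
      intervalIntegral.integral_sub (id _) intervalIntegrable_const,
      integral_shift_sub hm hper] at this
    simp only [intervalIntegral.integral_const, sub_zero, smul_eq_mul, sub_self, mul_zero,
      add_zero] at this
    rw [le_inv_mul_iff₀ (by positivity)]
    linarith
  have key := integral_ge_of_heinzKernel hΦi ?_ ?_ ?_ ?_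
  · simp only [norm_sq_circleCoeff hmm hper]
    have : ∫ ψ in (0:ℝ)..(π / 2), Φ ψ = (2 * π)⁻¹ *
        ((∫ ψ in (0:ℝ)..(π / 2), autocorr θ 1 (2 * ψ)) +
        (1 + √3) * (∫ ψ in (0:ℝ)..(π / 2), autocorr θ 0 (2 * ψ)) +
        (1 + √3) * (∫ ψ in (0:ℝ)..(π / 2), autocorr θ (-1) (2 * ψ)) +
        (∫ ψ in (0:ℝ)..(π / 2), autocorr θ (-2) (2 * ψ))) := by
      simp only [hΦ]
      rw [intervalIntegral.integral_const_mul,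
        intervalIntegral.integral_add
          (((ia 1).add ((ia 0).const_mul _)).add ((ia (-1)).const_mul _)) (ia (-2)),
        intervalIntegral.integral_add ((ia 1).add ((ia 0).const_mul _)) ((ia (-1)).const_mul _),
        intervalIntegral.integral_add (ia 1) ((ia 0).const_mul _),
        intervalIntegral.integral_const_mul, intervalIntegral.integral_const_mul]
    rw [this, le_inv_mul_iff₀ (by positivity)] at key
    refine le_of_mul_le_mul_left (a := π ^ 2) ?_ (by positivity)
    calc π ^ 2 * 0.705 = 2 * π * (0.705 * (π / 2)) := by ring
      _ ≤ _ := key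
      _ = _ := by field_simp
  · intro ψ hψ
    refine avg ψ _ (- heinzKernel ψ * (0.74 + 0.27 * ψ)) fun t => ?_
    have h1 := cos_add_ge_affine hψ.1 hψ.2
      (shift_sub_nonneg hm (show 0 ≤ 2 * ψ by linarith [hψ.1]) t)
    have h2 := heinzKernel_nonneg hψ.1 (by linarith [hψ.2])
    linarith [mul_le_mul_of_nonneg_left h1 h2]
  · intro ψ hψ
    refine avg ψ _ (- heinzKernel ψ * sin (3 * ψ)) fun t => ?_
    have h1 := cos_add_ge_tangent hψ.1 hψ.2
      (shift_sub_nonneg hm (show 0 ≤ 2 * ψ by linarith [hψ.1]) t)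
    have h2 := heinzKernel_nonneg (ψ := ψ) (by linarith [hψ.1]) (by linarith [hψ.2])
    linarith [mul_le_mul_of_nonneg_left h1 h2]
  · intro ψ hψ
    refine avg ψ _ 0 fun t => ?_
    have h2 := heinzKernel_nonneg (ψ := ψ) (by linarith [hψ.1]) (by linarith [hψ.2])
    nlinarith [mul_le_mul_of_nonneg_left (neg_one_le_cos (θ (t + 2 * ψ) - θ t + ψ)) h2]
  · intro ψ hψ
    refine avg ψ _ 0 fun t => ?_
    have h2 := heinzKernel_nonpos (ψ := ψ) (by linarith [hψ.1]) (by linarith [hψ.2])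
    nlinarith [mul_le_mul_of_nonpos_left (cos_le_one (θ (t + 2 * ψ) - θ t + ψ)) h2]
end

end

section

open Filter Topology Metric

/-- Pointwise limits of uniformly bounded holomorphic functions are locally uniform. -/
theorem tendstoLocallyUniformlyOn_of_norm_le_one {ι : Type*} {l : Filter ι} [l.NeBot] {U : Set ℂ}
    (hU : IsOpen U) {F : ι → ℂ → ℂ} {G : ℂ → ℂ} (hF : ∀ n, DifferentiableOn ℂ (F n) U)
    (hb : ∀ n, ∀ z ∈ U, ‖F n z‖ ≤ 1) (hlim : ∀ z ∈ U, Tendsto (fun n => F n z) l (𝓝 (G z))) :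
    TendstoLocallyUniformlyOn F G l U := by
  rw [Metric.tendstoLocallyUniformlyOn_iff]
  intro ε hε x hx
  obtain ⟨R, hR, hRU⟩ := Metric.isOpen_iff.1 hU x hx
  have lip (n : ι) (y : ℂ) (hy : y ∈ ball x R) : dist (F n y) (F n x) ≤ 3 / R * dist y x := by
    refine Complex.dist_le_div_mul_dist_of_mapsTo_ball ((hF n).mono hRU) (fun z hz => ?_) hy
    rw [mem_closedBall, dist_eq_norm]
    have h1 := hb n z (hRU hz)
    have h2 := hb n x hx
    have := norm_sub_le (F n z) (F n x)
    linarith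
  have lipG (y : ℂ) (hy : y ∈ ball x R) : dist (G y) (G x) ≤ 3 / R * dist y x :=
    le_of_tendsto ((hlim y (hRU hy)).dist (hlim x hx)) (Eventually.of_forall fun n => lip n y hy)
  refine ⟨ball x (min R (ε * R / 9)), mem_nhdsWithin_of_mem_nhds (ball_mem_nhds _ (by positivity)),
    ?_⟩
  have := (Metric.tendsto_nhds.1 (hlim x hx)) (ε / 3) (by positivity)
  filter_upwards [this] with n hn y hy
  have hyR : y ∈ ball x R := ball_subset_ball (min_le_left _ _) hy
  have hd : dist y x < ε * R / 9 := (mem_ball.1 hy).trans_le (min_le_right _ _)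
  have h3 : 3 / R * dist y x < ε / 3 := by
    calc 3 / R * dist y x < 3 / R * (ε * R / 9) := by gcongr
      _ = ε / 3 := by field_simp; ring
  have h1 := lip n y hyR
  have h2 := lipG y hyR
  have h4 := dist_triangle4 (G y) (G x) (F n x) (F n y)
  rw [dist_comm (G x), dist_comm (F n x) (F n y)] at h4
  linarith

/-- **Hurwitz's theorem**: a locally uniform limit of nonvanishing holomorphic functions
which vanishes somewhere vanishes identically. -/
theorem eqOn_zero_of_tendstoLocallyUniformlyOn {ι : Type*} {l : Filter ι} [l.NeBot] {U : Set ℂ}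
    (hU : IsOpen U) (hUc : IsPreconnected U) {F : ι → ℂ → ℂ} {G : ℂ → ℂ}
    (hF : ∀ n, DifferentiableOn ℂ (F n) U) (hlim : TendstoLocallyUniformlyOn F G l U)
    (hne : ∀ n, ∀ z ∈ U, F n z ≠ 0) {b : ℂ} (hb : b ∈ U) (hGb : G b = 0) : EqOn G 0 U := by
  have hG : DifferentiableOn ℂ G U := hlim.differentiableOn (Eventually.of_forall hF) hU
  have hGa : AnalyticOnNhd ℂ G U := hG.analyticOnNhd hU
  rcases (hGa b hb).eventually_eq_zero_or_eventually_ne_zero with h | h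
  · exact hGa.eqOn_zero_of_preconnected_of_eventuallyEq_zero hUc hb h
  exfalso
  have h' := eventually_nhdsWithin_iff.1 h
  obtain ⟨r, hr, hrU⟩ := Metric.nhds_basis_closedBall.mem_iff.1
    (h'.and (hU.mem_nhds hb))
  have hsub : closedBall b r ⊆ U := fun z hz => (hrU hz).2
  have hsph : sphere b r ⊆ U := sphere_subset_closedBall.trans hsub
  have hnz : ∀ z ∈ sphere b r, G z ≠ 0 := fun z hz =>
    (hrU (sphere_subset_closedBall hz)).1 (ne_of_mem_sphere hz hr.ne')
  obtain ⟨z₀, hz₀, hmin⟩ := (isCompact_sphere b r).exists_isMinOn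
    (NormedSpace.sphere_nonempty.2 hr.le) ((hG.continuousOn.mono hsph).norm)
  set m := ‖G z₀‖ with hm
  have hmpos : 0 < m := norm_pos_iff.2 (hnz z₀ hz₀)
  have hunif : TendstoUniformlyOn F G l (sphere b r) :=
    (tendstoLocallyUniformlyOn_iff_tendstoUniformlyOn_of_compact (isCompact_sphere b r)).1
      (hlim.mono hsph)
  have hev := Metric.tendstoUniformlyOn_iff.1 hunif (m / 2) (by positivity)
  have hlow : ∀ᶠ n in l, m / 2 ≤ ‖F n b‖ := by
    filter_upwards [hev] with n hn
    have hdiff : DiffContOnCl ℂ (fun z => (F n z)⁻¹) (ball b r) := by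
      apply DifferentiableOn.diffContOnCl
      rw [closure_ball b hr.ne']
      exact ((hF n).mono hsub).inv fun z hz => hne n z (hsub hz)
    have := Complex.norm_le_of_forall_mem_frontier_norm_le isBounded_ball hdiff
      (C := (m / 2)⁻¹) (fun z hz => ?_) (subset_closure (mem_ball_self hr))
    · rw [norm_inv] at this
      exact (inv_le_inv₀ (norm_pos_iff.2 (hne n b hb)) (by positivity)).1 this
    · rw [frontier_ball b hr.ne'] at hz
      rw [norm_inv]
      have h1 : m ≤ ‖G z‖ := hmin hz
      have h2 := hn z hz
      rw [dist_eq_norm] at h2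
      have h3 := norm_sub_norm_le (G z) (F n z)
      exact inv_anti₀ (by positivity) (by linarith)
  have := ge_of_tendsto (hlim.tendsto_at hb).norm hlow
  rw [hGb, norm_zero] at this
  linarith

/-- The disc automorphism moving `a` to the origin. -/
noncomputable def discMoebius (a z : ℂ) : ℂ := (z - a) / (1 - star a * z)

theorem one_sub_star_mul_ne_zero {a z : ℂ} (ha : ‖a‖ < 1) (hz : ‖z‖ < 1) : 1 - star a * z ≠ 0 := by
  intro h
  have h1 : ‖star a * z‖ = 1 := by rw [← sub_eq_zero.1 h, norm_one]
  rw [norm_mul, norm_star] at h1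
  nlinarith [norm_nonneg a, norm_nonneg z]

theorem norm_discMoebius_lt_one {a z : ℂ} (ha : ‖a‖ < 1) (hz : ‖z‖ < 1) :
    ‖discMoebius a z‖ < 1 := by
  have h0 := one_sub_star_mul_ne_zero ha hz
  rw [discMoebius, norm_div, div_lt_one (norm_pos_iff.2 h0)]
  apply lt_of_pow_lt_pow_left₀ 2 (norm_nonneg _)
  have h1 : ‖a‖ ^ 2 < 1 := by nlinarith [norm_nonneg a]
  have h2 : ‖z‖ ^ 2 < 1 := by nlinarith [norm_nonneg z]
  rw [Complex.sq_norm, Complex.normSq_apply] at *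
  rw [Complex.sq_norm, Complex.normSq_apply]
  simp only [Complex.sub_re, Complex.sub_im, Complex.mul_re, Complex.mul_im, Complex.one_re,
    Complex.one_im, Complex.star_def, Complex.conj_re, Complex.conj_im]
  nlinarith [mul_pos (sub_pos.2 h1) (sub_pos.2 h2)]

theorem hasDerivAt_discMoebius {a z : ℂ} (ha : ‖a‖ < 1) (hz : ‖z‖ < 1) :
    HasDerivAt (discMoebius a) ((1 - ‖a‖ ^ 2 : ℝ) / (1 - star a * z) ^ 2) z := by
  have h0 := one_sub_star_mul_ne_zero ha hz
  have h1 : HasDerivAt (fun z : ℂ => z - a) 1 z := (hasDerivAt_id z).sub_const a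
  have h2 : HasDerivAt (fun z : ℂ => 1 - star a * z) (-star a) z := by
    simpa using ((hasDerivAt_id z).const_mul (star a)).const_sub 1
  convert! h1.div h2 h0 using 1
  congr 1
  have : ((‖a‖ ^ 2 : ℝ) : ℂ) = star a * a := by
    rw [Complex.sq_norm, Complex.normSq_eq_conj_mul_self, Complex.star_def]
  push_cast at this ⊢
  rw [this]; ring

theorem injOn_discMoebius {a : ℂ} (ha : ‖a‖ < 1) : InjOn (discMoebius a) (ball 0 1) := by
  intro z hz w hw h
  rw [mem_ball_zero_iff] at hz hw
  have h1 := one_sub_star_mul_ne_zero ha hz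
  have h2 := one_sub_star_mul_ne_zero ha hw
  rw [discMoebius, discMoebius, div_eq_div_iff h1 h2] at h
  have h3 : (z - w) * (1 - star a * a) = 0 := by linear_combination h
  rcases mul_eq_zero.1 h3 with h4 | h4
  · exact sub_eq_zero.1 h4
  · exact absurd h4 (one_sub_star_mul_ne_zero ha ha)

/-- Normalised univalent maps of `Ω` into the unit disc. -/
structure IsNormalizedUnivalent (Ω : Set ℂ) (f : ℂ → ℂ) : Prop where
  diff : DifferentiableOn ℂ f Ω
  maps : ∀ z ∈ Ω, ‖f z‖ < 1
  inj : InjOn f Ω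
  zero : f 0 = 0
  deriv_ne : ∀ z ∈ Ω, deriv f z ≠ 0

section

variable {Ω : Set ℂ}

theorem exists_isNormalizedUnivalent (hb : Bornology.IsBounded Ω) :
    ∃ f, IsNormalizedUnivalent Ω f := by
  obtain ⟨C, hC, hCb⟩ := hb.exists_pos_norm_lt
  have hC' : ((C⁻¹ : ℝ) : ℂ) ≠ 0 := by exact_mod_cast (inv_pos.2 hC).ne'
  refine ⟨fun z => (C⁻¹ : ℝ) * z, by fun_prop, fun z hz => ?_, fun z _ w _ h => ?_, by simp,
    fun z _ => ?_⟩
  · rw [norm_mul, Complex.norm_real, norm_of_nonneg (by positivity), inv_mul_lt_one₀ hC]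
    exact hCb z hz
  · exact mul_left_cancel₀ hC' h
  · rw [deriv_const_mul_field, deriv_id'', mul_one]
    exact hC'

theorem IsNormalizedUnivalent.limit {ι : Type*} {l : Filter ι} [l.NeBot] (ho : IsOpen Ω)
    (hc : IsPreconnected Ω) (h0 : 0 ∈ Ω) {F : ι → ℂ → ℂ} {G : ℂ → ℂ}
    (hF : ∀ n, IsNormalizedUnivalent Ω (F n))
    (hlim : ∀ z ∈ Ω, Tendsto (fun n => F n z) l (𝓝 (G z))) (hG : deriv G 0 ≠ 0) :
    IsNormalizedUnivalent Ω G ∧ Tendsto (fun n => deriv (F n) 0) l (𝓝 (deriv G 0)) := by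
  have hlu : TendstoLocallyUniformlyOn F G l Ω :=
    tendstoLocallyUniformlyOn_of_norm_le_one ho (fun n => (hF n).diff)
      (fun n z hz => ((hF n).maps z hz).le) hlim
  have hGd : DifferentiableOn ℂ G Ω :=
    hlu.differentiableOn (Eventually.of_forall fun n => (hF n).diff) ho
  have hlud : TendstoLocallyUniformlyOn (deriv ∘ F) (deriv G) l Ω :=
    hlu.deriv (Eventually.of_forall fun n => (hF n).diff) ho
  have hG0 : G 0 = 0 := by
    refine tendsto_nhds_unique (hlim 0 h0) ?_
    simp only [(hF _).zero]
    exact tendsto_const_nhds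
  have hle : ∀ z ∈ Ω, ‖G z‖ ≤ 1 := fun z hz =>
    le_of_tendsto (hlim z hz).norm (Eventually.of_forall fun n => ((hF n).maps z hz).le)
  have hnc : ∀ c : ℂ, ¬ EqOn G (fun _ => c) Ω := by
    intro c hcon
    apply hG
    have : G =ᶠ[𝓝 0] fun _ => c := hcon.eventuallyEq_of_mem (ho.mem_nhds h0)
    rw [this.deriv_eq, deriv_const]
  refine ⟨⟨hGd, fun z hz => ?_, ?_, hG0, fun z hz hz0 => ?_⟩, hlud.tendsto_at h0⟩
  · refine lt_of_le_of_ne (hle z hz) fun h => hnc (G z) ?_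
    refine Complex.eqOn_of_isPreconnected_of_isMaxOn_norm hc ho hGd hz fun w hw => ?_
    rw [mem_ofPred_eq, Function.comp_apply, Function.comp_apply, h]
    exact hle w hw
  · intro a ha b hb hab
    by_contra hne
    obtain ⟨r, hr, hrs⟩ := Metric.isOpen_iff.1 (ho.sdiff isClosed_singleton : IsOpen (Ω \ {a})) b
      ⟨hb, fun h => hne h.symm⟩
    have hz := eqOn_zero_of_tendstoLocallyUniformlyOn (l := l) (U := ball b r)
      (F := fun n z => F n z - F n a) (G := fun z => G z - G a) isOpen_ball
      (convex_ball b r).isPreconnected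
      (fun n => (((hF n).diff.mono (hrs.trans sdiff_subset)).sub_const _)) ?_ ?_
      (mem_ball_self hr) (by simp [hab])
    · refine hnc (G a) ?_
      refine AnalyticOnNhd.eqOn_of_preconnected_of_eventuallyEq (hGd.analyticOnNhd ho)
        analyticOnNhd_const hc hb ?_
      refine (hz.eventuallyEq_of_mem (ball_mem_nhds b hr)).mono fun z hz => ?_
      simpa [sub_eq_zero] using hz
    · refine TendstoLocallyUniformlyOn.sub (hlu.mono (hrs.trans sdiff_subset)) ?_
      refine TendstoUniformlyOn.tendstoLocallyUniformlyOn ?_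
      exact (hlim a ha).tendstoUniformlyOn_const _
    · intro n z hz hza
      exact (hrs hz).2 ((hF n).inj (hrs hz).1 ha (sub_eq_zero.1 hza))
  · have := eqOn_zero_of_tendstoLocallyUniformlyOn ho hc
      (fun n => (hF n).diff.deriv ho) hlud (fun n => (hF n).deriv_ne) hz hz0
    exact hG (this h0)

theorem norm_deriv_zero_le (ho : IsOpen Ω) (h0 : 0 ∈ Ω) :
    ∃ C, ∀ f, IsNormalizedUnivalent Ω f → ‖deriv f 0‖ ≤ C := by
  obtain ⟨R, hR, hRΩ⟩ := Metric.isOpen_iff.1 ho 0 h0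
  refine ⟨1 / R, fun f hf => ?_⟩
  refine Complex.norm_deriv_le_div_of_mapsTo_ball (hf.diff.mono hRΩ) (fun z hz => ?_) hR
  rw [hf.zero, mem_closedBall_zero_iff]
  exact (hf.maps z (hRΩ hz)).le

theorem exists_extremal_isNormalizedUnivalent (ho : IsOpen Ω) (hc : IsPreconnected Ω) (h0 : 0 ∈ Ω)
    (hb : Bornology.IsBounded Ω) :
    ∃ f, IsNormalizedUnivalent Ω f ∧
      ∀ g, IsNormalizedUnivalent Ω g → ‖deriv g 0‖ ≤ ‖deriv f 0‖ := by
  set S : Set ℝ := {x | ∃ f, IsNormalizedUnivalent Ω f ∧ ‖deriv f 0‖ = x} with hS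
  obtain ⟨f₀, hf₀⟩ := exists_isNormalizedUnivalent hb
  have hne : S.Nonempty := ⟨_, f₀, hf₀, rfl⟩
  have hbdd : BddAbove S := by
    obtain ⟨C, hC⟩ := norm_deriv_zero_le ho h0
    refine ⟨C, ?_⟩
    rintro x ⟨f, hf, rfl⟩
    exact hC f hf
  obtain ⟨u, -, hu, huS⟩ := exists_seq_tendsto_sSup hne hbdd
  choose F hF hFu using huS
  have hpos : 0 < sSup S :=
    (norm_pos_iff.2 (hf₀.deriv_ne 0 h0)).trans_le (le_csSup hbdd ⟨f₀, hf₀, rfl⟩)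
  set l : Ultrafilter ℕ := Ultrafilter.of atTop
  have hl : (l : Filter ℕ) ≤ atTop := Ultrafilter.of_le atTop
  have hlim (z : ℂ) (hz : z ∈ Ω) : ∃ y, Tendsto (fun n => F n z) l (𝓝 y) := by
    obtain ⟨y, -, hy⟩ := (isCompact_closedBall (0 : ℂ) 1).ultrafilter_le_nhds
      (l.map fun n => F n z) (by
        rw [le_principal_iff]
        exact mem_map.2 (Eventually.of_forall fun n =>
          mem_closedBall_zero_iff.2 ((hF n).maps z hz).le))
    exact ⟨y, hy⟩
  choose! G hG using hlim
  have hlu : TendstoLocallyUniformlyOn F G l Ω :=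
    tendstoLocallyUniformlyOn_of_norm_le_one ho (fun n => (hF n).diff)
      (fun n z hz => ((hF n).maps z hz).le) hG
  have hd := ((hlu.deriv (Eventually.of_forall fun n => (hF n).diff) ho).tendsto_at h0).norm
  have heq : ‖deriv G 0‖ = sSup S := by
    refine tendsto_nhds_unique hd ?_
    simp only [Function.comp_apply, hFu]
    exact hu.mono_left hl
  have hGd : deriv G 0 ≠ 0 := by
    rw [← norm_pos_iff, heq]
    exact hpos
  refine ⟨G, (IsNormalizedUnivalent.limit ho hc h0 hF hG hGd).1, fun g hg => ?_⟩
  rw [heq]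
  exact le_csSup hbdd ⟨g, hg, rfl⟩

theorem IsNormalizedUnivalent.surjOn_of_extremal (ho : IsOpen Ω) (h0 : 0 ∈ Ω)
    (hsqrt : ∀ g : ℂ → ℂ, DifferentiableOn ℂ g Ω → (∀ z ∈ Ω, g z ≠ 0) →
      ∃ s : ℂ → ℂ, DifferentiableOn ℂ s Ω ∧ ∀ z ∈ Ω, s z ^ 2 = g z) {f : ℂ → ℂ}
    (hf : IsNormalizedUnivalent Ω f)
    (hmax : ∀ g, IsNormalizedUnivalent Ω g → ‖deriv g 0‖ ≤ ‖deriv f 0‖) :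
    ball 0 1 ⊆ f '' Ω := by
  intro a ha
  by_contra hna
  rw [mem_ball_zero_iff] at ha
  have hdf (z : ℂ) (hz : z ∈ Ω) : HasDerivAt f (deriv f z) z :=
    (hf.diff.differentiableAt (ho.mem_nhds hz)).hasDerivAt
  have ha0 : a ≠ 0 := fun h => hna ⟨0, h0, by rw [hf.zero, h]⟩
  have hgd (z : ℂ) (hz : z ∈ Ω) : HasDerivAt (fun z => discMoebius a (f z))
      ((1 - ‖a‖ ^ 2 : ℝ) / (1 - star a * f z) ^ 2 * deriv f z) z :=
    (hasDerivAt_discMoebius ha (hf.maps z hz)).comp z (hdf z hz)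
  obtain ⟨s, hs, hsg⟩ := hsqrt (fun z => discMoebius a (f z))
    (fun z hz => (hgd z hz).differentiableAt.differentiableWithinAt) (fun z hz => by
      rw [discMoebius]
      refine div_ne_zero (fun h => hna ⟨z, hz, sub_eq_zero.1 h⟩)
        (one_sub_star_mul_ne_zero ha (hf.maps z hz)))
  have hds (z : ℂ) (hz : z ∈ Ω) : HasDerivAt s (deriv s z) z :=
    (hs.differentiableAt (ho.mem_nhds hz)).hasDerivAt
  have hs1 (z : ℂ) (hz : z ∈ Ω) : ‖s z‖ < 1 := by
    have h1 := norm_discMoebius_lt_one ha (hf.maps z hz)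
    rw [← hsg z hz, norm_pow] at h1
    exact (pow_lt_one_iff_of_nonneg (norm_nonneg _) two_ne_zero).1 h1
  have hrel (z : ℂ) (hz : z ∈ Ω) : 2 * s z * deriv s z =
      (1 - ‖a‖ ^ 2 : ℝ) / (1 - star a * f z) ^ 2 * deriv f z := by
    have h1 : HasDerivAt (fun z => s z ^ 2) (2 * s z * deriv s z) z := by
      simpa using (hds z hz).fun_pow 2
    refine h1.unique ((hgd z hz).congr_of_eventuallyEq ?_)
    filter_upwards [ho.mem_nhds hz] with w hw using hsg w hw
  have ha2 : (1 - ‖a‖ ^ 2 : ℝ) ≠ 0 := by nlinarith [norm_nonneg a]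
  have hsd (z : ℂ) (hz : z ∈ Ω) : deriv s z ≠ 0 := by
    intro h
    have h1 := hrel z hz
    rw [h, mul_zero] at h1
    refine mul_ne_zero (div_ne_zero (by exact_mod_cast ha2)
      (pow_ne_zero 2 (one_sub_star_mul_ne_zero ha (hf.maps z hz)))) (hf.deriv_ne z hz) h1.symm
  have hsinj : InjOn s Ω := fun z hz w hw h => by
    apply hf.inj hz hw
    apply injOn_discMoebius ha (mem_ball_zero_iff.2 (hf.maps z hz))
      (mem_ball_zero_iff.2 (hf.maps w hw))
    rw [← hsg z hz, ← hsg w hw, h]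
  set b := s 0 with hb
  have hb1 : ‖b‖ < 1 := hs1 0 h0
  have hhd (z : ℂ) (hz : z ∈ Ω) : HasDerivAt (fun z => discMoebius b (s z))
      ((1 - ‖b‖ ^ 2 : ℝ) / (1 - star b * s z) ^ 2 * deriv s z) z :=
    (hasDerivAt_discMoebius hb1 (hs1 z hz)).comp z (hds z hz)
  have hb2 : (1 - ‖b‖ ^ 2 : ℝ) ≠ 0 := by nlinarith [norm_nonneg b]
  have hh : IsNormalizedUnivalent Ω fun z => discMoebius b (s z) := by
    refine ⟨fun z hz => (hhd z hz).differentiableAt.differentiableWithinAt,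
      fun z hz => norm_discMoebius_lt_one hb1 (hs1 z hz), fun z hz w hw h => ?_, ?_, fun z hz => ?_⟩
    · exact hsinj hz hw (injOn_discMoebius hb1 (mem_ball_zero_iff.2 (hs1 z hz))
        (mem_ball_zero_iff.2 (hs1 w hw)) h)
    · simp [discMoebius, ← hb]
    · rw [(hhd z hz).deriv]
      exact mul_ne_zero (div_ne_zero (by exact_mod_cast hb2)
        (pow_ne_zero 2 (one_sub_star_mul_ne_zero hb1 (hs1 z hz)))) (hsd z hz)
  have hle := hmax _ hh
  rw [(hhd 0 h0).deriv, ← hb] at hle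
  have hbb : (1 - star b * b : ℂ) = (1 - ‖b‖ ^ 2 : ℝ) := by
    rw [Complex.sq_norm, Complex.star_def, ← Complex.normSq_eq_conj_mul_self]
    push_cast; rfl
  have hr0 := congrArg norm (hrel 0 h0)
  have hba : ‖b‖ ^ 2 = ‖a‖ := by
    have := congrArg norm (hsg 0 h0)
    rw [norm_pow] at this
    rw [hb, this]
    simp [discMoebius, hf.zero]
  have hbpos : 0 < 1 - ‖b‖ ^ 2 := by rw [hba]; linarith
  have hapos : 0 < 1 - ‖a‖ ^ 2 := by nlinarith [norm_nonneg a]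
  rw [hbb, norm_mul, norm_div, norm_pow, Complex.norm_real, norm_of_nonneg hbpos.le] at hle
  rw [hf.zero, mul_zero, sub_zero, one_pow, div_one, norm_mul, norm_mul, norm_mul,
    Complex.norm_real, norm_of_nonneg hapos.le, ← hb] at hr0
  have hb0 : 0 < ‖b‖ := by
    rcases (norm_nonneg b).lt_or_eq with h | h
    · exact h
    · rw [← h] at hba
      exact absurd (norm_eq_zero.1 (by linarith : ‖a‖ = 0)) ha0
  have hD : 0 < ‖deriv s 0‖ := norm_pos_iff.2 (hsd 0 h0)
  have h2 : ‖(2 : ℂ)‖ = 2 := by simp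
  rw [h2] at hr0
  have hle' : ‖deriv s 0‖ ≤ ‖deriv f 0‖ * (1 - ‖b‖ ^ 2) := by
    have : (1 - ‖b‖ ^ 2) / (1 - ‖b‖ ^ 2) ^ 2 * ‖deriv s 0‖ = ‖deriv s 0‖ / (1 - ‖b‖ ^ 2) := by
      field_simp
    rw [this, div_le_iff₀ hbpos] at hle
    exact hle
  rw [← hba] at hr0 hapos
  have h3 : ‖deriv s 0‖ * (1 + ‖b‖ ^ 2) ≤ 2 * ‖b‖ * ‖deriv s 0‖ := by
    rw [hr0]
    nlinarith [sq_nonneg ‖b‖]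
  nlinarith [sq_pos_of_pos (sub_pos.2 hb1)]

/-- **Riemann mapping theorem** for bounded domains, in terms of square roots. -/
theorem exists_univalent_image_ball (ho : IsOpen Ω) (hc : IsPreconnected Ω) (h0 : 0 ∈ Ω)
    (hb : Bornology.IsBounded Ω)
    (hsqrt : ∀ g : ℂ → ℂ, DifferentiableOn ℂ g Ω → (∀ z ∈ Ω, g z ≠ 0) →
      ∃ s : ℂ → ℂ, DifferentiableOn ℂ s Ω ∧ ∀ z ∈ Ω, s z ^ 2 = g z) :
    ∃ φ ψ : ℂ → ℂ, DifferentiableOn ℂ φ (ball 0 1) ∧ MapsTo φ (ball 0 1) Ω ∧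
      DifferentiableOn ℂ ψ Ω ∧ MapsTo ψ Ω (ball 0 1) ∧ (∀ z ∈ ball (0 : ℂ) 1, ψ (φ z) = z) ∧
      (∀ z ∈ Ω, φ (ψ z) = z) ∧ φ 0 = 0 := by
  obtain ⟨f, hf, hmax⟩ := exists_extremal_isNormalizedUnivalent ho hc h0 hb
  have hsurj := hf.surjOn_of_extremal ho h0 hsqrt hmax
  have hinv : ∀ w ∈ ball (0 : ℂ) 1, ∃ z ∈ Ω, f z = w := fun w hw => hsurj hw
  choose! φ hφ hfφ using hinv
  have hmaps : MapsTo f Ω (ball 0 1) := fun z hz => mem_ball_zero_iff.2 (hf.maps z hz)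
  have hφf : ∀ z ∈ Ω, φ (f z) = z := fun z hz => hf.inj (hφ _ (hmaps hz)) hz (hfφ _ (hmaps hz))
  have hφ0 : φ 0 = 0 := by simpa [hf.zero] using hφf 0 h0
  have hcont : ∀ w ∈ ball (0 : ℂ) 1, ContinuousAt φ w := by
    intro w hw
    have hs : HasStrictDerivAt f (deriv f (φ w)) (φ w) :=
      (hf.diff.analyticAt (ho.mem_nhds (hφ w hw))).hasStrictDerivAt
    intro V hV
    have h1 : V ∩ Ω ∈ 𝓝 (φ w) := inter_mem hV (ho.mem_nhds (hφ w hw))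
    have h2 : f '' (V ∩ Ω) ∈ 𝓝 w := by
      have := hs.map_nhds_eq (hf.deriv_ne _ (hφ w hw))
      rw [hfφ w hw] at this
      rw [← this]
      exact image_mem_map h1
    rw [mem_map]
    filter_upwards [h2]
    rintro _ ⟨z, ⟨hzV, hzΩ⟩, rfl⟩
    rw [mem_preimage, hφf z hzΩ]
    exact hzV
  refine ⟨φ, f, fun w hw => ?_, hφ, hf.diff, hmaps, hfφ, hφf, hφ0⟩
  have h1 : HasDerivAt f (deriv f (φ w)) (φ w) :=
    (hf.diff.differentiableAt (ho.mem_nhds (hφ w hw))).hasDerivAt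
  refine (HasDerivAt.of_local_left_inverse (hcont w hw) h1 (hf.deriv_ne _ (hφ w hw))
    ?_).differentiableAt.differentiableWithinAt
  filter_upwards [isOpen_ball.mem_nhds hw] with z hz using hfφ z hz

end

section
variable {p q a b c W : ℝ}

theorem lewy_conj_re_im (hW : W ^ 2 = 1 + p ^ 2 + q ^ 2) (h0 : 0 < W) :
    star (1 - (⟨(1 + p ^ 2) / W, p * q / W⟩ : ℂ)) =
      -(⟨p / (1 + W), -q / (1 + W)⟩ : ℂ) ^ 2 * (1 + ⟨(1 + p ^ 2) / W, p * q / W⟩) := by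
  have h1 : 1 + W ≠ 0 := by positivity
  apply Complex.ext <;> simp [pow_two] <;> field_simp <;> grind

theorem lewy_conj_re_im' (hW : W ^ 2 = 1 + p ^ 2 + q ^ 2) (h0 : 0 < W) :
    star (Complex.I - (⟨p * q / W, (1 + q ^ 2) / W⟩ : ℂ)) =
      -(⟨p / (1 + W), -q / (1 + W)⟩ : ℂ) ^ 2 * (Complex.I + ⟨p * q / W, (1 + q ^ 2) / W⟩) := by
  have h1 : 1 + W ≠ 0 := by positivity
  apply Complex.ext <;> simp [pow_two] <;> field_simp <;> grind

/-- ω_u B = ω_v A -/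
theorem lewy_holo (hW : W ^ 2 = 1 + p ^ 2 + q ^ 2) (h0 : 0 < W)
    (hm : (1 + q ^ 2) * a - 2 * p * q * b + (1 + p ^ 2) * c = 0) :
    (⟨a / (1 + W) - p * ((p * a + q * b) / W) / (1 + W) ^ 2,
      -(b / (1 + W) - q * ((p * a + q * b) / W) / (1 + W) ^ 2)⟩ : ℂ) *
        (Complex.I + ⟨p * q / W, (1 + q ^ 2) / W⟩) =
    ⟨b / (1 + W) - p * ((p * b + q * c) / W) / (1 + W) ^ 2,
      -(c / (1 + W) - q * ((p * b + q * c) / W) / (1 + W) ^ 2)⟩ *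
        (1 + ⟨(1 + p ^ 2) / W, p * q / W⟩) := by
  have h1 : 1 + W ≠ 0 := by positivity
  apply Complex.ext <;> simp [pow_two] <;> field_simp <;> grind

theorem lewy_jac (hW : W ^ 2 = 1 + p ^ 2 + q ^ 2) (h0 : 0 < W) :
    (star (⟨a / (1 + W) - p * ((p * a + q * b) / W) / (1 + W) ^ 2,
      -(b / (1 + W) - q * ((p * a + q * b) / W) / (1 + W) ^ 2)⟩ : ℂ) *
      ⟨b / (1 + W) - p * ((p * b + q * c) / W) / (1 + W) ^ 2,
      -(c / (1 + W) - q * ((p * b + q * c) / W) / (1 + W) ^ 2)⟩).im =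
      (b ^ 2 - a * c) / (W * (1 + W) ^ 2) := by
  have h1 : 1 + W ≠ 0 := by positivity
  simp [pow_two]; field_simp; grind

theorem lewy_jac' (hW : W ^ 2 = 1 + p ^ 2 + q ^ 2) (h0 : 0 < W) :
    (star (1 + (⟨(1 + p ^ 2) / W, p * q / W⟩ : ℂ)) *
      (Complex.I + ⟨p * q / W, (1 + q ^ 2) / W⟩)).im = (1 + W) ^ 2 / W := by
  simp [pow_two]; field_simp; grind

end

/-- The real covector on `ℂ` with components `a`, `b`. -/
noncomputable def covec (a b : ℝ) : ℂ →L[ℝ] ℝ := a • Complex.reCLM + b • Complex.imCLM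

/-- The real linear map of `ℂ` sending `1` to `A` and `I` to `B`. -/
noncomputable def realLin (A B : ℂ) : ℂ →L[ℝ] ℂ :=
  Complex.reCLM.smulRight A + Complex.imCLM.smulRight B

theorem covec_apply (a b : ℝ) (z : ℂ) : covec a b z = a * z.re + b * z.im := by simp [covec]

theorem realLin_apply (A B z : ℂ) : realLin A B z = z.re * A + z.im * B := by simp [realLin]

theorem hasFDerivAt_mk {P Q : ℂ → ℝ} {a b c d : ℝ} {z : ℂ} (hP : HasFDerivAt P (covec a b) z)
    (hQ : HasFDerivAt Q (covec c d) z) :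
    HasFDerivAt (fun z => (⟨P z, Q z⟩ : ℂ)) (realLin ⟨a, c⟩ ⟨b, d⟩) z := by
  have h := (Complex.equivRealProdCLM.symm : ℝ × ℝ →L[ℝ] ℂ).hasFDerivAt.comp z (hP.prodMk hQ)
  refine HasFDerivAt.congr_fderiv h ?_
  ext v
  apply Complex.ext
  · simp [realLin_apply, covec_apply]; ring
  · simp [realLin_apply, covec_apply]; ring

theorem hasFDerivAt_div_covec {N M : ℂ → ℝ} {n m k l : ℝ} {z : ℂ}
    (hN : HasFDerivAt N (covec n m) z) (hM : HasFDerivAt M (covec k l) z) (h0 : M z ≠ 0) :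
    HasFDerivAt (fun z => N z / M z)
      (covec (n / M z - N z * k / M z ^ 2) (m / M z - N z * l / M z ^ 2)) z := by
  have h1 := hN.mul ((hasDerivAt_inv h0).comp_hasFDerivAt z hM)
  refine HasFDerivAt.congr_fderiv h1 ?_
  ext v
  change _ = covec _ _ v
  simp only [covec_apply, _root_.smul_apply, _root_.add_apply, Function.comp_apply, smul_eq_mul]
  field_simp
  ring

/-- `p`, `q` are the first and `a`, `b`, `c` the second partial derivatives of a solution of the
minimal surface equation on the disc of radius `R`. -/
structure IsMinimalGradient (R : ℝ) (p q a b c : ℂ → ℝ) : Prop where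
  hp : ∀ z ∈ ball (0 : ℂ) R, HasFDerivAt p (covec (a z) (b z)) z
  hq : ∀ z ∈ ball (0 : ℂ) R, HasFDerivAt q (covec (b z) (c z)) z
  mse : ∀ z ∈ ball (0 : ℂ) R,
    (1 + q z ^ 2) * a z - 2 * p z * q z * b z + (1 + p z ^ 2) * c z = 0

/-- The area element of a graph with gradient `(p, q)`. -/
noncomputable def areaElt (p q : ℂ → ℝ) (z : ℂ) : ℝ := √(1 + p z ^ 2 + q z ^ 2)

/-- The derivative of the conjugate-type map `Y` in direction `1`. -/
noncomputable def lewyU (p q : ℂ → ℝ) (z : ℂ) : ℂ :=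
  ⟨(1 + p z ^ 2) / areaElt p q z, p z * q z / areaElt p q z⟩

/-- The derivative of the conjugate-type map `Y` in direction `I`. -/
noncomputable def lewyV (p q : ℂ → ℝ) (z : ℂ) : ℂ :=
  ⟨p z * q z / areaElt p q z, (1 + q z ^ 2) / areaElt p q z⟩

/-- The stereographic projection of the Gauss map. -/
noncomputable def gaussMap (p q : ℂ → ℝ) (z : ℂ) : ℂ :=
  ⟨p z / (1 + areaElt p q z), -q z / (1 + areaElt p q z)⟩

theorem areaElt_pos (p q : ℂ → ℝ) (z : ℂ) : 0 < areaElt p q z := Real.sqrt_pos.2 (by positivity)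

theorem areaElt_sq (p q : ℂ → ℝ) (z : ℂ) : areaElt p q z ^ 2 = 1 + p z ^ 2 + q z ^ 2 :=
  Real.sq_sqrt (by positivity)

namespace IsMinimalGradient

variable {R : ℝ} {p q a b c : ℂ → ℝ}

theorem hasFDerivAt_areaElt (h : IsMinimalGradient R p q a b c) {z : ℂ}
    (hz : z ∈ ball (0 : ℂ) R) : HasFDerivAt (areaElt p q)
    (covec ((p z * a z + q z * b z) / areaElt p q z)
      ((p z * b z + q z * c z) / areaElt p q z)) z := by
  have h1 := (((h.hp z hz).pow 2).const_add 1).add ((h.hq z hz).pow 2)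
  have h2 := h1.sqrt (by simp; positivity)
  refine HasFDerivAt.congr_fderiv h2 ?_
  ext v
  have hW := (areaElt_pos p q z).ne'
  change _ = covec _ _ v
  simp only [covec_apply, areaElt, _root_.smul_apply, _root_.add_apply,
    Pi.add_apply, smul_eq_mul, nsmul_eq_mul] at *
  field_simp
  push_cast
  ring

theorem hasFDerivAt_div_areaElt (h : IsMinimalGradient R p q a b c) {z : ℂ}
    (hz : z ∈ ball (0 : ℂ) R) {N : ℂ → ℝ} {n m : ℝ} (hN : HasFDerivAt N (covec n m) z) :
    HasFDerivAt (fun z => N z / areaElt p q z)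
      (covec (n / areaElt p q z - N z * ((p z * a z + q z * b z) / areaElt p q z) /
        areaElt p q z ^ 2) (m / areaElt p q z - N z * ((p z * b z + q z * c z) / areaElt p q z) /
        areaElt p q z ^ 2)) z := by
  exact hasFDerivAt_div_covec hN (h.hasFDerivAt_areaElt hz) (areaElt_pos p q z).ne'

theorem hasFDerivAt_div_one_add_areaElt (h : IsMinimalGradient R p q a b c) {z : ℂ}
    (hz : z ∈ ball (0 : ℂ) R) {N : ℂ → ℝ} {n m : ℝ} (hN : HasFDerivAt N (covec n m) z) :
    HasFDerivAt (fun z => N z / (1 + areaElt p q z))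
      (covec (n / (1 + areaElt p q z) - N z * ((p z * a z + q z * b z) / areaElt p q z) /
        (1 + areaElt p q z) ^ 2) (m / (1 + areaElt p q z) -
        N z * ((p z * b z + q z * c z) / areaElt p q z) / (1 + areaElt p q z) ^ 2)) z := by
  have hW := areaElt_pos p q z
  exact hasFDerivAt_div_covec hN ((h.hasFDerivAt_areaElt hz).const_add 1) (by positivity)

theorem hasFDerivAt_gaussMap (h : IsMinimalGradient R p q a b c) {z : ℂ}
    (hz : z ∈ ball (0 : ℂ) R) : HasFDerivAt (gaussMap p q)
    (realLin ⟨a z / (1 + areaElt p q z) -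
        p z * ((p z * a z + q z * b z) / areaElt p q z) / (1 + areaElt p q z) ^ 2,
      -(b z / (1 + areaElt p q z) -
        q z * ((p z * a z + q z * b z) / areaElt p q z) / (1 + areaElt p q z) ^ 2)⟩
      ⟨b z / (1 + areaElt p q z) -
        p z * ((p z * b z + q z * c z) / areaElt p q z) / (1 + areaElt p q z) ^ 2,
      -(c z / (1 + areaElt p q z) -
        q z * ((p z * b z + q z * c z) / areaElt p q z) / (1 + areaElt p q z) ^ 2)⟩) z := by
  refine hasFDerivAt_mk (h.hasFDerivAt_div_one_add_areaElt hz (h.hp z hz)) ?_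
  have h1 := (h.hasFDerivAt_div_one_add_areaElt hz (h.hq z hz)).fun_neg
  refine HasFDerivAt.congr_fderiv (h1.congr_of_eventuallyEq (Eventually.of_forall fun w => ?_)) ?_
  · simp [neg_div]
  · ext v
    change -covec _ _ v = covec _ _ v
    simp only [covec_apply]
    ring

theorem exists_hasFDerivAt_lewy (h : IsMinimalGradient R p q a b c) {z : ℂ}
    (hz : z ∈ ball (0 : ℂ) R) : ∃ B C D : ℂ, HasFDerivAt (lewyU p q) (realLin B C) z ∧
    HasFDerivAt (lewyV p q) (realLin C D) z := by
  have hp := h.hp z hz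
  have hq := h.hq z hz
  have e1 : HasFDerivAt (fun z => 1 + p z ^ 2) (covec (2 * p z * a z) (2 * p z * b z)) z := by
    refine HasFDerivAt.congr_fderiv ((hp.pow 2).const_add 1) ?_
    ext v
    change _ = covec _ _ v
    simp [covec_apply]; ring
  have e2 : HasFDerivAt (fun z => 1 + q z ^ 2) (covec (2 * q z * b z) (2 * q z * c z)) z := by
    refine HasFDerivAt.congr_fderiv ((hq.pow 2).const_add 1) ?_
    ext v
    change _ = covec _ _ v
    simp [covec_apply]; ring
  have e3 : HasFDerivAt (fun z => p z * q z)
      (covec (a z * q z + p z * b z) (b z * q z + p z * c z)) z := by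
    refine HasFDerivAt.congr_fderiv (hp.mul hq) ?_
    ext v
    change _ = covec _ _ v
    simp [covec_apply]; ring
  have f1 := h.hasFDerivAt_div_areaElt hz e1
  have f2 := h.hasFDerivAt_div_areaElt hz e2
  have f3 := h.hasFDerivAt_div_areaElt hz e3
  have hU := hasFDerivAt_mk f1 f3
  have hV := hasFDerivAt_mk f3 f2
  refine ⟨_, _, _, hU, hV.congr_fderiv (congrArg (realLin · _) ?_)⟩
  have hW := areaElt_pos p q z
  have hW2 := areaElt_sq p q z
  have hm := h.mse z hz
  apply Complex.ext
  · simp only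
    field_simp
    grind
  · simp only
    field_simp
    grind

end IsMinimalGradient

theorem hasFDerivAt_realLin {U V : ℂ → ℂ} {A B C D z : ℂ} (hU : HasFDerivAt U (realLin A B) z)
    (hV : HasFDerivAt V (realLin C D) z) :
    HasFDerivAt (fun z => realLin (U z) (V z))
      ((ContinuousLinearMap.smulRightL ℝ ℂ ℂ Complex.reCLM).comp (realLin A B) +
        (ContinuousLinearMap.smulRightL ℝ ℂ ℂ Complex.imCLM).comp (realLin C D)) z :=
  ((ContinuousLinearMap.smulRightL ℝ ℂ ℂ Complex.reCLM).hasFDerivAt.comp z hU).add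
    ((ContinuousLinearMap.smulRightL ℝ ℂ ℂ Complex.imCLM).hasFDerivAt.comp z hV)

/-- A real linear change of variables intertwining derivatives produces a complex derivative. -/
theorem hasDerivAt_comp_inverse {ζ χ k : ℂ → ℂ} {w lam : ℂ} {L : ℂ →L[ℝ] ℂ}
    (hL : Function.Injective L) (hχ : ContinuousAt χ w) (hζ : HasFDerivAt ζ L (χ w))
    (hinv : ∀ᶠ y in 𝓝 w, ζ (χ y) = y) (hk : HasFDerivAt k (lam • L) (χ w)) :
    HasDerivAt (fun y => k (χ y)) lam w := by
  let e : ℂ ≃L[ℝ] ℂ := (LinearEquiv.ofInjectiveEndo (L : ℂ →ₗ[ℝ] ℂ) hL).toContinuousLinearEquiv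
  have he : (e : ℂ →L[ℝ] ℂ) = L := by ext v; rfl
  have h1 : HasFDerivAt χ (e.symm : ℂ →L[ℝ] ℂ) w :=
    HasFDerivAt.of_local_left_inverse hχ (he ▸ hζ) hinv
  have h2 := hk.comp w h1
  rw [hasDerivAt_iff_hasFDerivAt]
  refine hasFDerivAt_of_restrictScalars ℝ h2 ?_
  rw [← he]
  ext v; simp [mul_comm]

theorem hasDerivAt_of_sq_eq {s g : ℂ → ℂ} {z g' : ℂ} (hs : ContinuousAt s z)
    (hg : HasDerivAt g g' z) (hsg : ∀ᶠ w in 𝓝 z, s w ^ 2 = g w) (h0 : s z ≠ 0) :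
    HasDerivAt s (g' / (2 * s z)) z := by
  rw [hasDerivAt_iff_tendsto_slope] at hg ⊢
  have h1 : Tendsto (fun w => slope g z w / (s w + s z)) (𝓝[≠] z) (𝓝 (g' / (2 * s z))) := by
    refine hg.div ?_ (by simpa using h0)
    rw [two_mul]
    exact (hs.tendsto.mono_left nhdsWithin_le_nhds).add tendsto_const_nhds
  refine h1.congr' ?_
  have h2 : ∀ᶠ w in 𝓝 z, s w + s z ≠ 0 := by
    refine (hs.add continuousAt_const).eventually_ne ?_
    change s z + s z ≠ 0
    rw [← two_mul]
    exact mul_ne_zero two_ne_zero h0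
  filter_upwards [nhdsWithin_le_nhds hsg, nhdsWithin_le_nhds h2,
    self_mem_nhdsWithin] with w hw h3 h4
  have h5 : w - z ≠ 0 := sub_ne_zero.2 h4
  rw [slope_def_field, slope_def_field, ← hw, ← hsg.self_of_nhds]
  field_simp
  ring

theorem IsMinimalGradient.exists_primitive {R : ℝ} {p q a b c : ℂ → ℝ}
    (h : IsMinimalGradient R p q a b c) :
    ∃ Y : ℂ → ℂ, Y 0 = 0 ∧
      ∀ z ∈ ball (0 : ℂ) R, HasFDerivAt Y (realLin (lewyU p q z) (lewyV p q z)) z := by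
  have hd (z : ℂ) (hz : z ∈ ball (0 : ℂ) R) := h.exists_hasFDerivAt_lewy hz
  obtain ⟨Y, hY⟩ := (convex_ball (0 : ℂ) R).exists_forall_hasFDerivAt_of_fderiv_symmetric
    isOpen_ball (ω := fun z => realLin (lewyU p q z) (lewyV p q z))
    (fun z hz => by
      obtain ⟨A, B, C, hU, hV⟩ := hd z hz
      exact (hasFDerivAt_realLin hU hV).differentiableAt.differentiableWithinAt)
    (fun z hz x y => by
      obtain ⟨A, B, C, hU, hV⟩ := hd z hz
      rw [(hasFDerivAt_realLin hU hV).fderiv]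
      simp [realLin_apply]
      ring)
  exact ⟨fun z => Y z - Y 0, sub_self _, fun z hz => (hY z hz).sub_const _⟩

theorem re_star_mul_lewy_nonneg (p q : ℂ → ℝ) (z v : ℂ) :
    0 ≤ (star v * realLin (lewyU p q z) (lewyV p q z) v).re := by
  have hW := areaElt_pos p q z
  have : (star v * realLin (lewyU p q z) (lewyV p q z) v).re =
      (v.re ^ 2 + v.im ^ 2 + (p z * v.re + q z * v.im) ^ 2) / areaElt p q z := by
    simp [realLin_apply, lewyU, lewyV]
    field_simp
    ring
  rw [this]
  positivity

theorem re_star_sub_mul_nonneg {R : ℝ} {p q : ℂ → ℝ} {Y : ℂ → ℂ}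
    (hY : ∀ z ∈ ball (0 : ℂ) R, HasFDerivAt Y (realLin (lewyU p q z) (lewyV p q z)) z)
    {x y : ℂ} (hx : x ∈ ball (0 : ℂ) R) (hy : y ∈ ball (0 : ℂ) R) :
    0 ≤ (star (y - x) * (Y y - Y x)).re := by
  let l : ℂ →L[ℝ] ℝ := Complex.reCLM.comp (ContinuousLinearMap.mul ℝ ℂ (star (y - x)))
  have hl (w : ℂ) : l w = (star (y - x) * w).re := rfl
  obtain ⟨z, hz, h⟩ := domain_mvt (f := fun w => l (Y w))
    (f' := fun w => l.comp (realLin (lewyU p q w) (lewyV p q w)))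
    (fun w hw => (l.hasFDerivAt.comp w (hY w hw)).hasFDerivWithinAt) (convex_ball (0 : ℂ) R) hx hy
  rw [← hl, map_sub, h]
  exact re_star_mul_lewy_nonneg p q z _

/-- The map `z + Y z` expands distances. -/
theorem norm_sub_le_norm_add_sub {R : ℝ} {p q : ℂ → ℝ} {Y : ℂ → ℂ}
    (hY : ∀ z ∈ ball (0 : ℂ) R, HasFDerivAt Y (realLin (lewyU p q z) (lewyV p q z)) z)
    {x y : ℂ} (hx : x ∈ ball (0 : ℂ) R) (hy : y ∈ ball (0 : ℂ) R) :
    ‖y - x‖ ≤ ‖(y + Y y) - (x + Y x)‖ := by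
  have h1 := re_star_sub_mul_nonneg hY hx hy
  have h2 : ‖y - x‖ ^ 2 ≤ ‖y - x‖ * ‖(y + Y y) - (x + Y x)‖ := by
    calc ‖y - x‖ ^ 2 ≤ (star (y - x) * ((y + Y y) - (x + Y x))).re := by
          rw [Complex.sq_norm, Complex.normSq_apply]
          simp at h1 ⊢
          linarith
      _ ≤ ‖star (y - x) * ((y + Y y) - (x + Y x))‖ := Complex.re_le_norm _
      _ = _ := by rw [norm_mul, norm_star]
  rcases (norm_nonneg (y - x)).eq_or_lt with h | h
  · rw [← h]; positivity
  · rw [pow_two] at h2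
    exact le_of_mul_le_mul_left h2 h

/-- Isothermal coordinates `χ` on a bounded plane domain for a minimal graph over the unit disc,
with inverse `ζ`, antiholomorphic part `Ψ` and Gauss map `ω`. -/
structure IsIsothermalChart (Ω : Set ℂ) (ζ χ Ψ ω : ℂ → ℂ) : Prop where
  isOpen : IsOpen Ω
  isBounded : Bornology.IsBounded Ω
  ball_subset : ball 0 1 ⊆ Ω
  mapsTo_inv : MapsTo ζ (ball 0 1) Ω
  mapsTo : MapsTo χ Ω (ball 0 1)
  left_inv : ∀ z ∈ ball (0 : ℂ) 1, χ (ζ z) = z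
  right_inv : ∀ w ∈ Ω, ζ (χ w) = w
  continuousOn_inv : ContinuousOn ζ (ball 0 1)
  inv_zero : ζ 0 = 0
  hasDerivAt : ∀ w ∈ Ω, HasDerivAt Ψ (-(ω w) ^ 2) w
  two_mul_eq : ∀ w ∈ Ω, 2 * χ w = w + star (Ψ w)
  differentiableOn : DifferentiableOn ℂ ω Ω
  norm_lt_one : ∀ w ∈ Ω, ‖ω w‖ < 1

theorem norm_sq_gaussMap (p q : ℂ → ℝ) (z : ℂ) :
    ‖gaussMap p q z‖ ^ 2 = (areaElt p q z - 1) / (1 + areaElt p q z) := by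
  have hW := areaElt_pos p q z
  have hW2 := areaElt_sq p q z
  rw [Complex.sq_norm, Complex.normSq_apply, gaussMap]
  simp only
  field_simp
  linarith

theorem norm_gaussMap_lt_one (p q : ℂ → ℝ) (z : ℂ) : ‖gaussMap p q z‖ < 1 := by
  have hW := areaElt_pos p q z
  have h := norm_sq_gaussMap p q z
  have : ‖gaussMap p q z‖ ^ 2 < 1 := by
    rw [h, div_lt_one (by positivity)]
    linarith
  exact (pow_lt_one_iff_of_nonneg (norm_nonneg _) two_ne_zero).1 this

theorem IsMinimalGradient.hasFDerivAt_gaussMap_smul {R : ℝ} {p q a b c : ℂ → ℝ}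
    (h : IsMinimalGradient R p q a b c) {z : ℂ} (hz : z ∈ ball (0 : ℂ) R) :
    ∃ lam : ℂ, HasFDerivAt (gaussMap p q)
      (lam • realLin (1 + lewyU p q z) (Complex.I + lewyV p q z)) z ∧
      ‖lam‖ ^ 2 * (1 + areaElt p q z) ^ 4 = b z ^ 2 - a z * c z := by
  have hW := areaElt_pos p q z
  have hW2 := areaElt_sq p q z
  have hd := h.hasFDerivAt_gaussMap hz
  have hB := lewy_holo hW2 hW (h.mse z hz)
  have hJ := lewy_jac (a := a z) (b := b z) (c := c z) hW2 hW
  have hJ' := lewy_jac' hW2 hW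
  set A := 1 + lewyU p q z with hA
  set B := Complex.I + lewyV p q z
  change _ * B = _ * A at hB
  change (star A * B).im = _ at hJ'
  have hA0 : A ≠ 0 := by
    intro h0
    have := congrArg Complex.re h0
    simp only [hA, lewyU, Complex.add_re, Complex.one_re, Complex.zero_re] at this
    have h1 : 0 ≤ (1 + p z ^ 2) / areaElt p q z := by positivity
    linarith
  set S : ℂ := ⟨a z / (1 + areaElt p q z) -
        p z * ((p z * a z + q z * b z) / areaElt p q z) / (1 + areaElt p q z) ^ 2,
      -(b z / (1 + areaElt p q z) -
        q z * ((p z * a z + q z * b z) / areaElt p q z) / (1 + areaElt p q z) ^ 2)⟩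
  set T : ℂ := ⟨b z / (1 + areaElt p q z) -
        p z * ((p z * b z + q z * c z) / areaElt p q z) / (1 + areaElt p q z) ^ 2,
      -(c z / (1 + areaElt p q z) -
        q z * ((p z * b z + q z * c z) / areaElt p q z) / (1 + areaElt p q z) ^ 2)⟩
  have hS : S = S / A * A := by field_simp
  have hT : T = S / A * B := by field_simp; rw [hB]
  refine ⟨S / A, hd.congr_fderiv ?_, ?_⟩
  · ext v
    simp only [realLin_apply, _root_.smul_apply, smul_eq_mul]
    rw [hT]
    nth_rw 1 [hS]
    ring
  · have h1 : (star S * T).im = ‖S / A‖ ^ 2 * (star A * B).im := by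
      have key (l : ℂ) : (star (l * A) * (l * B)).im = ‖l‖ ^ 2 * (star A * B).im := by
        rw [Complex.sq_norm, Complex.normSq_apply]
        simp
        ring
      rw [← key, ← hT, ← hS]
    rw [hJ, hJ'] at h1
    field_simp at h1
    linarith

theorem injective_realLin_lewy (p q : ℂ → ℝ) (z : ℂ) :
    Function.Injective (realLin (1 + lewyU p q z) (Complex.I + lewyV p q z)) := by
  rw [injective_iff_map_eq_zero]
  intro v hv
  have h1 := re_star_mul_lewy_nonneg p q z v
  have h2 : realLin (lewyU p q z) (lewyV p q z) v = -v := by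
    rw [realLin_apply] at hv ⊢
    linear_combination hv - Complex.re_add_im v
  rw [h2, mul_neg, Complex.neg_re] at h1
  have h3 : Complex.normSq v = (star v * v).re := by
    rw [Complex.normSq_apply]
    simp
  have h4 := Complex.normSq_nonneg v
  exact Complex.normSq_eq_zero.1 (by linarith)

theorem IsMinimalGradient.exists_isIsothermalChart {R : ℝ} {p q a b c : ℂ → ℝ} (hR : 1 < R)
    (h : IsMinimalGradient R p q a b c) :
    ∃ (Ω : Set ℂ) (ζ χ Ψ ω : ℂ → ℂ), IsIsothermalChart Ω ζ χ Ψ ω ∧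
      ω 0 = gaussMap p q 0 ∧
      ‖deriv ω 0‖ ^ 2 * (1 + areaElt p q 0) ^ 4 = b 0 ^ 2 - a 0 * c 0 := by
  obtain ⟨Y, hY0, hY⟩ := h.exists_primitive
  set ζ : ℂ → ℂ := fun z => z + Y z with hζdef
  have hsub : closedBall (0 : ℂ) 1 ⊆ ball 0 R := closedBall_subset_ball hR
  have hsub' : ball (0 : ℂ) 1 ⊆ ball 0 R := ball_subset_closedBall.trans hsub
  have hexp {x y : ℂ} (hx : x ∈ ball (0 : ℂ) R) (hy : y ∈ ball (0 : ℂ) R) :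
      ‖y - x‖ ≤ ‖ζ y - ζ x‖ := norm_sub_le_norm_add_sub hY hx hy
  have hζ (z : ℂ) (hz : z ∈ ball (0 : ℂ) R) :
      HasFDerivAt ζ (realLin (1 + lewyU p q z) (Complex.I + lewyV p q z)) z := by
    refine ((hasFDerivAt_id z).add (hY z hz)).congr_fderiv ?_
    ext v
    simp only [realLin_apply, _root_.add_apply, ContinuousLinearMap.id_apply]
    linear_combination -Complex.re_add_im v
  have hη (z : ℂ) (hz : z ∈ ball (0 : ℂ) R) : HasFDerivAt (fun z => star (z - Y z))
      (-(gaussMap p q z) ^ 2 • realLin (1 + lewyU p q z) (Complex.I + lewyV p q z)) z := by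
    have h1 := (Complex.conjCLE : ℂ →L[ℝ] ℂ).hasFDerivAt.comp z
      ((hasFDerivAt_id z).sub (hY z hz))
    refine HasFDerivAt.congr_fderiv h1 ?_
    have e1 := lewy_conj_re_im (areaElt_sq p q z) (areaElt_pos p q z)
    have e2 := lewy_conj_re_im' (areaElt_sq p q z) (areaElt_pos p q z)
    change star (1 - lewyU p q z) = -(gaussMap p q z) ^ 2 * (1 + lewyU p q z) at e1
    change star (Complex.I - lewyV p q z) =
      -(gaussMap p q z) ^ 2 * (Complex.I + lewyV p q z) at e2
    ext v
    have e3 : (Complex.conjCLE : ℂ →L[ℝ] ℂ).comp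
        (ContinuousLinearMap.id ℝ ℂ - realLin (lewyU p q z) (lewyV p q z)) v =
        v.re * star (1 - lewyU p q z) + v.im * star (Complex.I - lewyV p q z) := by
      have : (ContinuousLinearMap.id ℝ ℂ - realLin (lewyU p q z) (lewyV p q z)) v =
          v.re * (1 - lewyU p q z) + v.im * (Complex.I - lewyV p q z) := by
        simp only [realLin_apply, _root_.sub_apply, ContinuousLinearMap.id_apply]
        linear_combination -Complex.re_add_im v
      rw [ContinuousLinearMap.comp_apply, this]
      simp
    rw [e3, e1, e2]
    simp only [realLin_apply, _root_.smul_apply, smul_eq_mul]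
    ring
  have hcont : ContinuousOn ζ (ball 0 R) := fun z hz =>
    (hζ z hz).continuousAt.continuousWithinAt
  have hinj : InjOn ζ (ball 0 R) := fun x hx y hy hxy => by
    have := hexp hx hy
    rw [hxy, sub_self, norm_zero] at this
    exact (sub_eq_zero.1 (norm_le_zero_iff.1 this)).symm
  have hζ0 : ζ 0 = 0 := by simp [hζdef, hY0]
  have h0R : (0 : ℂ) ∈ ball (0 : ℂ) R := mem_ball_self (by linarith)
  have h0 : (0 : ℂ) ∈ ball (0 : ℂ) 1 := mem_ball_self one_pos
  set Ω := ζ '' ball 0 1 with hΩ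
  have hLcont (z : ℂ) (hz : z ∈ ball (0 : ℂ) R) : ContinuousAt
      (fun z => realLin (1 + lewyU p q z) (Complex.I + lewyV p q z)) z := by
    obtain ⟨A, B, C, hU, hV⟩ := h.exists_hasFDerivAt_lewy hz
    exact (hasFDerivAt_realLin (hU.const_add 1) (hV.const_add Complex.I)).continuousAt
  have hopen {U : Set ℂ} (hU : U ⊆ ball 0 R) (hUo : IsOpen U) : IsOpen (ζ '' U) := by
    rw [isOpen_iff_mem_nhds]
    rintro _ ⟨z, hz, rfl⟩
    have hst := hasStrictFDerivAt_of_hasFDerivAt_of_continuousAt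
      (eventually_of_mem (isOpen_ball.mem_nhds (hU hz)) hζ) (hLcont z (hU hz))
    rw [← hst.map_nhds_eq_of_surj (LinearMap.range_eq_top.2
      (LinearMap.injective_iff_surjective.1 (injective_realLin_lewy p q z)))]
    exact image_mem_map (hUo.mem_nhds hz)
  have hΩo : IsOpen Ω := hopen hsub' isOpen_ball
  have hcpt : IsCompact (ζ '' closedBall 0 1) :=
    (isCompact_closedBall (0 : ℂ) 1).image_of_continuousOn (hcont.mono hsub)
  have hΩsub : Ω ⊆ ζ '' closedBall 0 1 := image_mono ball_subset_closedBall
  have hinv : ∀ w ∈ Ω, ∃ z ∈ ball (0 : ℂ) 1, ζ z = w := fun w hw => hw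
  choose! χ hχ hζχ using hinv
  have hχζ (z : ℂ) (hz : z ∈ ball (0 : ℂ) 1) : χ (ζ z) = z :=
    hinj (hsub' (hχ _ (mem_image_of_mem ζ hz))) (hsub' hz) (hζχ _ (mem_image_of_mem ζ hz))
  have hχc (w : ℂ) (hw : w ∈ Ω) : ContinuousAt χ w := by
    rw [Metric.continuousAt_iff]
    intro ε hε
    obtain ⟨δ, hδ, hδΩ⟩ := Metric.isOpen_iff.1 hΩo w hw
    refine ⟨min δ ε, by positivity, fun {y} hy => ?_⟩
    have hyΩ : y ∈ Ω := hδΩ (hy.trans_le (min_le_left _ _))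
    have := hexp (hsub' (hχ w hw)) (hsub' (hχ y hyΩ))
    rw [hζχ w hw, hζχ y hyΩ, ← dist_eq_norm, ← dist_eq_norm] at this
    exact this.trans_lt (hy.trans_le (min_le_right _ _))
  have hderiv {k : ℂ → ℂ} {w lam : ℂ} (hw : w ∈ Ω) (hk : HasFDerivAt k
      (lam • realLin (1 + lewyU p q (χ w)) (Complex.I + lewyV p q (χ w))) (χ w)) :
      HasDerivAt (fun y => k (χ y)) lam w :=
    hasDerivAt_comp_inverse (injective_realLin_lewy p q _) (hχc w hw) (hζ _ (hsub' (hχ w hw)))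
      (eventually_of_mem (hΩo.mem_nhds hw) hζχ) hk
  have hχ0 : χ 0 = 0 := by simpa [hζ0] using hχζ 0 h0
  have h0Ω : (0 : ℂ) ∈ Ω := ⟨0, h0, hζ0⟩
  refine ⟨Ω, ζ, χ, fun w => star (χ w - Y (χ w)), fun w => gaussMap p q (χ w),
    ⟨hΩo, hcpt.isBounded.subset hΩsub, ?_, fun z hz => mem_image_of_mem ζ hz, hχ, hχζ, hζχ,
      hcont.mono hsub', hζ0, fun w hw => hderiv (k := fun z => star (z - Y z)) hw
        (hη _ (hsub' (hχ w hw))), fun w hw => ?_, fun w hw => ?_,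
      fun w _ => norm_gaussMap_lt_one p q _⟩, by simp only [hχ0], ?_⟩
  · refine (convex_ball (0 : ℂ) 1).isPreconnected.subset_of_closure_inter_subset hΩo
      ⟨0, h0, h0Ω⟩ ?_
    rintro y ⟨hy, hy1⟩
    obtain ⟨x, hx, rfl⟩ := closure_minimal hΩsub hcpt.isClosed hy
    refine ⟨x, ?_, rfl⟩
    have := hexp h0R (hsub hx)
    rw [hζ0, sub_zero, sub_zero] at this
    rw [mem_ball_zero_iff] at hy1 ⊢
    linarith
  · have := hζχ w hw
    simp only [hζdef] at this
    rw [star_star]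
    linear_combination this
  · obtain ⟨lam, hlam, -⟩ := h.hasFDerivAt_gaussMap_smul (hsub' (hχ w hw))
    exact (hderiv hw hlam).differentiableAt.differentiableWithinAt
  · obtain ⟨lam, hlam, hl⟩ := h.hasFDerivAt_gaussMap_smul h0R
    rw [← hχ0] at hlam
    rw [(hderiv h0Ω hlam).deriv, hl]

theorem isSimplyConnected_of_convex {E : Type*} [AddCommGroup E] [Module ℝ E] [TopologicalSpace E]
    [ContinuousAdd E] [ContinuousSMul ℝ E] {s : Set E} (hs : Convex ℝ s) (hne : s.Nonempty) :
    IsSimplyConnected s := by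
  have := hs.contractibleSpace hne
  exact (inferInstance : SimplyConnectedSpace s)

theorem IsIsothermalChart.exists_sqrt {Ω : Set ℂ} {ζ χ Ψ ω : ℂ → ℂ}
    (h : IsIsothermalChart Ω ζ χ Ψ ω) {g : ℂ → ℂ} (hg : DifferentiableOn ℂ g Ω)
    (hg0 : ∀ z ∈ Ω, g z ≠ 0) : ∃ s : ℂ → ℂ, DifferentiableOn ℂ s Ω ∧ ∀ z ∈ Ω, s z ^ 2 = g z := by
  have hsc : IsSimplyConnected (ball (0 : ℂ) 1) :=
    isSimplyConnected_of_convex (convex_ball (0 : ℂ) 1) ⟨0, mem_ball_self one_pos⟩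
  obtain ⟨s, hs, hsq⟩ := Complex.exists_continuousOn_pow_eq hsc isOpen_ball
    (hg.continuousOn.comp h.continuousOn_inv h.mapsTo_inv)
    (by rintro ⟨z, hz, h0⟩; exact hg0 _ (h.mapsTo_inv hz) h0) two_ne_zero
  have hsq' (w : ℂ) (hw : w ∈ Ω) : s (χ w) ^ 2 = g w := by
    rw [hsq, Function.comp_apply, h.right_inv w hw]
  have hχ : ContinuousOn χ Ω := by
    have h1 : ContinuousOn (fun w => (w + star (Ψ w)) / 2) Ω := fun w hw =>
      ((continuousAt_id.add (h.hasDerivAt w hw).continuousAt.star).div_const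
        2).continuousWithinAt
    refine h1.congr fun w hw => ?_
    simp only [← h.two_mul_eq w hw]
    ring
  refine ⟨fun w => s (χ w), fun w hw => ?_, hsq'⟩
  have hnhds := h.isOpen.mem_nhds hw
  refine (hasDerivAt_of_sq_eq ((hs.comp hχ h.mapsTo).continuousAt hnhds)
    (hg.differentiableAt hnhds).hasDerivAt (eventually_of_mem hnhds hsq') fun h0 => ?_
    ).differentiableAt.differentiableWithinAt
  apply hg0 w hw
  rw [← hsq' w hw]
  change s (χ w) = 0 at h0
  rw [h0]
  simp

/-- Two continuous logarithms on a preconnected set differ by a constant. -/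
theorem sub_eq_sub_of_exp_eq {X : Type*} [TopologicalSpace X] {S : Set X} (hS : IsPreconnected S)
    {L L' : X → ℂ} (hL : ContinuousOn L S) (hL' : ContinuousOn L' S)
    (h : ∀ x ∈ S, Complex.exp (L x) = Complex.exp (L' x)) {x y : X} (hx : x ∈ S) (hy : y ∈ S) :
    L x - L' x = L y - L' y := by
  have hIntg (z : X) (hz : z ∈ S) : ∃ n : ℤ, L z - L' z = n * (2 * π * Complex.I) := by
    obtain ⟨n, hn⟩ := Complex.exp_eq_exp_iff_exists_int.1 (h z hz)
    exact ⟨n, by rw [hn]; ring⟩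
  have him : ContinuousOn (fun z => (L z - L' z).im / (2 * π)) S := by fun_prop
  have hmaps : ∀ z ∈ S, (L z - L' z).im / (2 * π) ∈ range ((↑) : ℤ → ℝ) := by
    intro z hz
    obtain ⟨n, hn⟩ := hIntg z hz
    refine ⟨n, ?_⟩
    rw [hn]
    simp
  have hpre := hS.image _ him
  have hsub : ((fun z => (L z - L' z).im / (2 * π)) '' S).Subsingleton := by
    have hd : IsTotallyDisconnected (range ((↑) : ℤ → ℝ)) :=
      (countable_range _).isTotallyDisconnected
    exact hd _ (by rintro _ ⟨z, hz, rfl⟩; exact hmaps z hz) hpre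
  have heq := hsub (mem_image_of_mem _ hx) (mem_image_of_mem _ hy)
  obtain ⟨n, hn⟩ := hIntg x hx
  obtain ⟨m, hm⟩ := hIntg y hy
  rw [hn, hm] at heq ⊢
  have : (n : ℝ) = m := by
    simp at heq
    exact_mod_cast heq
  rw [show n = m by exact_mod_cast this]

/-- A continuous logarithm of a function with nonzero limit converges. -/
theorem exists_tendsto_of_tendsto_exp {L : ℝ → ℂ} {F : ℂ} (hL : ContinuousOn L (Iio 0))
    (hF : F ≠ 0) (h : Tendsto (fun x => Complex.exp (L x)) (𝓝[<] 0) (𝓝 F)) :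
    ∃ l, Tendsto L (𝓝[<] 0) (𝓝 l) ∧ Complex.exp l = F := by
  have h1 : Tendsto (fun x => Complex.exp (L x) / F) (𝓝[<] 0) (𝓝 1) := by
    simpa [hF] using h.div_const F
  have h2 : ∀ᶠ x in 𝓝[<] (0 : ℝ), Complex.exp (L x) / F ∈ Complex.slitPlane :=
    h1 (Complex.isOpen_slitPlane.mem_nhds Complex.one_mem_slitPlane)
  obtain ⟨ε, hε, hsub⟩ := mem_nhdsLT_iff_exists_Ioo_subset.1 h2
  have hc : ContinuousOn L (Ioo ε 0) := hL.mono fun x hx => hx.2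
  set x₀ := ε / 2
  have hx₀ : x₀ ∈ Ioo ε 0 := by
    have : ε < 0 := hε
    constructor <;> simp only [x₀] <;> linarith
  have hconst (x : ℝ) (hx : x ∈ Ioo ε 0) :
      L x = Complex.log (Complex.exp (L x) / F) +
        (L x₀ - Complex.log (Complex.exp (L x₀) / F)) := by
    have := sub_eq_sub_of_exp_eq (S := Ioo ε 0) isPreconnected_Ioo
      (L := L) (L' := fun x => Complex.log (Complex.exp (L x) / F) + Complex.log F) hc
      ((ContinuousOn.clog (by fun_prop) fun x hx => hsub hx).add continuousOn_const)
      (fun x hx => by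
        rw [Complex.exp_add, Complex.exp_log (Complex.slitPlane_ne_zero (hsub hx)),
          Complex.exp_log hF, div_mul_cancel₀ _ hF]) hx hx₀
    linear_combination this
  have hlim : Tendsto L (𝓝[<] 0)
      (𝓝 (Complex.log 1 + (L x₀ - Complex.log (Complex.exp (L x₀) / F)))) := by
    refine Tendsto.congr' ?_ ((h1.clog Complex.one_mem_slitPlane).add_const _)
    filter_upwards [Ioo_mem_nhdsLT hε] with x hx
    exact (hconst x hx).symm
  exact ⟨_, hlim, tendsto_nhds_unique (Complex.continuous_exp.continuousAt.tendsto.comp hlim) h⟩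

theorem log_neg_of_im_pos {z : ℂ} (hz : 0 < z.im) :
    Complex.log (-z) = Complex.log z - π * Complex.I := by
  rw [Complex.log, Complex.log, norm_neg, Complex.arg_neg_eq_arg_sub_pi_of_im_pos hz]
  push_cast
  ring

theorem log_neg_of_im_neg {z : ℂ} (hz : z.im < 0) :
    Complex.log (-z) = Complex.log z + π * Complex.I := by
  rw [Complex.log, Complex.log, norm_neg, Complex.arg_neg_eq_arg_add_pi_of_im_neg hz]
  push_cast
  ring

/-- A nonvanishing function on a convex set cannot pass from the upper to the lower half plane
both through the right and through the left half plane. -/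
theorem false_of_two_paths {E : Type*} [NormedAddCommGroup E] [NormedSpace ℝ E] {S A B : Set E}
    (hS : Convex ℝ S) (hSo : IsOpen S) {F : E → ℂ} (hF : ContinuousOn F S) (h0 : ∀ x ∈ S, F x ≠ 0)
    (hA : IsPreconnected A) (hB : IsPreconnected B) (hAS : A ⊆ S) (hBS : B ⊆ S)
    (hFA : ∀ x ∈ A, F x ∈ Complex.slitPlane) (hFB : ∀ x ∈ B, -F x ∈ Complex.slitPlane)
    {e c : E} (heA : e ∈ A) (heB : e ∈ B) (hcA : c ∈ A) (hcB : c ∈ B)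
    (he : 0 < (F e).im) (hc : (F c).im < 0) : False := by
  have hsc : IsSimplyConnected S := by
    have := hS.contractibleSpace ⟨e, hAS heA⟩
    exact (inferInstance : SimplyConnectedSpace S)
  have : LocallyPathConnectedSpace E := inferInstance
  obtain ⟨lam, hlam, hexp⟩ := Complex.exists_continuousOn_eqOn_exp_comp hsc hSo hF
    (by rintro ⟨x, hx, h⟩; exact h0 x hx h)
  have h1 := sub_eq_sub_of_exp_eq hA (hlam.mono hAS)
    (ContinuousOn.clog (hF.mono hAS) hFA) (fun x hx => by
      rw [Complex.exp_log (h0 x (hAS hx))]; exact hexp (hAS hx)) heA hcA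
  have h2 := sub_eq_sub_of_exp_eq hB (L' := fun x => Complex.log (-F x) + π * Complex.I)
    (hlam.mono hBS)
    ((ContinuousOn.clog (hF.mono hBS).neg hFB).add continuousOn_const) (fun x hx => by
      rw [Complex.exp_add, Complex.exp_log (neg_ne_zero.2 (h0 x (hBS hx))), Complex.exp_pi_mul_I,
        mul_neg_one, neg_neg]
      exact hexp (hBS hx)) heB hcB
  rw [log_neg_of_im_pos he, log_neg_of_im_neg hc] at h2
  have h3 : (2 * π * Complex.I : ℂ) = 0 := by linear_combination h2 - h1
  exact Complex.two_pi_I_ne_zero h3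

/-- Order preservation for disjoint arcs, in logarithmic coordinates. -/
theorem le_of_disjoint_arcs {L₁ L₂ : ℝ → ℂ} {τ₁ τ₂ T₁ T₂ : ℝ} (hc₁ : ContinuousOn L₁ (Iio 0))
    (hc₂ : ContinuousOn L₂ (Iio 0)) (hne : ∀ x < 0, ∀ x' < 0, L₁ x ≠ L₂ x')
    (hneg₁ : ∀ x < 0, (L₁ x).re < 0) (hneg₂ : ∀ x < 0, (L₂ x).re < 0)
    (hbot₁ : Tendsto (fun x => (L₁ x).re) atBot atBot)
    (hbot₂ : Tendsto (fun x => (L₂ x).re) atBot atBot)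
    (hre₁ : Tendsto (fun x => (L₁ x).re) (𝓝[<] 0) (𝓝 0))
    (hre₂ : Tendsto (fun x => (L₂ x).re) (𝓝[<] 0) (𝓝 0))
    (hτ₁ : Tendsto (fun x => (L₁ x).im) atBot (𝓝 τ₁))
    (hτ₂ : Tendsto (fun x => (L₂ x).im) atBot (𝓝 τ₂))
    (hT₁ : Tendsto (fun x => (L₁ x).im) (𝓝[<] 0) (𝓝 T₁))
    (hT₂ : Tendsto (fun x => (L₂ x).im) (𝓝[<] 0) (𝓝 T₂)) (hτ : τ₁ < τ₂) : T₁ ≤ T₂ := by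
  by_contra! hlt
  -- the region near `-∞`
  obtain ⟨N₁,
    hN₁⟩ := eventually_atBot.1 (hτ₁.eventually_lt_const (by linarith : τ₁ < (τ₁ + τ₂) / 2))
  obtain ⟨N₂,
    hN₂⟩ := eventually_atBot.1 (hτ₂.eventually_const_lt (by linarith : (τ₁ + τ₂) / 2 < τ₂))
  -- the region near `0`
  obtain ⟨d₁, hd₁, hd₁'⟩ := mem_nhdsLT_iff_exists_Ioo_subset.1
    (hT₁.eventually_const_lt (by linarith : (T₁ + T₂) / 2 < T₁))
  obtain ⟨d₂, hd₂, hd₂'⟩ := mem_nhdsLT_iff_exists_Ioo_subset.1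
    (hT₂.eventually_lt_const (by linarith : T₂ < (T₁ + T₂) / 2))
  have hd₁0 : d₁ < 0 := hd₁
  have hd₂0 : d₂ < 0 := hd₂
  set d := max d₁ d₂ / 2 with hd
  have hdneg : d < 0 := by
    have : max d₁ d₂ < 0 := max_lt hd₁0 hd₂0
    linarith
  have hdd₁ : d₁ < d := by
    have := le_max_left d₁ d₂
    have : max d₁ d₂ < 0 := max_lt hd₁0 hd₂0
    linarith
  have hdd₂ : d₂ < d := by
    have := le_max_right d₁ d₂
    have : max d₁ d₂ < 0 := max_lt hd₁0 hd₂0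
    linarith
  set N := min (min N₁ N₂) d with hN
  have hNneg : N < 0 := (min_le_right _ _).trans_lt hdneg
  -- lower bound of the real parts away from `-∞`
  have hlow {L : ℝ → ℂ} (hc : ContinuousOn L (Iio 0))
      (hre : Tendsto (fun x => (L x).re) (𝓝[<] 0) (𝓝 0)) : ∃ C : ℝ, ∀ x,
        N ≤ x → x < 0 → C ≤ (L x).re := by
    obtain ⟨d', hd'0, hd'⟩ := mem_nhdsLT_iff_exists_Ioo_subset.1
      (hre.eventually_const_lt (by norm_num : (-1 : ℝ) < 0))
    have hd'1 : d' < 0 := hd'0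
    obtain ⟨C, hC⟩ := (isCompact_Icc (a := N) (b := d' / 2)).bddBelow_image
      (f := fun x => (L x).re) (Complex.continuous_re.comp_continuousOn
        (hc.mono fun x hx => by simp only [mem_Iio]; linarith [hx.2]))
    refine ⟨min C (-1), fun x hx hx0 => ?_⟩
    by_cases h : x ≤ d' / 2
    · exact (min_le_left _ _).trans (hC (mem_image_of_mem _ ⟨hx, h⟩))
    · have : (-1 : ℝ) < (L x).re := hd' (⟨by linarith, hx0⟩ : x ∈ Ioo d' 0)
      exact (min_le_right _ _).trans this.le
  obtain ⟨C₁, hC₁⟩ := hlow hc₁ hre₁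
  obtain ⟨C₂, hC₂⟩ := hlow hc₂ hre₂
  obtain ⟨M, hM₁, hM₂, hMN⟩ := ((hbot₁.eventually_lt_atBot C₂).and
    ((hbot₂.eventually_lt_atBot C₁).and (eventually_lt_atBot N))).exists
  -- upper bound of the real parts away from `0`
  have hup {L : ℝ → ℂ} (hc : ContinuousOn L (Iio 0)) (hneg : ∀ x < 0, (L x).re < 0) :
      ∃ C < (0 : ℝ), ∀ x ∈ Icc M d, (L x).re ≤ C := by
    obtain ⟨x₀, hx₀, hmax⟩ := (isCompact_Icc (a := M) (b := d)).exists_isMaxOn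
      (f := fun x => (L x).re) (nonempty_Icc.2 (by linarith [min_le_right (min N₁ N₂) d]))
      (Complex.continuous_re.comp_continuousOn
        (hc.mono fun x hx => by simp only [mem_Iio]; linarith [hx.2]))
    exact ⟨_, hneg x₀ (by linarith [hx₀.2]), fun x hx => hmax hx⟩
  obtain ⟨D₁, hD₁0, hD₁⟩ := hup hc₁ hneg₁
  obtain ⟨D₂, hD₂0, hD₂⟩ := hup hc₂ hneg₂
  obtain ⟨ε, ⟨hε₁, hε₂⟩, hεd, hε0⟩ := ((((hre₁.eventually_const_lt hD₂0).and
    (hre₂.eventually_const_lt hD₁0)).and (Ioo_mem_nhdsLT hdneg)).exists)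
  have hearly (x x' : ℝ) (hx : x ≤ N) (hx' : x' ≤ N) : 0 < (L₂ x' - L₁ x).im := by
    have h1 : (L₁ x).im < (τ₁ + τ₂) / 2 :=
      hN₁ x (hx.trans ((min_le_left _ _).trans (min_le_left _ _)))
    have h2 : (τ₁ + τ₂) / 2 < (L₂ x').im :=
      hN₂ x' (hx'.trans ((min_le_left _ _).trans (min_le_right _ _)))
    rw [Complex.sub_im]
    linarith
  have hlate (x x' : ℝ) (hx : x ∈ Ico d 0) (hx' : x' ∈ Ico d 0) : (L₂ x' - L₁ x).im < 0 := by
    have h1 : (T₁ + T₂) / 2 < (L₁ x).im :=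
      hd₁' (⟨hdd₁.trans_le hx.1, hx.2⟩ : x ∈ Ioo d₁ 0)
    have h2 : (L₂ x').im < (T₁ + T₂) / 2 :=
      hd₂' (⟨hdd₂.trans_le hx'.1, hx'.2⟩ : x' ∈ Ioo d₂ 0)
    rw [Complex.sub_im]
    linarith
  have hNd : N ≤ d := min_le_right _ _
  have hMε : M ≤ ε := by linarith
  have pre {P Q : Set (ℝ × ℝ)} {x : ℝ × ℝ} (hP : IsPreconnected P) (hQ : IsPreconnected Q)
      (hxP : x ∈ P) (hxQ : x ∈ Q) : IsPreconnected (P ∪ Q) := hP.union x hxP hxQ hQ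
  refine false_of_two_paths (S := Iio (0 : ℝ) ×ˢ Iio (0 : ℝ))
    (A := ({M} ×ˢ Icc M ε) ∪ (Icc M ε ×ˢ {ε})) (B := (Icc M ε ×ˢ {M}) ∪ ({ε} ×ˢ Icc M ε))
    (F := fun x => L₂ x.2 - L₁ x.1) (e := (M, M)) (c := (ε, ε))
    ((convex_Iio 0).prod (convex_Iio 0)) (isOpen_Iio.prod isOpen_Iio) ?_ ?_ ?_ ?_ ?_ ?_ ?_ ?_
    ?_ ?_ ?_ ?_ (hearly M M hMN.le hMN.le) (hlate ε ε ⟨hεd.le, hε0⟩ ⟨hεd.le, hε0⟩)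
  · exact (hc₂.comp continuousOn_snd fun x hx => hx.2).sub
      (hc₁.comp continuousOn_fst fun x hx => hx.1)
  · exact fun x hx h => hne x.1 hx.1 x.2 hx.2 (sub_eq_zero.1 h).symm
  · exact pre (x := (M, ε)) (isPreconnected_singleton.prod isPreconnected_Icc)
      (isPreconnected_Icc.prod isPreconnected_singleton) ⟨rfl, hMε, le_rfl⟩ ⟨⟨le_rfl, hMε⟩, rfl⟩
  · exact pre (x := (ε, M)) (isPreconnected_Icc.prod isPreconnected_singleton)
      (isPreconnected_singleton.prod isPreconnected_Icc) ⟨⟨hMε, le_rfl⟩, rfl⟩ ⟨rfl, le_rfl, hMε⟩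
  · rintro ⟨x, x'⟩ (⟨rfl, hx'⟩ | ⟨hx, rfl⟩)
    · exact ⟨hMε.trans_lt hε0, hx'.2.trans_lt hε0⟩
    · exact ⟨hx.2.trans_lt hε0, hε0⟩
  · rintro ⟨x, x'⟩ (⟨hx, rfl⟩ | ⟨rfl, hx'⟩)
    · exact ⟨hx.2.trans_lt hε0, hMε.trans_lt hε0⟩
    · exact ⟨hε0, hx'.2.trans_lt hε0⟩
  · rintro ⟨x, x'⟩ (⟨rfl, hx'⟩ | ⟨hx, rfl⟩)
    · by_cases h : x' ≤ N
      · exact Complex.mem_slitPlane_iff.2 (Or.inr (hearly _ _ hMN.le h).ne')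
      · have := hC₂ x' (by linarith) (hx'.2.trans_lt hε0)
        refine Complex.mem_slitPlane_iff.2 (Or.inl ?_)
        simp only [Complex.sub_re]
        linarith
    · by_cases h : x ≤ d
      · have := hD₁ x ⟨hx.1, h⟩
        refine Complex.mem_slitPlane_iff.2 (Or.inl ?_)
        simp only [Complex.sub_re]
        linarith
      · exact Complex.mem_slitPlane_iff.2 (Or.inr (hlate _ _ ⟨by linarith, hx.2.trans_lt hε0⟩
          ⟨hεd.le, hε0⟩).ne)
  · rintro ⟨x, x'⟩ (⟨hx, rfl⟩ | ⟨rfl, hx'⟩)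
    · by_cases h : x ≤ N
      · have := hearly _ _ h hMN.le
        refine Complex.mem_slitPlane_iff.2 (Or.inr ?_)
        rw [Complex.neg_im]
        exact neg_ne_zero.2 this.ne'
      · have := hC₁ x (by linarith) (hx.2.trans_lt hε0)
        refine Complex.mem_slitPlane_iff.2 (Or.inl ?_)
        simp only [Complex.sub_re, Complex.neg_re]
        linarith
    · by_cases h : x' ≤ d
      · have := hD₂ x' ⟨hx'.1, h⟩
        refine Complex.mem_slitPlane_iff.2 (Or.inl ?_)
        simp only [Complex.sub_re, Complex.neg_re]
        linarith
      · have := hlate _ _ ⟨hεd.le, hε0⟩ ⟨by linarith, hx'.2.trans_lt hε0⟩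
        refine Complex.mem_slitPlane_iff.2 (Or.inr ?_)
        rw [Complex.neg_im]
        exact neg_ne_zero.2 this.ne
  · exact Or.inl ⟨rfl, le_rfl, hMε⟩
  · exact Or.inl ⟨⟨le_rfl, hMε⟩, rfl⟩
  · exact Or.inr ⟨⟨hMε, le_rfl⟩, rfl⟩
  · exact Or.inr ⟨rfl, hMε, le_rfl⟩

/-- `h + star g` is a harmonic homeomorphism of the unit disk fixing the origin, with `h`
univalent and bounded and `g` subordinate to `h`. -/
structure IsHarmonicDiscMap (h g : ℂ → ℂ) : Prop where
  diff_h : DifferentiableOn ℂ h (ball 0 1)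
  diff_g : DifferentiableOn ℂ g (ball 0 1)
  h_zero : h 0 = 0
  g_zero : g 0 = 0
  norm_deriv_le : ∀ z ∈ ball (0 : ℂ) 1, ‖deriv g z‖ ≤ ‖deriv h z‖
  norm_deriv_zero_lt : ‖deriv g 0‖ < ‖deriv h 0‖
  injOn_h : InjOn h (ball 0 1)
  isBounded_h : Bornology.IsBounded (h '' ball 0 1)
  injOn : InjOn (fun z => h z + star (g z)) (ball 0 1)
  mapsTo : MapsTo (fun z => h z + star (g z)) (ball 0 1) (ball 0 1)
  proper : ∀ ρ < (1 : ℝ), ∃ δ < (1 : ℝ), ∀ z ∈ ball (0 : ℂ) 1, δ < ‖z‖ → ρ < ‖h z + star (g z)‖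

/-- The angular limit at the origin, up to a constant, of `z ↦ z + β * star z`. -/
noncomputable def originAngle (β : ℂ) (y : ℝ) : ℝ :=
  y + (1 + β * Complex.exp (-(2 * y * Complex.I))).arg

theorem originAngle_aux {β : ℂ} (hβ : ‖β‖ < 1) (y : ℝ) :
    0 < (1 + β * Complex.exp (-(2 * y * Complex.I))).re := by
  have h1 : ‖β * Complex.exp (-(2 * y * Complex.I))‖ < 1 := by
    rw [norm_mul, show -(2 * (y : ℂ) * Complex.I) = ((-2 * y : ℝ) : ℂ) * Complex.I by
      push_cast; ring, Complex.norm_exp_ofReal_mul_I, mul_one]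
    exact hβ
  have h2 := (abs_le.1 (Complex.abs_re_le_norm (β * Complex.exp (-(2 * y * Complex.I))))).1
  rw [Complex.add_re, Complex.one_re]
  linarith

theorem strictMono_originAngle {β : ℂ} (hβ : ‖β‖ < 1) : StrictMono (originAngle β) := by
  intro y₁ y₂ hy
  set v : ℝ → ℂ := fun y => 1 + β * Complex.exp (-(2 * y * Complex.I)) with hv
  have harg (y : ℝ) : |(v y).arg| < π / 2 :=
    Complex.abs_arg_lt_pi_div_two_iff.2 (Or.inl (originAngle_aux hβ y))
  have ha₁ := abs_lt.1 (harg y₁)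
  have ha₂ := abs_lt.1 (harg y₂)
  change y₁ + (v y₁).arg < y₂ + (v y₂).arg
  by_cases hlt : y₂ - y₁ < π
  · have hpolar (y : ℝ) : (‖v y‖ : ℂ) * Complex.exp ((y + (v y).arg : ℝ) * Complex.I) =
        Complex.exp (y * Complex.I) + β * star (Complex.exp (y * Complex.I)) := by
      have hs : star (Complex.exp (y * Complex.I)) = Complex.exp (-(y * Complex.I)) := by
        rw [Complex.star_def, ← Complex.exp_conj]; simp
      rw [hs]
      push_cast
      rw [add_mul, Complex.exp_add]
      have := Complex.norm_mul_exp_arg_mul_I (v y)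
      rw [mul_left_comm, this, hv]
      simp only
      rw [mul_add, mul_one, mul_left_comm, ← Complex.exp_add]
      congr 3
      ring
    have him : ‖v y₁‖ * ‖v y₂‖ * sin (y₂ + (v y₂).arg - (y₁ + (v y₁).arg)) =
        (1 - ‖β‖ ^ 2) * sin (y₂ - y₁) := by
      have h₁ := hpolar y₁
      have h₂ := hpolar y₂
      rw [← Complex.normSq_eq_norm_sq, Complex.normSq_apply]
      have e₁ := congrArg Complex.re h₁
      have e₂ := congrArg Complex.im h₁
      have e₃ := congrArg Complex.re h₂
      have e₄ := congrArg Complex.im h₂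
      simp only [Complex.exp_ofReal_mul_I_re, Complex.exp_ofReal_mul_I_im, Complex.add_re,
        Complex.add_im, Complex.mul_re, Complex.mul_im, Complex.star_def, Complex.conj_re,
        Complex.conj_im, Complex.ofReal_re, Complex.ofReal_im, zero_mul, sub_zero, add_zero]
        at e₁ e₂ e₃ e₄
      rw [sin_sub, sin_sub]
      have s₁ := sin_sq_add_cos_sq y₁
      have s₂ := sin_sq_add_cos_sq y₂
      calc _ = (‖v y₂‖ * sin (y₂ + (v y₂).arg)) * (‖v y₁‖ * cos (y₁ + (v y₁).arg)) -
          (‖v y₂‖ * cos (y₂ + (v y₂).arg)) * (‖v y₁‖ * sin (y₁ + (v y₁).arg)) := by ring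
        _ = _ := by
          rw [e₁, e₂, e₃, e₄]
          ring
    have hpos : 0 < (1 - ‖β‖ ^ 2) * sin (y₂ - y₁) :=
      mul_pos (by nlinarith [norm_nonneg β]) (sin_pos_of_pos_of_lt_pi (by linarith) hlt)
    rw [← him] at hpos
    have hsin := (pos_iff_pos_of_mul_pos hpos).1
      (mul_pos (norm_pos_iff.2 fun h => by simpa [h] using originAngle_aux hβ y₁ |>.trans_eq (congrArg Complex.re h))
        (norm_pos_iff.2 fun h => by simpa [h] using originAngle_aux hβ y₂ |>.trans_eq (congrArg Complex.re h)))
    by_contra! hle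
    have := sin_nonpos_of_nonpos_of_neg_pi_le (x := y₂ + (v y₂).arg - (y₁ + (v y₁).arg))
      (by linarith) (by linarith)
    linarith
  · linarith

namespace IsHarmonicDiscMap

variable {h g : ℂ → ℂ}

theorem continuousOn (H : IsHarmonicDiscMap h g) :
    ContinuousOn (fun z => h z + star (g z)) (ball 0 1) :=
  H.diff_h.continuousOn.add H.diff_g.continuousOn.star

theorem deriv_ne_zero (H : IsHarmonicDiscMap h g) : deriv h 0 ≠ 0 :=
  norm_pos_iff.1 ((norm_nonneg _).trans_lt H.norm_deriv_zero_lt)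

theorem norm_ratio_lt (H : IsHarmonicDiscMap h g) : ‖star (deriv g 0) / deriv h 0‖ < 1 := by
  rw [norm_div, norm_star, div_lt_one (norm_pos_iff.2 H.deriv_ne_zero)]
  exact H.norm_deriv_zero_lt

theorem eq_zero_iff (H : IsHarmonicDiscMap h g) {z : ℂ} (hz : z ∈ ball (0 : ℂ) 1) :
    h z + star (g z) = 0 ↔ z = 0 := by
  constructor
  · intro h0
    refine H.injOn hz (by simp) ?_
    change h z + star (g z) = h 0 + star (g 0)
    rw [h0, H.h_zero, H.g_zero, star_zero, add_zero]
  · rintro rfl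
    simp [H.h_zero, H.g_zero]

theorem exp_mem_ball {ξ : ℂ} (hξ : ξ.re < 0) : Complex.exp ξ ∈ ball (0 : ℂ) 1 := by
  rw [mem_ball_zero_iff, Complex.norm_exp]
  exact exp_lt_one_iff.2 hξ

/-- The quotient of `h z + star (g z)` by its leading holomorphic term. -/
theorem tendsto_quotient (H : IsHarmonicDiscMap h g) (y : ℝ) :
    Tendsto (fun x : ℝ => (h (Complex.exp (x + y * Complex.I)) +
      star (g (Complex.exp (x + y * Complex.I)))) /
        (deriv h 0 * Complex.exp (x + y * Complex.I))) atBot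
      (𝓝 (1 + star (deriv g 0) / deriv h 0 * Complex.exp (-(2 * y * Complex.I)))) := by
  have hz : Tendsto (fun x : ℝ => Complex.exp (x + y * Complex.I)) atBot (𝓝[≠] 0) := by
    refine tendsto_nhdsWithin_iff.2 ⟨?_, Eventually.of_forall fun x => Complex.exp_ne_zero _⟩
    rw [tendsto_zero_iff_norm_tendsto_zero]
    simpa [Complex.norm_exp] using tendsto_exp_atBot
  have hslope {k : ℂ → ℂ} (hk : DifferentiableOn ℂ k (ball 0 1)) (hk0 : k 0 = 0) :
      Tendsto (fun z => k z / z) (𝓝[≠] 0) (𝓝 (deriv k 0)) := by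
    have := (hk.differentiableAt (ball_mem_nhds 0 one_pos)).hasDerivAt.tendsto_slope
    refine this.congr fun z => ?_
    rw [slope_def_field, hk0, sub_zero, sub_zero]
  have h1 := ((hslope H.diff_h H.h_zero).comp hz).div_const (deriv h 0)
  have h2 := (((hslope H.diff_g H.g_zero).comp hz).star.div_const (deriv h 0)).mul_const
    (Complex.exp (-(2 * y * Complex.I)))
  rw [div_self H.deriv_ne_zero] at h1
  refine (h1.add h2).congr fun x => ?_
  have hne := Complex.exp_ne_zero (x + y * Complex.I)
  have hs : star (Complex.exp (x + y * Complex.I)) =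
      Complex.exp (-(2 * y * Complex.I)) * Complex.exp (x + y * Complex.I) := by
    rw [Complex.star_def, ← Complex.exp_conj, ← Complex.exp_add]
    congr 1
    simp
    ring
  have ha := H.deriv_ne_zero
  simp only [Function.comp_apply, star_div₀, hs]
  have he := Complex.exp_ne_zero (-(2 * y * Complex.I))
  field_simp

theorem exists_quotient_mem_slitPlane (H : IsHarmonicDiscMap h g) :
    ∃ N < (0 : ℝ), ∀ ξ : ℂ, ξ.re < N →
      (h (Complex.exp ξ) + star (g (Complex.exp ξ))) / (deriv h 0 * Complex.exp ξ) ∈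
        Complex.slitPlane := by
  have ha := H.deriv_ne_zero
  have hslope {k : ℂ → ℂ} (hk : DifferentiableOn ℂ k (ball 0 1)) (hk0 : k 0 = 0) :
      Tendsto (fun z => k z / z) (𝓝[≠] 0) (𝓝 (deriv k 0)) := by
    have := (hk.differentiableAt (ball_mem_nhds 0 one_pos)).hasDerivAt.tendsto_slope
    refine this.congr fun z => ?_
    rw [slope_def_field, hk0, sub_zero, sub_zero]
  have h1 : Tendsto (fun z => ‖h z / z / deriv h 0 - 1‖ + ‖g z / z‖ / ‖deriv h 0‖) (𝓝[≠] 0)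
      (𝓝 (‖deriv h 0 / deriv h 0 - 1‖ + ‖deriv g 0‖ / ‖deriv h 0‖)) :=
    ((((hslope H.diff_h H.h_zero).div_const _).sub_const _).norm).add
      ((hslope H.diff_g H.g_zero).norm.div_const _)
  have h2 := h1.eventually_lt_const (u := 1) (by
    rw [div_self ha, sub_self, norm_zero, zero_add, div_lt_one (norm_pos_iff.2 ha)]
    exact H.norm_deriv_zero_lt)
  rw [eventually_nhdsWithin_iff, Metric.eventually_nhds_iff] at h2
  obtain ⟨ε, hε, hb⟩ := h2
  refine ⟨min (log ε) (-1), by simp, fun ξ hξ => ?_⟩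
  have hne := Complex.exp_ne_zero ξ
  have hlt : dist (Complex.exp ξ) 0 < ε := by
    rw [dist_zero_right, Complex.norm_exp, ← lt_log_iff_exp_lt hε]
    exact hξ.trans_le (min_le_left _ _)
  have hb := hb hlt hne
  set z := Complex.exp ξ
  refine Complex.mem_slitPlane_of_norm_lt_one (z := _ - 1) ?_ |> fun h => by simpa using h
  calc ‖(h z + star (g z)) / (deriv h 0 * z) - 1‖
      = ‖(h z / z / deriv h 0 - 1) + star (g z) / z / deriv h 0‖ := by
        congr 1; field_simp; ring
    _ ≤ _ := norm_add_le _ _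
    _ = ‖h z / z / deriv h 0 - 1‖ + ‖g z / z‖ / ‖deriv h 0‖ := by
        rw [norm_div (star (g z) / z), norm_div (star (g z)), norm_star, norm_div (g z)]
    _ < 1 := hb

/-- Logarithmic coordinates for a harmonic homeomorphism of the disk. -/
theorem exists_lift (H : IsHarmonicDiscMap h g) : ∃ (L : ℂ → ℂ) (κ : ℝ),
    ContinuousOn L {ξ | ξ.re < 0} ∧
    (∀ ξ : ℂ, ξ.re < 0 → Complex.exp (L ξ) = h (Complex.exp ξ) + star (g (Complex.exp ξ))) ∧
    (∀ ξ : ℂ, ξ.re < 0 → ∀ k : ℤ,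
      L (ξ + k * (2 * π * Complex.I)) = L ξ + k * (2 * π * Complex.I)) ∧
    ∀ y : ℝ, Tendsto (fun x : ℝ => (L (x + y * Complex.I)).im) atBot
      (𝓝 (originAngle (star (deriv g 0) / deriv h 0) y + κ)) := by
  have ha := H.deriv_ne_zero
  have hconv : Convex ℝ {ξ : ℂ | ξ.re < 0} := convex_halfSpace_re_lt 0
  have hopen : IsOpen {ξ : ℂ | ξ.re < 0} := isOpen_lt Complex.continuous_re continuous_const
  have hsc : IsSimplyConnected {ξ : ℂ | ξ.re < 0} := by
    have := hconv.contractibleSpace ⟨-1, by simp⟩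
    exact (inferInstance : SimplyConnectedSpace {ξ : ℂ | ξ.re < 0})
  have hwc : ContinuousOn (fun ξ => h (Complex.exp ξ) + star (g (Complex.exp ξ)))
      {ξ : ℂ | ξ.re < 0} :=
    H.continuousOn.comp Complex.continuous_exp.continuousOn fun ξ hξ => exp_mem_ball hξ
  obtain ⟨L, hL, hexp⟩ := Complex.exists_continuousOn_eqOn_exp_comp hsc hopen hwc
    (by
      rintro ⟨ξ, hξ, h0⟩
      exact Complex.exp_ne_zero ξ ((H.eq_zero_iff (exp_mem_ball hξ)).1 h0))
  have hexp (ξ : ℂ) (hξ : ξ.re < 0) :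
      Complex.exp (L ξ) = h (Complex.exp ξ) + star (g (Complex.exp ξ)) := hexp hξ
  obtain ⟨N, hN, hslit⟩ := H.exists_quotient_mem_slitPlane
  set Q : ℂ → ℂ := fun ξ =>
    (h (Complex.exp ξ) + star (g (Complex.exp ξ))) / (deriv h 0 * Complex.exp ξ) with hQ
  have hQc : ContinuousOn Q {ξ : ℂ | ξ.re < N} :=
    (hwc.mono fun ξ (hξ : ξ.re < N) => hξ.trans hN).div (by fun_prop)
      fun ξ _ => mul_ne_zero ha (Complex.exp_ne_zero ξ)
  set ξ₀ : ℂ := ((N - 1 : ℝ) : ℂ) with hξ₀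
  have hξ₀N : ξ₀.re < N := by rw [hξ₀, Complex.ofReal_re]; linarith
  have hform (ξ : ℂ) (hξ : ξ.re < N) :
      L ξ = ξ + Complex.log (Q ξ) + (L ξ₀ - ξ₀ - Complex.log (Q ξ₀)) := by
    have := sub_eq_sub_of_exp_eq (S := {ξ : ℂ | ξ.re < N})
      (convex_halfSpace_re_lt N).isPreconnected (L := L)
      (L' := fun ξ => ξ + Complex.log (Q ξ) + Complex.log (deriv h 0))
      (hL.mono fun ξ (hξ : ξ.re < N) => hξ.trans hN)
      ((continuousOn_id.add (hQc.clog fun ξ hξ => hslit ξ hξ)).add continuousOn_const)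
      (fun ξ (hξ : ξ.re < N) => by
        rw [hexp ξ (hξ.trans hN), Complex.exp_add, Complex.exp_add,
          Complex.exp_log (Complex.slitPlane_ne_zero (hslit ξ hξ)), Complex.exp_log ha]
        have := Complex.exp_ne_zero ξ
        field_simp) hξ hξ₀N
    linear_combination this
  refine ⟨L, (L ξ₀ - ξ₀ - Complex.log (Q ξ₀)).im, hL, hexp, fun ξ hξ k => ?_, fun y => ?_⟩
  · have hre (ξ : ℂ) : (ξ + k * (2 * π * Complex.I)).re = ξ.re := by simp
    have hper (ξ : ℂ) : Complex.exp (ξ + k * (2 * π * Complex.I)) = Complex.exp ξ := by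
      rw [Complex.exp_add, Complex.exp_int_mul_two_pi_mul_I, mul_one]
    have := sub_eq_sub_of_exp_eq hconv.isPreconnected
      (L := fun ξ => L (ξ + k * (2 * π * Complex.I))) (L' := L)
      (hL.comp (by fun_prop) fun ξ (hξ : ξ.re < 0) => by
        rw [mem_ofPred_eq, hre]; exact hξ) hL
      (fun ξ (hξ : ξ.re < 0) => by
        rw [hexp _ (by rw [hre]; exact hξ), hexp ξ hξ, hper]) hξ
        (show ξ₀ ∈ {ξ : ℂ | ξ.re < 0} from hξ₀N.trans hN)
    have h2 : L (ξ₀ + k * (2 * π * Complex.I)) = L ξ₀ + k * (2 * π * Complex.I) := by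
      rw [hform _ (by rw [hre]; exact hξ₀N)]
      simp only [hQ, hper]
      ring
    rw [h2] at this
    linear_combination this
  · have hlim := (H.tendsto_quotient y).clog
      (Or.inl (originAngle_aux H.norm_ratio_lt y))
    have hlim2 := (Complex.continuous_im.continuousAt.tendsto.comp hlim).const_add y
      |>.add_const (L ξ₀ - ξ₀ - Complex.log (Q ξ₀)).im
    rw [Complex.log_im] at hlim2
    refine hlim2.congr' ?_
    filter_upwards [eventually_lt_atBot N] with x hx
    rw [hform (x + y * Complex.I) (by simpa using hx)]
    simp [hQ]

end IsHarmonicDiscMap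

end

section

open Filter Topology Metric MeasureTheory

theorem abs_det_restrictScalars_smulRight (c : ℂ) :
    |(((1 : ℂ →L[ℂ] ℂ).smulRight c).restrictScalars ℝ).det| = ‖c‖ ^ 2 := by
  have h : (((1 : ℂ →L[ℂ] ℂ).smulRight c).restrictScalars ℝ).det = Complex.normSq c := by
    rw [← Algebra.norm_complex_apply, Algebra.norm_apply, ContinuousLinearMap.det]
    congr 1
    ext
    simp [mul_comm]
  rw [h, Complex.normSq_eq_norm_sq, abs_of_nonneg (by positivity)]

/-- An injective holomorphic function with bounded image on an open set of finite area has
integrable derivative. -/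
theorem lintegral_enorm_deriv_lt_top {F : ℂ → ℂ} {R : Set ℂ} (hR : IsOpen R)
    (hvol : volume R < ⊤) (hF : DifferentiableOn ℂ F R) (hinj : InjOn F R)
    (hb : Bornology.IsBounded (F '' R)) : ∫⁻ ξ in R, ‖deriv F ξ‖ₑ < ⊤ := by
  have harea := lintegral_abs_det_fderiv_eq_addHaar_image volume hR.measurableSet
    (f := F) (f' := fun ξ => ((1 : ℂ →L[ℂ] ℂ).smulRight (deriv F ξ)).restrictScalars ℝ)
    (fun ξ hξ => ((hF.differentiableAt (hR.mem_nhds hξ)).hasDerivAt.hasFDerivAt.restrictScalars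
      ℝ).hasFDerivWithinAt) hinj
  simp only [abs_det_restrictScalars_smulRight] at harea
  calc ∫⁻ ξ in R, ‖deriv F ξ‖ₑ
      ≤ ∫⁻ ξ in R, (1 + ENNReal.ofReal (‖deriv F ξ‖ ^ 2)) := by
        refine lintegral_mono fun ξ => ?_
        rw [← ofReal_norm, ← ENNReal.ofReal_one,
          ← ENNReal.ofReal_add zero_le_one (by positivity)]
        exact ENNReal.ofReal_le_ofReal (by nlinarith [sq_nonneg (‖deriv F ξ‖ - 1)])
    _ = volume R + volume (F '' R) := by
        rw [lintegral_add_left measurable_const, harea]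
        simp
    _ < ⊤ := ENNReal.add_lt_top.2 ⟨hvol, hb.measure_lt_top⟩

theorem exists_tendsto_of_integrableOn_deriv {E : Type*} [NormedAddCommGroup E] [NormedSpace ℝ E]
    [CompleteSpace E] {u u' : ℝ → E}
    (hu : ∀ x ∈ Ioo (-1 : ℝ) 0, HasDerivAt u (u' x) x) (hIntg : IntegrableOn u' (Ioo (-1) 0)) :
    ∃ l, Tendsto u (𝓝[<] 0) (𝓝 l) := by
  have hI : IntegrableOn u' (uIcc (-(1 / 2)) 0) := by
    rw [uIcc_of_le (by norm_num), integrableOn_Icc_iff_integrableOn_Ioo]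
    exact hIntg.mono_set (Ioo_subset_Ioo (by norm_num) le_rfl)
  have hc := (intervalIntegral.continuousOn_primitive_interval hI) 0 right_mem_uIcc
  refine ⟨u (-(1 / 2)) + ∫ t in (-(1 / 2))..(0 : ℝ), u' t, ?_⟩
  have h1 : Tendsto (fun x => ∫ t in (-(1 / 2))..x, u' t) (𝓝[<] 0)
      (𝓝 (∫ t in (-(1 / 2))..(0 : ℝ), u' t)) := by
    refine (hc.tendsto).mono_left ?_
    rw [uIcc_of_le (by norm_num : (-(1 / 2) : ℝ) ≤ 0)]
    refine (nhdsWithin_Ioo_eq_nhdsLT (show (-(1 / 2) : ℝ) < 0 by norm_num)).symm.le.trans ?_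
    exact nhdsWithin_mono _ Ioo_subset_Icc_self
  refine (h1.const_add (u (-(1 / 2)))).congr' ?_
  filter_upwards [Ioo_mem_nhdsLT (show (-(1 / 2) : ℝ) < 0 by norm_num)] with x hx
  rw [intervalIntegral.integral_eq_sub_of_hasDerivAt (f := u)]
  · abel
  · intro t ht
    rw [uIcc_of_le hx.1.le] at ht
    exact hu t ⟨by linarith [ht.1], by linarith [ht.2, hx.2]⟩
  · rw [intervalIntegrable_iff_integrableOn_Ioc_of_le hx.1.le]
    refine hIntg.mono_set fun t ht => ⟨by linarith [ht.1], by linarith [ht.2, hx.2]⟩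

namespace IsHarmonicDiscMap

variable {h g : ℂ → ℂ}

theorem hasDerivAt_comp_exp {k : ℂ → ℂ} (hk : DifferentiableOn ℂ k (ball 0 1)) {ξ : ℂ}
    (hξ : ξ.re < 0) :
    HasDerivAt (fun ξ => k (Complex.exp ξ)) (deriv k (Complex.exp ξ) * Complex.exp ξ) ξ :=
  (hk.differentiableAt (isOpen_ball.mem_nhds (exp_mem_ball hξ))).hasDerivAt.comp ξ
    (Complex.hasDerivAt_exp ξ)

theorem ae_lintegral_lt_top (H : IsHarmonicDiscMap h g) (α : ℝ) :
    ∀ᵐ y : ℝ ∂(volume.restrict (Ioo α (α + 2 * π))),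
      ∫⁻ x in Ioo (-1 : ℝ) 0, ‖deriv (fun ξ => h (Complex.exp ξ)) (x + y * Complex.I)‖ₑ < ⊤ := by
  set F : ℂ → ℂ := fun ξ => h (Complex.exp ξ) with hF
  set R : Set ℂ := Ioo (-1 : ℝ) 0 ×ℂ Ioo α (α + 2 * π) with hRdef
  have hmp := Complex.volume_preserving_equiv_real_prod.symm
  have hpre : Complex.measurableEquivRealProd.symm ⁻¹' R =
      Ioo (-1 : ℝ) 0 ×ˢ Ioo α (α + 2 * π) := by
    ext p
    simp [hRdef, Complex.mem_reProdIm]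
  have hRo : IsOpen R := isOpen_Ioo.reProdIm isOpen_Ioo
  have hvol : volume R < ⊤ := by
    rw [← hmp.measure_preimage hRo.measurableSet.nullMeasurableSet, hpre,
      Measure.volume_eq_prod, Measure.prod_prod]
    simp [ENNReal.mul_lt_top_iff]
  have hre : ∀ ξ ∈ R, ξ.re < 0 := fun ξ hξ => hξ.1.2
  have hfin := lintegral_enorm_deriv_lt_top hRo hvol (F := F)
    (fun ξ hξ => (hasDerivAt_comp_exp H.diff_h (hre ξ hξ)).differentiableAt.differentiableWithinAt)
    (fun ξ hξ ξ' hξ' heq => by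
      have h1 := H.injOn_h (exp_mem_ball (hre ξ hξ)) (exp_mem_ball (hre ξ' hξ')) heq
      obtain ⟨n, hn⟩ := Complex.exp_eq_exp_iff_exists_int.1 h1
      have him := congrArg Complex.im hn
      simp at him
      have i1 := hξ.2
      have i2 := hξ'.2
      simp only [mem_preimage, mem_Ioo] at i1 i2
      have hn0 : n = 0 := by
        have a1 : (n : ℝ) < 1 := by nlinarith [pi_pos]
        have a2 : (-1 : ℝ) < n := by nlinarith [pi_pos]
        have a1 : n < 1 := by exact_mod_cast a1
        have a2 : -1 < n := by exact_mod_cast a2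
        omega
      rw [hn, hn0]
      simp)
    (H.isBounded_h.subset (by
      rintro _ ⟨ξ, hξ, rfl⟩
      exact mem_image_of_mem _ (exp_mem_ball (hre ξ hξ))))
  have hmeas : Measurable fun ξ => ‖deriv F ξ‖ₑ := (measurable_deriv F).enorm
  have hcomp : Measurable fun p => ‖deriv F (Complex.measurableEquivRealProd.symm p)‖ₑ :=
    hmeas.comp Complex.measurableEquivRealProd.symm.measurable
  rw [← hmp.setLIntegral_comp_preimage hRo.measurableSet hmeas, hpre, Measure.volume_eq_prod,
    ← Measure.prod_restrict,
    lintegral_prod_symm' _ hcomp] at hfin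
  have := ae_lt_top (Measurable.lintegral_prod_left' hcomp) hfin.ne
  filter_upwards [this] with y hy
  have hpt (x : ℝ) : (x : ℂ) + y * Complex.I = Complex.measurableEquivRealProd.symm (x, y) := by
    apply Complex.ext <;> simp
  simpa only [hpt] using hy

theorem ae_exists_tendsto (H : IsHarmonicDiscMap h g) :
    ∀ᵐ y : ℝ, (∃ l, Tendsto (fun x : ℝ => h (Complex.exp (x + y * Complex.I))) (𝓝[<] 0) (𝓝 l)) ∧
      ∃ l, Tendsto (fun x : ℝ => g (Complex.exp (x + y * Complex.I))) (𝓝[<] 0) (𝓝 l) := by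
  have hcover : ⋃ k : ℤ, Ioo (k : ℝ) (k + 2 * π) = univ := by
    refine eq_univ_of_forall fun y => mem_iUnion.2 ⟨⌈y⌉ - 1, ?_, ?_⟩
    · push_cast
      linarith [Int.ceil_lt_add_one y]
    · push_cast
      linarith [Int.le_ceil y, pi_gt_three]
  rw [← Measure.restrict_univ (μ := (volume : Measure ℝ)), ← hcover, ae_restrict_iUnion_iff]
  intro k
  filter_upwards [H.ae_lintegral_lt_top k] with y hy
  have hline (x : ℝ) : HasDerivAt (fun x : ℝ => (x : ℂ) + y * Complex.I) 1 x :=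
    (Complex.ofRealCLM.hasDerivAt (x := x)).add_const _
  have hd {k : ℂ → ℂ} (hk : DifferentiableOn ℂ k (ball 0 1)) (x : ℝ) (hx : x ∈ Ioo (-1 : ℝ) 0) :
      HasDerivAt (fun x : ℝ => k (Complex.exp (x + y * Complex.I)))
        (deriv (fun ξ => k (Complex.exp ξ)) (x + y * Complex.I)) x := by
    have := (hasDerivAt_comp_exp hk (ξ := x + y * Complex.I) (by simpa using hx.2))
    rw [this.deriv]
    have h2 := this.comp x (hline x)
    rw [mul_one] at h2
    exact h2
  have hmeas (k : ℂ → ℂ) : Measurable fun x : ℝ =>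
      deriv (fun ξ => k (Complex.exp ξ)) (x + y * Complex.I) :=
    (measurable_deriv _).comp (by fun_prop)
  have hIntg : IntegrableOn (fun x : ℝ => deriv (fun ξ => h (Complex.exp ξ)) (x + y * Complex.I))
      (Ioo (-1) 0) := ⟨(hmeas h).aestronglyMeasurable, hy⟩
  refine ⟨exists_tendsto_of_integrableOn_deriv (hd H.diff_h) hIntg,
    exists_tendsto_of_integrableOn_deriv (hd H.diff_g)
      (Integrable.mono hIntg (hmeas g).aestronglyMeasurable ?_)⟩
  refine (ae_restrict_iff' measurableSet_Ioo).2 (Eventually.of_forall fun x hx => ?_)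
  have hre : ((x : ℂ) + y * Complex.I).re < 0 := by simpa using hx.2
  rw [(hasDerivAt_comp_exp H.diff_g hre).deriv, (hasDerivAt_comp_exp H.diff_h hre).deriv,
    norm_mul, norm_mul]
  exact mul_le_mul_of_nonneg_right (H.norm_deriv_le _ (exp_mem_ball hre)) (norm_nonneg _)

end IsHarmonicDiscMap

/-- A function that is monotone and quasi-periodic on a conull set extends to a function with
these properties on the line. -/
theorem exists_monotone_extension {G : Set ℝ} {T : ℝ → ℝ} {c : ℝ} (hG : ∀ᵐ y : ℝ, y ∈ G)
    (hper : ∀ y, y + c ∈ G ↔ y ∈ G) (hT : ∀ y ∈ G, T (y + c) = T y + c) (hmono : MonotoneOn T G) :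
    ∃ θ : ℝ → ℝ, Monotone θ ∧ (∀ t, θ (t + c) = θ t + c) ∧ EqOn θ T G := by
  have hdense : Dense G := Measure.dense_of_ae hG
  have hne (t : ℝ) : (T '' (G ∩ Iic t)).Nonempty := by
    obtain ⟨y, hy, hyt⟩ := hdense.exists_lt t
    exact ⟨_, mem_image_of_mem _ ⟨hy, hyt.le⟩⟩
  have hbdd (t : ℝ) : BddAbove (T '' (G ∩ Iic t)) := by
    obtain ⟨y, hy, hyt⟩ := hdense.exists_gt t
    refine ⟨T y, ?_⟩
    rintro _ ⟨z, ⟨hz, hzt⟩, rfl⟩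
    exact hmono hz hy (le_trans hzt hyt.le)
  refine ⟨fun t => sSup (T '' (G ∩ Iic t)), fun s t hst => ?_, fun t => ?_, fun y hy => ?_⟩
  · exact csSup_le_csSup (hbdd t) (hne s)
      (image_mono (inter_subset_inter_right _ (Iic_subset_Iic.2 hst)))
  · have h1 := (OrderIso.addRight c).isLUB_image'.2 (isLUB_csSup (hne t) (hbdd t))
    have h2 : OrderIso.addRight c '' (T '' (G ∩ Iic t)) = T '' (G ∩ Iic (t + c)) := by
      ext s
      constructor
      · rintro ⟨_, ⟨y, ⟨hy, hyt⟩, rfl⟩, rfl⟩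
        exact ⟨y + c, ⟨(hper y).2 hy, by simpa using hyt⟩, hT y hy⟩
      · rintro ⟨y, ⟨hy, hyt⟩, rfl⟩
        have hy' : y - c ∈ G := (hper _).1 (by simpa using hy)
        refine ⟨T (y - c), ⟨y - c, ⟨hy', ?_⟩, rfl⟩, ?_⟩
        · simp only [mem_Iic] at hyt ⊢
          linarith
        · have := hT _ hy'
          simp only [OrderIso.addRight_apply]
          rw [← this, sub_add_cancel]
    rw [h2] at h1
    exact h1.csSup_eq (hne _)
  · refine le_antisymm (csSup_le (hne y) ?_) (le_csSup (hbdd y) ⟨y, ⟨hy, self_mem_Iic⟩, rfl⟩)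
    rintro _ ⟨z, ⟨hz, hzt⟩, rfl⟩
    exact hmono hz hy hzt

namespace IsHarmonicDiscMap

variable {h g : ℂ → ℂ}

theorem tendsto_norm (H : IsHarmonicDiscMap h g) (y : ℝ) :
    Tendsto (fun x : ℝ => ‖h (Complex.exp (x + y * Complex.I)) +
      star (g (Complex.exp (x + y * Complex.I)))‖) (𝓝[<] 0) (𝓝 1) := by
  refine tendsto_order.2 ⟨fun ρ hρ => ?_, fun ρ hρ => ?_⟩
  · obtain ⟨δ, hδ, hb⟩ := H.proper ρ hρ
    have hexp : Tendsto (fun x : ℝ => rexp x) (𝓝[<] 0) (𝓝 1) := by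
      simpa using (continuous_exp.tendsto 0).mono_left nhdsWithin_le_nhds
    filter_upwards [hexp.eventually_const_lt hδ, self_mem_nhdsWithin] with x hx hx0
    refine hb _ (exp_mem_ball (by simpa using hx0)) ?_
    simpa [Complex.norm_exp] using hx
  · filter_upwards [self_mem_nhdsWithin] with x hx0
    have := H.mapsTo (exp_mem_ball (ξ := x + y * Complex.I) (by simpa using hx0))
    rw [mem_ball_zero_iff] at this
    exact this.trans hρ

/-- The boundary function of a harmonic homeomorphism of the disk. -/
theorem exists_boundary (H : IsHarmonicDiscMap h g) : ∃ θ : ℝ → ℝ, Monotone θ ∧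
    (∀ t, θ (t + 2 * π) = θ t + 2 * π) ∧
    ∀ᵐ t : ℝ, Tendsto (fun x : ℝ => h (Complex.exp (x + t * Complex.I)) +
      star (g (Complex.exp (x + t * Complex.I)))) (𝓝[<] 0)
        (𝓝 (Complex.exp (θ t * Complex.I))) := by
  obtain ⟨L, κ, hL, hexp, hLper, horigin⟩ := H.exists_lift
  set G : Set ℝ := {y | (∃ l, Tendsto (fun x : ℝ => h (Complex.exp (x + y * Complex.I)))
      (𝓝[<] 0) (𝓝 l)) ∧
    ∃ l, Tendsto (fun x : ℝ => g (Complex.exp (x + y * Complex.I))) (𝓝[<] 0) (𝓝 l)} with hGdef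
  have hG : ∀ᵐ y : ℝ, y ∈ G := H.ae_exists_tendsto
  have hre (x y : ℝ) (hx : x < 0) : ((x : ℂ) + y * Complex.I).re < 0 := by simpa using hx
  have hLray (y : ℝ) : ContinuousOn (fun x : ℝ => L (x + y * Complex.I)) (Iio 0) :=
    hL.comp (by fun_prop) fun x hx => hre x y hx
  have hlim (y : ℝ) (hy : y ∈ G) : ∃ T : ℝ,
      Tendsto (fun x : ℝ => L (x + y * Complex.I)) (𝓝[<] 0) (𝓝 (T * Complex.I)) := by
    obtain ⟨⟨l, hl⟩, m, hm⟩ := hy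
    have hw := hl.add hm.star
    have hnorm : ‖l + star m‖ = 1 := tendsto_nhds_unique hw.norm (H.tendsto_norm y)
    obtain ⟨ℓ, hℓ, hℓe⟩ := exists_tendsto_of_tendsto_exp (hLray y)
      (F := l + star m) (by rw [← norm_pos_iff, hnorm]; exact one_pos)
      (hw.congr' (by
        filter_upwards [self_mem_nhdsWithin] with x hx
        exact (hexp _ (hre x y hx)).symm))
    refine ⟨ℓ.im, ?_⟩
    have hzero : ℓ.re = 0 := by
      rw [← hℓe, Complex.norm_exp] at hnorm
      simpa using hnorm
    convert hℓ using 2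
    apply Complex.ext <;> simp [hzero]
  choose! T hT using hlim
  have hshift (x y : ℝ) : (x : ℂ) + (y + 2 * π : ℝ) * Complex.I =
      (x + y * Complex.I) + (1 : ℤ) * (2 * π * Complex.I) := by
    push_cast
    ring
  have hper (y : ℝ) : y + 2 * π ∈ G ↔ y ∈ G := by
    simp only [hGdef, mem_ofPred_eq, hshift, Complex.exp_add _ ((1 : ℤ) * (2 * π * Complex.I)),
      Complex.exp_int_mul_two_pi_mul_I, mul_one]
  have hTper (y : ℝ) (hy : y ∈ G) : T (y + 2 * π) = T y + 2 * π := by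
    have h1 := hT _ ((hper y).2 hy)
    have h2 := (hT y hy).add_const ((1 : ℤ) * (2 * π * Complex.I))
    have h3 := tendsto_nhds_unique h1 (h2.congr' (by
      filter_upwards [self_mem_nhdsWithin] with x hx
      rw [hshift, hLper _ (hre x y hx)]))
    have := congrArg Complex.im h3
    simpa using this
  have hLre (ξ : ℂ) (hξ : ξ.re < 0) :
      (L ξ).re = log ‖h (Complex.exp ξ) + star (g (Complex.exp ξ))‖ := by
    rw [← hexp ξ hξ, Complex.norm_exp, log_exp]
  have hLneg (ξ : ℂ) (hξ : ξ.re < 0) : (L ξ).re < 0 := by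
    have := H.mapsTo (exp_mem_ball hξ)
    rw [mem_ball_zero_iff] at this
    simp only [← hexp ξ hξ, Complex.norm_exp] at this
    exact exp_lt_one_iff.1 this
  have hbot (y : ℝ) : Tendsto (fun x : ℝ => (L (x + y * Complex.I)).re) atBot atBot := by
    have hz : Tendsto (fun x : ℝ => Complex.exp (x + y * Complex.I)) atBot (𝓝 0) := by
      rw [tendsto_zero_iff_norm_tendsto_zero]
      simpa [Complex.norm_exp] using tendsto_exp_atBot
    have hc := (H.continuousOn.continuousAt (ball_mem_nhds 0 one_pos)).tendsto.comp hz
    simp only [H.h_zero, H.g_zero, star_zero, add_zero] at hc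
    have hn : Tendsto (fun x : ℝ => ‖h (Complex.exp (x + y * Complex.I)) +
        star (g (Complex.exp (x + y * Complex.I)))‖) atBot (𝓝[>] 0) := by
      refine tendsto_nhdsWithin_iff.2 ⟨by simpa using hc.norm, ?_⟩
      filter_upwards [eventually_lt_atBot 0] with x hx
      rw [mem_Ioi, norm_pos_iff, ← hexp _ (hre x y hx)]
      exact Complex.exp_ne_zero _
    refine (tendsto_log_nhdsGT_zero.comp hn).congr' ?_
    filter_upwards [eventually_lt_atBot 0] with x hx
    exact (hLre _ (hre x y hx)).symm
  have hmono : MonotoneOn T G := by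
    intro y₁ hy₁ y₂ hy₂ hle
    rcases hle.eq_or_lt with rfl | hlt
    · exact le_rfl
    have hTre (y : ℝ) (hy : y ∈ G) :
        Tendsto (fun x : ℝ => (L (x + y * Complex.I)).re) (𝓝[<] 0) (𝓝 0) := by
      simpa [Function.comp_def] using (Complex.continuous_re.tendsto _).comp (hT y hy)
    have hTim (y : ℝ) (hy : y ∈ G) :
        Tendsto (fun x : ℝ => (L (x + y * Complex.I)).im) (𝓝[<] 0) (𝓝 (T y)) := by
      simpa [Function.comp_def] using (Complex.continuous_im.tendsto _).comp (hT y hy)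
    refine le_of_disjoint_arcs (hLray y₁) (hLray y₂) (fun x hx x' hx' heq => ?_)
      (fun x hx => hLneg _ (hre x _ hx)) (fun x hx => hLneg _ (hre x _ hx)) (hbot y₁) (hbot y₂)
      (hTre y₁ hy₁) (hTre y₂ hy₂) (horigin y₁) (horigin y₂) (hTim y₁ hy₁) (hTim y₂ hy₂)
      (add_lt_add_left (strictMono_originAngle H.norm_ratio_lt hlt) κ)
    have h1 := congrArg Complex.exp heq
    rw [hexp _ (hre x y₁ hx), hexp _ (hre x' y₂ hx')] at h1
    obtain ⟨n, hn⟩ := Complex.exp_eq_exp_iff_exists_int.1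
      (H.injOn (exp_mem_ball (hre x y₁ hx)) (exp_mem_ball (hre x' y₂ hx')) h1)
    rw [hn, hLper _ (hre x' y₂ hx')] at heq
    have hn0 : (n : ℂ) * (2 * π * Complex.I) = 0 := by simpa using heq
    rw [hn0, add_zero] at hn
    have := congrArg Complex.im hn
    simp at this
    linarith
  obtain ⟨θ, hθ, hθper, hθT⟩ := exists_monotone_extension hG hper hTper hmono
  refine ⟨θ, hθ, hθper, ?_⟩
  filter_upwards [hG] with t ht
  rw [hθT ht]
  refine ((Complex.continuous_exp.tendsto _).comp (hT t ht)).congr' ?_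
  filter_upwards [self_mem_nhdsWithin] with x hx
  exact hexp _ (hre x t hx)

end IsHarmonicDiscMap

/-- The Fourier coefficients of a function on the circle of radius `exp x`. -/
noncomputable def rayCoeff (k : ℂ → ℂ) (n : ℤ) (x : ℝ) : ℂ :=
  (2 * π : ℝ)⁻¹ • ∫ t in (0 : ℝ)..(2 * π),
    k (Complex.exp (x + t * Complex.I)) * Complex.exp (-(n * t * Complex.I))

theorem circleMap_zero_exp (x t : ℝ) :
    circleMap 0 (rexp x) t = Complex.exp (x + t * Complex.I) := by
  rw [circleMap_zero, Complex.exp_add, Complex.ofReal_exp]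

theorem rayCoeff_eq_circleIntegral (k : ℂ → ℂ) (n : ℤ) (x : ℝ) :
    rayCoeff k n x = Complex.exp (n * x) *
      ((2 * π * Complex.I : ℂ)⁻¹ • ∮ z in C(0, rexp x), z ^ (-n - 1) * k z) := by
  have hpi : (π : ℂ) ≠ 0 := by exact_mod_cast pi_ne_zero
  have h1 : (∮ z in C(0, rexp x), z ^ (-n - 1) * k z) =
      ∫ t in (0 : ℝ)..(2 * π), (Complex.I * Complex.exp (-(n * x))) *
        (k (Complex.exp (x + t * Complex.I)) * Complex.exp (-(n * t * Complex.I))) := by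
    rw [circleIntegral]
    refine intervalIntegral.integral_congr fun t _ => ?_
    simp only [deriv_circleMap, circleMap_zero_exp, smul_eq_mul, ← Complex.exp_int_mul]
    have : Complex.exp (x + t * Complex.I) *
        Complex.exp (((-n - 1 : ℤ) : ℂ) * (x + t * Complex.I)) =
        Complex.exp (-(n * x)) * Complex.exp (-(n * t * Complex.I)) := by
      rw [← Complex.exp_add, ← Complex.exp_add]
      congr 1
      push_cast
      ring
    linear_combination Complex.I * k (Complex.exp (x + t * Complex.I)) * this
  rw [h1, intervalIntegral.integral_const_mul, rayCoeff, smul_eq_mul, Complex.real_smul]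
  have h2 : Complex.exp (n * x) * Complex.exp (-(n * x)) = 1 := by
    rw [← Complex.exp_add, add_neg_cancel, Complex.exp_zero]
  set J := ∫ t in (0 : ℝ)..(2 * π),
    k (Complex.exp (x + t * Complex.I)) * Complex.exp (-(n * t * Complex.I))
  have h3 : (2 * π * Complex.I : ℂ)⁻¹ * Complex.I = (2 * π : ℂ)⁻¹ := by
    field_simp
  push_cast
  linear_combination (-(2 * π : ℂ)⁻¹ * J) * h2 -
    Complex.exp (n * x) * Complex.exp (-(n * x)) * J * h3

section

variable {k : ℂ → ℂ} {x : ℝ}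

theorem differentiableOn_dslope_zero (hk : DifferentiableOn ℂ k (ball 0 1)) :
    DifferentiableOn ℂ (dslope k 0) (ball 0 1) :=
  (Complex.differentiableOn_dslope (ball_mem_nhds 0 one_pos)).2 hk

theorem mul_dslope_zero (hk0 : k 0 = 0) (z : ℂ) : z * dslope k 0 z = k z := by
  simpa [hk0] using sub_smul_dslope k 0 z

theorem closedBall_exp_subset (hx : x < 0) : closedBall (0 : ℂ) (rexp x) ⊆ ball 0 1 :=
  closedBall_subset_ball (exp_lt_one_iff.2 hx)

theorem sphere_exp_ne_zero {z : ℂ} (hz : z ∈ sphere (0 : ℂ) (rexp x)) : z ≠ 0 := by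
  rintro rfl
  have : 0 = rexp x := by simpa using hz
  exact (exp_pos x).ne this

theorem rayCoeff_neg_nat (hk : DifferentiableOn ℂ k (ball 0 1)) (hk0 : k 0 = 0) (hx : x < 0)
    (m : ℕ) : rayCoeff k (-m) x = 0 := by
  rw [rayCoeff_eq_circleIntegral]
  have h1 : (∮ z in C(0, rexp x), z ^ (-(-(m : ℤ)) - 1) * k z) =
      ∮ z in C(0, rexp x), z ^ m * dslope k 0 z := by
    refine circleIntegral.integral_congr (exp_pos x).le fun z hz => ?_
    have hz0 := sphere_exp_ne_zero hz
    rw [← mul_dslope_zero hk0 z, neg_neg, zpow_sub_one₀ hz0, zpow_natCast]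
    field_simp
  have hd : DifferentiableOn ℂ (fun z => z ^ m * dslope k 0 z) (ball 0 1) :=
    (by fun_prop : DifferentiableOn ℂ (fun z : ℂ => z ^ m) (ball 0 1)).mul
      (differentiableOn_dslope_zero hk)
  rw [h1, Complex.circleIntegral_eq_zero_of_differentiable_on_off_countable (exp_pos x).le
    countable_empty (hd.continuousOn.mono (closedBall_exp_subset hx))]
  · simp
  · intro z hz
    exact hd.differentiableAt (isOpen_ball.mem_nhds
      (closedBall_exp_subset hx (ball_subset_closedBall hz.1)))

theorem rayCoeff_one (hk : DifferentiableOn ℂ k (ball 0 1)) (hx : x < 0) :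
    rayCoeff k 1 x = Complex.exp x * deriv k 0 := by
  rw [rayCoeff_eq_circleIntegral,
    ← Complex.two_pi_I_inv_smul_circleIntegral_sub_sq_inv_smul_of_differentiable isOpen_ball
      (closedBall_exp_subset hx) hk (mem_ball_self (exp_pos x))]
  simp only [Int.cast_one, one_mul, sub_zero, smul_eq_mul]
  norm_num [zpow_neg]

theorem rayCoeff_two (hk : DifferentiableOn ℂ k (ball 0 1)) (hk0 : k 0 = 0) (hx : x < 0) :
    rayCoeff k 2 x = Complex.exp (2 * x) * deriv (dslope k 0) 0 := by
  rw [rayCoeff_eq_circleIntegral,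
    ← Complex.two_pi_I_inv_smul_circleIntegral_sub_sq_inv_smul_of_differentiable isOpen_ball
      (closedBall_exp_subset hx) (differentiableOn_dslope_zero hk) (mem_ball_self (exp_pos x))]
  congr 2
  · refine circleIntegral.integral_congr (exp_pos x).le fun z hz => ?_
    have hz0 := sphere_exp_ne_zero hz
    simp only [sub_zero, smul_eq_mul]
    rw [← mul_dslope_zero hk0 z, show (-2 - 1 : ℤ) = -((3 : ℕ) : ℤ) by norm_num, zpow_neg,
      zpow_natCast]
    field_simp

end

theorem continuous_ray {k : ℂ → ℂ} (hk : ContinuousOn k (ball 0 1)) {x : ℝ} (hx : x < 0) :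
    Continuous fun t : ℝ => k (Complex.exp (x + t * Complex.I)) :=
  hk.comp_continuous (by fun_prop) fun t => IsHarmonicDiscMap.exp_mem_ball (by simpa using hx)

namespace IsHarmonicDiscMap

variable {h g : ℂ → ℂ}

theorem rayCoeff_eq (H : IsHarmonicDiscMap h g) (n : ℤ) {x : ℝ} (hx : x < 0) :
    rayCoeff (fun z => h z + star (g z)) n x = rayCoeff h n x + star (rayCoeff g (-n) x) := by
  have hstar : star (rayCoeff g (-n) x) = (2 * π : ℝ)⁻¹ • ∫ t in (0 : ℝ)..(2 * π),
      star (g (Complex.exp (x + t * Complex.I))) * Complex.exp (-(n * t * Complex.I)) := by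
    rw [rayCoeff, star_smul, star_trivial]
    congr 1
    rw [Complex.star_def, intervalIntegral.integral_of_le two_pi_pos.le, ← integral_conj,
      intervalIntegral.integral_of_le two_pi_pos.le]
    refine integral_congr_ae (Eventually.of_forall fun t => ?_)
    simp [← Complex.exp_conj]
  rw [hstar, rayCoeff, rayCoeff, ← smul_add, ← intervalIntegral.integral_add]
  · simp only [add_mul]
  · exact Continuous.intervalIntegrable
      ((continuous_ray H.diff_h.continuousOn hx).mul (by fun_prop)) _ _
  · exact Continuous.intervalIntegrable
      ((continuous_ray H.diff_g.continuousOn hx).star.mul (by fun_prop)) _ _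

theorem tendsto_rayCoeff (H : IsHarmonicDiscMap h g) {θ : ℝ → ℝ} (hθ : ∀ᵐ t : ℝ,
    Tendsto (fun x : ℝ => h (Complex.exp (x + t * Complex.I)) +
      star (g (Complex.exp (x + t * Complex.I)))) (𝓝[<] 0)
        (𝓝 (Complex.exp (θ t * Complex.I)))) (n : ℤ) :
    Tendsto (rayCoeff (fun z => h z + star (g z)) n) (𝓝[<] 0) (𝓝 (circleCoeff θ n)) := by
  refine Tendsto.const_smul ?_ _
  refine intervalIntegral.tendsto_integral_filter_of_dominated_convergence (fun _ => 1) ?_ ?_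
    (by simp) ?_
  · filter_upwards [self_mem_nhdsWithin] with x hx
    exact ((continuous_ray H.continuousOn hx).mul (by fun_prop)).aestronglyMeasurable
  · filter_upwards [self_mem_nhdsWithin] with x hx
    refine Eventually.of_forall fun t _ => ?_
    have := H.mapsTo (exp_mem_ball (ξ := x + t * Complex.I) (by simpa using hx))
    rw [mem_ball_zero_iff] at this
    rw [norm_mul, show -(n * t * Complex.I) = ((-(n * t) : ℝ) : ℂ) * Complex.I by push_cast; ring,
      Complex.norm_exp_ofReal_mul_I, mul_one]
    exact this.le
  · filter_upwards [hθ] with t ht _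
    have := ht.mul_const (Complex.exp (-(n * t * Complex.I)))
    rw [← Complex.exp_add] at this
    convert this using 3
    push_cast
    ring

/-- The boundary function of a harmonic homeomorphism of the disk and its first Fourier
coefficients. -/
theorem exists_boundary_circleCoeff (H : IsHarmonicDiscMap h g) : ∃ θ : ℝ → ℝ, Monotone θ ∧
    (∀ t, θ (t + 2 * π) = θ t + 2 * π) ∧ circleCoeff θ 0 = 0 ∧ circleCoeff θ 1 = deriv h 0 ∧
    circleCoeff θ 2 = deriv (dslope h 0) 0 ∧ circleCoeff θ (-1) = star (deriv g 0) ∧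
    circleCoeff θ (-2) = star (deriv (dslope g 0) 0) := by
  obtain ⟨θ, hmono, hper, hθ⟩ := H.exists_boundary
  have key (n : ℤ) {F : ℝ → ℂ} {c : ℂ} (hF : Tendsto F (𝓝[<] 0) (𝓝 c))
      (hFeq : ∀ x < 0, rayCoeff h n x + star (rayCoeff g (-n) x) = F x) : circleCoeff θ n = c := by
    refine tendsto_nhds_unique (H.tendsto_rayCoeff hθ n) (hF.congr' ?_)
    filter_upwards [self_mem_nhdsWithin] with x hx
    rw [H.rayCoeff_eq n hx, hFeq x hx]
  have hexp (m : ℂ) : Tendsto (fun x : ℝ => Complex.exp (m * x)) (𝓝[<] 0) (𝓝 1) := by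
    have : Continuous fun x : ℝ => Complex.exp (m * x) := by fun_prop
    simpa using (this.tendsto 0).mono_left nhdsWithin_le_nhds
  have hneg {k : ℂ → ℂ} (hk : DifferentiableOn ℂ k (ball 0 1)) (hk0 : k 0 = 0) (m : ℕ) {x : ℝ}
      (hx : x < 0) := rayCoeff_neg_nat hk hk0 hx m
  refine ⟨θ, hmono, hper, ?_, ?_, ?_, ?_, ?_⟩
  · refine key 0 tendsto_const_nhds fun x hx => ?_
    have h1 := hneg H.diff_h H.h_zero 0 hx
    have h2 := hneg H.diff_g H.g_zero 0 hx
    simp only [Nat.cast_zero, neg_zero] at h1 h2 ⊢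
    rw [h1, h2, star_zero, add_zero]
  · refine key 1 (F := fun x => Complex.exp (1 * x) * deriv h 0)
      (by simpa using (hexp 1).mul_const (deriv h 0)) fun x hx => ?_
    have h2 := hneg H.diff_g H.g_zero 1 hx
    simp only [Nat.cast_one] at h2
    rw [h2, rayCoeff_one H.diff_h hx, star_zero, add_zero, one_mul]
  · refine key 2 (F := fun x => Complex.exp (2 * x) * deriv (dslope h 0) 0)
      (by simpa using (hexp 2).mul_const (deriv (dslope h 0) 0)) fun x hx => ?_
    have h2 := hneg H.diff_g H.g_zero 2 hx
    simp only [Nat.cast_ofNat] at h2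
    rw [h2, rayCoeff_two H.diff_h H.h_zero hx, star_zero, add_zero]
  · refine key (-1) (F := fun x => star (Complex.exp (1 * x) * deriv g 0))
      (by simpa using ((hexp 1).mul_const (deriv g 0)).star) fun x hx => ?_
    have h2 := hneg H.diff_h H.h_zero 1 hx
    simp only [Nat.cast_one] at h2
    rw [h2, neg_neg, rayCoeff_one H.diff_g hx, zero_add, one_mul]
  · refine key (-2) (F := fun x => star (Complex.exp (2 * x) * deriv (dslope g 0) 0))
      (by simpa using ((hexp 2).mul_const (deriv (dslope g 0) 0)).star) fun x hx => ?_
    have h2 := hneg H.diff_h H.h_zero 2 hx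
    simp only [Nat.cast_ofNat] at h2
    rw [h2, neg_neg, rayCoeff_two H.diff_g H.g_zero hx, zero_add]

end IsHarmonicDiscMap

/-- The **Schwarz–Pick lemma** at the origin. -/
theorem norm_deriv_zero_le_one_sub_sq {f : ℂ → ℂ} (hf : DifferentiableOn ℂ f (ball 0 1))
    (hmaps : ∀ z ∈ ball (0 : ℂ) 1, ‖f z‖ < 1) : ‖deriv f 0‖ ≤ 1 - ‖f 0‖ ^ 2 := by
  have h0 : (0 : ℂ) ∈ ball (0 : ℂ) 1 := mem_ball_self one_pos
  have ha := hmaps 0 h0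
  have hpos : 0 < 1 - ‖f 0‖ ^ 2 := by nlinarith [norm_nonneg (f 0)]
  have hd : DifferentiableOn ℂ (fun z => discMoebius (f 0) (f z)) (ball 0 1) := fun z hz =>
    ((hasDerivAt_discMoebius ha (hmaps z hz)).differentiableAt.comp z
      (hf.differentiableAt (isOpen_ball.mem_nhds hz))).differentiableWithinAt
  have hd0 : HasDerivAt (fun z => discMoebius (f 0) (f z))
      ((1 - ‖f 0‖ ^ 2 : ℝ) / (1 - star (f 0) * f 0) ^ 2 * deriv f 0) 0 :=
    (hasDerivAt_discMoebius ha ha).comp 0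
      (hf.differentiableAt (isOpen_ball.mem_nhds h0)).hasDerivAt
  have hzero : discMoebius (f 0) (f 0) = 0 := by simp [discMoebius]
  have key := Complex.norm_deriv_le_div_of_mapsTo_ball hd (R₂ := 1) (by
    intro z hz
    rw [hzero, mem_closedBall_zero_iff]
    exact (norm_discMoebius_lt_one ha (hmaps z hz)).le) one_pos
  have hs : 1 - star (f 0) * f 0 = ((1 - ‖f 0‖ ^ 2 : ℝ) : ℂ) := by
    rw [Complex.star_def, ← Complex.normSq_eq_conj_mul_self, Complex.normSq_eq_norm_sq]
    push_cast
    ring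
  rw [hd0.deriv, hs, norm_mul, norm_div, norm_pow, Complex.norm_real,
    Real.norm_of_nonneg hpos.le, div_one] at key
  have : (1 - ‖f 0‖ ^ 2) / (1 - ‖f 0‖ ^ 2) ^ 2 * ‖deriv f 0‖ =
      ‖deriv f 0‖ / (1 - ‖f 0‖ ^ 2) := by
    field_simp
  rw [this, div_le_one hpos] at key
  exact key

theorem four_mul_sq_le_of_coeff_bound {s a b : ℝ} (hs : 0 ≤ s) (hs' : s ^ 2 ≤ 0.18) (ha : 0 ≤ a)
    (hb : 0 ≤ b) (hba : b ≤ s * (1 - s ^ 2) * a + s ^ 2)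
    (h : 0.705 ≤ a ^ 2 + (1 + √3) * (s ^ 2 * a) ^ 2 + b ^ 2) :
    4 * (1 - s ^ 2) ^ 2 ≤ 5.6995 * a ^ 2 * (1 + s ^ 2) ^ 4 := by
  by_contra! hlt
  set x := s ^ 2 with hx
  have hx0 : 0 ≤ x := sq_nonneg s
  have hsqrt : √3 ≤ 1.7321 := by
    rw [Real.sqrt_le_left (by norm_num)]
    norm_num
  have hfrac : (1 - x) ^ 2 ≤ (1 - 3 * x) * (1 + x) ^ 4 := by
    have h2 : 0 ≤ x * (0.18 - x) := mul_nonneg hx0 (by linarith)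
    have h3 : 0 ≤ x ^ 2 * (0.18 - x) := mul_nonneg (sq_nonneg x) (by linarith)
    have h4 : 0 ≤ x ^ 3 * (0.18 - x) := mul_nonneg (by positivity) (by linarith)
    have h5 : 0 ≤ x ^ 4 * (0.18 - x) := mul_nonneg (by positivity) (by linarith)
    nlinarith
  have ha2 : a ^ 2 ≤ 0.70182 * (1 - 3 * x) := by
    have hp : 0 < (1 + x) ^ 4 := by positivity
    have : a ^ 2 * (1 + x) ^ 4 ≤ 0.70182 * (1 - 3 * x) * (1 + x) ^ 4 := by nlinarith
    exact le_of_mul_le_mul_right this hp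
  have ha1 : a ≤ 0.84 := by nlinarith
  have hs1 : s ≤ 0.4243 := by nlinarith
  have hsa : s * a ≤ 0.35642 := by nlinarith [mul_nonneg hs ha]
  have hb2 : b ^ 2 ≤ x * (1 - x) ^ 2 * a ^ 2 + 0.71284 * x + x ^ 2 := by
    calc b ^ 2 ≤ (s * (1 - x) * a + x) ^ 2 := pow_le_pow_left₀ hb hba 2
      _ = x * (1 - x) ^ 2 * a ^ 2 + 2 * x * ((1 - x) * (s * a)) + x ^ 2 := by rw [hx]; ring
      _ ≤ _ := by
        have : (1 - x) * (s * a) ≤ 0.35642 := by nlinarith [mul_nonneg hs ha]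
        nlinarith
  have hcoef : (1 + √3) * (x * a) ^ 2 ≤ 2.7321 * x ^ 2 * a ^ 2 := by
    rw [mul_pow, mul_assoc]
    exact mul_le_mul_of_nonneg_right (by linarith) (by positivity)
  have hsum : 0.705 ≤ (1 + 2.7321 * x ^ 2 + x * (1 - x) ^ 2) * (0.70182 * (1 - 3 * x)) +
      0.71284 * x + x ^ 2 := by
    have : (1 + 2.7321 * x ^ 2 + x * (1 - x) ^ 2) * a ^ 2 ≤
        (1 + 2.7321 * x ^ 2 + x * (1 - x) ^ 2) * (0.70182 * (1 - 3 * x)) :=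
      mul_le_mul_of_nonneg_left ha2 (by positivity)
    nlinarith
  have h2 : 0 ≤ x * (0.18 - x) := mul_nonneg hx0 (by linarith)
  have h3 : 0 ≤ x ^ 2 * (0.18 - x) := mul_nonneg (sq_nonneg x) (by linarith)
  have h4 : 0 ≤ x ^ 3 * (0.18 - x) := mul_nonneg (by positivity) (by linarith)
  nlinarith

/-- The second Taylor coefficient of a function vanishing at the origin. -/
theorem two_mul_deriv_dslope_zero {k k' : ℂ → ℂ} {k'' : ℂ}
    (hk : ∀ z ∈ ball (0 : ℂ) 1, HasDerivAt k (k' z) z) (hk0 : k 0 = 0) (hk' : HasDerivAt k' k'' 0) :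
    2 * deriv (dslope k 0) 0 = k'' := by
  have hdk : DifferentiableOn ℂ k (ball 0 1) := fun z hz =>
    (hk z hz).differentiableAt.differentiableWithinAt
  have hs := differentiableOn_dslope_zero hdk
  have hs' : DifferentiableOn ℂ (deriv (dslope k 0)) (ball 0 1) := hs.deriv isOpen_ball
  have h0 : ball (0 : ℂ) 1 ∈ 𝓝 (0 : ℂ) := ball_mem_nhds 0 one_pos
  have heq : k' =ᶠ[𝓝 0] fun z => dslope k 0 z + z * deriv (dslope k 0) z := by
    filter_upwards [h0] with z hz
    have h1 : HasDerivAt (fun z => z * dslope k 0 z)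
        (1 * dslope k 0 z + z * deriv (dslope k 0) z) z :=
      (hasDerivAt_id z).mul (hs.differentiableAt (isOpen_ball.mem_nhds hz)).hasDerivAt
    rw [show (fun z => z * dslope k 0 z) = k from funext (mul_dslope_zero hk0), one_mul] at h1
    exact (hk z hz).unique h1
  have h2 : HasDerivAt (fun z => dslope k 0 z + z * deriv (dslope k 0) z)
      (deriv (dslope k 0) 0 + (1 * deriv (dslope k 0) 0 + 0 * deriv (deriv (dslope k 0)) 0)) 0 :=
    (hs.differentiableAt h0).hasDerivAt.add
      ((hasDerivAt_id (0 : ℂ)).mul (hs'.differentiableAt h0).hasDerivAt)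
  rw [(hk'.congr_of_eventuallyEq heq.symm).unique h2]
  ring

namespace IsIsothermalChart

variable {Ω : Set ℂ} {ζ χ Ψ ω : ℂ → ℂ}

theorem isPreconnected (h : IsIsothermalChart Ω ζ χ Ψ ω) : IsPreconnected Ω := by
  have himg : ζ '' ball 0 1 = Ω := by
    refine subset_antisymm h.mapsTo_inv.image_subset fun w hw => ?_
    exact ⟨χ w, h.mapsTo hw, h.right_inv w hw⟩
  rw [← himg]
  exact (convex_ball (0 : ℂ) 1).isPreconnected.image _ h.continuousOn_inv

theorem zero_mem (h : IsIsothermalChart Ω ζ χ Ψ ω) : (0 : ℂ) ∈ Ω :=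
  h.ball_subset (mem_ball_self one_pos)

theorem primitive_zero (h : IsIsothermalChart Ω ζ χ Ψ ω) : Ψ 0 = 0 := by
  have h1 := h.two_mul_eq 0 h.zero_mem
  have h2 := h.left_inv 0 (mem_ball_self one_pos)
  rw [h.inv_zero] at h2
  rw [h2, mul_zero, zero_add] at h1
  exact star_eq_zero.1 h1.symm

theorem isHarmonicDiscMap (h : IsIsothermalChart Ω ζ χ Ψ ω) {φ ψ : ℂ → ℂ}
    (hφ : DifferentiableOn ℂ φ (ball 0 1)) (hφΩ : MapsTo φ (ball 0 1) Ω)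
    (hψ : DifferentiableOn ℂ ψ Ω) (hψΩ : MapsTo ψ Ω (ball 0 1))
    (hψφ : ∀ z ∈ ball (0 : ℂ) 1, ψ (φ z) = z) (hφ0 : φ 0 = 0) (hφ'0 : deriv φ 0 ≠ 0) :
    IsHarmonicDiscMap (fun z => φ z / 2) (fun z => Ψ (φ z) / 2) := by
  have hdφ (z : ℂ) (hz : z ∈ ball (0 : ℂ) 1) : HasDerivAt φ (deriv φ z) z :=
    (hφ.differentiableAt (isOpen_ball.mem_nhds hz)).hasDerivAt
  have hdh (z : ℂ) (hz : z ∈ ball (0 : ℂ) 1) : HasDerivAt (fun z => φ z / 2) (deriv φ z / 2) z :=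
    (hdφ z hz).div_const 2
  have hdg (z : ℂ) (hz : z ∈ ball (0 : ℂ) 1) :
      HasDerivAt (fun z => Ψ (φ z) / 2) (-(ω (φ z)) ^ 2 * deriv φ z / 2) z :=
    ((h.hasDerivAt _ (hφΩ hz)).comp z (hdφ z hz)).div_const 2
  have hw (z : ℂ) (hz : z ∈ ball (0 : ℂ) 1) : φ z / 2 + star (Ψ (φ z) / 2) = χ (φ z) := by
    have := h.two_mul_eq _ (hφΩ hz)
    rw [star_div₀, star_ofNat]
    linear_combination -this / 2
  have hinjφ : InjOn φ (ball 0 1) := fun z hz z' hz' heq => by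
    rw [← hψφ z hz, heq, hψφ z' hz']
  have h0 : (0 : ℂ) ∈ ball (0 : ℂ) 1 := mem_ball_self one_pos
  refine
    { diff_h := fun z hz => (hdh z hz).differentiableAt.differentiableWithinAt
      diff_g := fun z hz => (hdg z hz).differentiableAt.differentiableWithinAt
      h_zero := by simp [hφ0]
      g_zero := by simp [hφ0, h.primitive_zero]
      norm_deriv_le := fun z hz => ?_
      norm_deriv_zero_lt := ?_
      injOn_h := fun z hz z' hz' heq => hinjφ hz hz' (by simpa using heq)
      isBounded_h := ?_
      injOn := fun z hz z' hz' heq => ?_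
      mapsTo := fun z hz => ?_
      proper := fun ρ hρ => ?_ }
  · rw [(hdh z hz).deriv, (hdg z hz).deriv, mul_div_assoc, norm_mul, norm_neg, norm_pow]
    have := h.norm_lt_one _ (hφΩ hz)
    exact mul_le_of_le_one_left (norm_nonneg _) (pow_le_one₀ (norm_nonneg _) this.le)
  · rw [(hdh 0 h0).deriv, (hdg 0 h0).deriv, mul_div_assoc, norm_mul, norm_neg, norm_pow]
    have := h.norm_lt_one _ (hφΩ h0)
    exact mul_lt_of_lt_one_left (norm_pos_iff.2 (div_ne_zero hφ'0 two_ne_zero))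
      (pow_lt_one₀ (norm_nonneg _) this two_ne_zero)
  · obtain ⟨C, hC⟩ := h.isBounded.exists_norm_le
    refine (isBounded_iff_forall_norm_le).2 ⟨C / 2, ?_⟩
    rintro _ ⟨z, hz, rfl⟩
    rw [norm_div, Complex.norm_two]
    linarith [hC _ (hφΩ hz)]
  · simp only [hw z hz, hw z' hz'] at heq
    refine hinjφ hz hz' ?_
    rw [← h.right_inv _ (hφΩ hz), heq, h.right_inv _ (hφΩ hz')]
  · simp only [hw z hz]
    exact h.mapsTo (hφΩ hz)
  · have hsub : closedBall (0 : ℂ) (max ρ 0) ⊆ ball 0 1 :=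
      closedBall_subset_ball (max_lt hρ one_pos)
    have hcont : ContinuousOn (fun w => ψ (ζ w)) (closedBall 0 (max ρ 0)) :=
      hψ.continuousOn.comp (h.continuousOn_inv.mono hsub) fun w hw => h.mapsTo_inv (hsub hw)
    obtain ⟨w₀, hw₀, hmax⟩ := (isCompact_closedBall (0 : ℂ) (max ρ 0)).exists_isMaxOn
      ⟨0, mem_closedBall_self (le_max_right _ _)⟩ hcont.norm
    refine ⟨‖ψ (ζ w₀)‖, ?_, fun z hz hlt => ?_⟩
    · simpa using hψΩ (h.mapsTo_inv (hsub hw₀))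
    · rw [hw z hz]
      by_contra! hle
      have := hmax (show χ (φ z) ∈ closedBall (0 : ℂ) (max ρ 0) by
        rw [mem_closedBall_zero_iff]; exact hle.trans (le_max_left _ _))
      simp only [mem_ofPred_eq, h.right_inv _ (hφΩ hz), hψφ z hz] at this
      linarith

/-- The curvature estimate in isothermal coordinates. -/
theorem sixteen_mul_norm_deriv_sq_le (h : IsIsothermalChart Ω ζ χ Ψ ω) :
    16 * ‖deriv ω 0‖ ^ 2 ≤ 5.6995 * (1 + ‖ω 0‖ ^ 2) ^ 4 := by
  have hx1 := h.norm_lt_one 0 h.zero_mem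
  by_cases hx : 0.18 ≤ ‖ω 0‖ ^ 2
  · have hsp := norm_deriv_zero_le_one_sub_sq (h.differentiableOn.mono h.ball_subset)
      fun z hz => h.norm_lt_one z (h.ball_subset hz)
    have h1 : ‖deriv ω 0‖ ^ 2 ≤ (1 - ‖ω 0‖ ^ 2) ^ 2 := pow_le_pow_left₀ (norm_nonneg _) hsp 2
    have h2 : (1 - ‖ω 0‖ ^ 2) ^ 2 ≤ 0.82 ^ 2 :=
      pow_le_pow_left₀ (by nlinarith [norm_nonneg (ω 0)]) (by linarith) 2
    have h3 : (1.18 : ℝ) ^ 4 ≤ (1 + ‖ω 0‖ ^ 2) ^ 4 :=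
      pow_le_pow_left₀ (by norm_num) (by linarith) 4
    norm_num at h2 h3 ⊢
    linarith
  · push Not at hx
    obtain ⟨φ, ψ, hφ, hφΩ, hψ, hψΩ, hψφ, -, hφ0⟩ := exists_univalent_image_ball h.isOpen
      h.isPreconnected h.zero_mem h.isBounded fun g hg hg0 => h.exists_sqrt hg hg0
    have h0 : (0 : ℂ) ∈ ball (0 : ℂ) 1 := mem_ball_self one_pos
    have hnhds : ball (0 : ℂ) 1 ∈ 𝓝 (0 : ℂ) := ball_mem_nhds 0 one_pos
    have hdφ (z : ℂ) (hz : z ∈ ball (0 : ℂ) 1) : HasDerivAt φ (deriv φ z) z :=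
      (hφ.differentiableAt (isOpen_ball.mem_nhds hz)).hasDerivAt
    have hφ'0 : deriv φ 0 ≠ 0 := by
      intro hzero
      have h1 : HasDerivAt (fun z => ψ (φ z)) (deriv ψ (φ 0) * deriv φ 0) 0 :=
        (hψ.differentiableAt (h.isOpen.mem_nhds (hφΩ h0))).hasDerivAt.comp 0 (hdφ 0 h0)
      have h2 : HasDerivAt (fun z => ψ (φ z)) 1 0 :=
        (hasDerivAt_id (0 : ℂ)).congr_of_eventuallyEq (by
          filter_upwards [hnhds] with z hz using hψφ z hz)
      have := h1.unique h2
      simp [hzero] at this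
    have H := h.isHarmonicDiscMap hφ hφΩ hψ hψΩ hψφ hφ0 hφ'0
    obtain ⟨θ, hmono, hper, c0, c1, c2, cm1, cm2⟩ := H.exists_boundary_circleCoeff
    have hlow := circleCoeff_lower_bound hmono hper
    have hdh (z : ℂ) (hz : z ∈ ball (0 : ℂ) 1) :
        HasDerivAt (fun z => φ z / 2) (deriv φ z / 2) z := (hdφ z hz).div_const 2
    have hdg (z : ℂ) (hz : z ∈ ball (0 : ℂ) 1) :
        HasDerivAt (fun z => Ψ (φ z) / 2) (-(ω (φ z)) ^ 2 * deriv φ z / 2) z :=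
      ((h.hasDerivAt _ (hφΩ hz)).comp z (hdφ z hz)).div_const 2
    have hdφ' : HasDerivAt (deriv φ) (deriv (deriv φ) 0) 0 :=
      ((hφ.deriv isOpen_ball).differentiableAt hnhds).hasDerivAt
    have hωφ : HasDerivAt (fun z => ω (φ z)) (deriv ω 0 * deriv φ 0) 0 := by
      have := (h.differentiableOn.differentiableAt (h.isOpen.mem_nhds (hφΩ h0))).hasDerivAt.comp 0
        (hdφ 0 h0)
      rwa [hφ0] at this
    have hsecond_h := two_mul_deriv_dslope_zero hdh (by simp [hφ0]) (hdφ'.div_const 2)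
    have hsecond_g := two_mul_deriv_dslope_zero hdg (by simp [hφ0, h.primitive_zero])
      (((hωφ.fun_pow 2).neg.mul hdφ').div_const 2)
    have hsp := norm_deriv_zero_le_one_sub_sq (f := fun z => ω (φ z))
      (h.differentiableOn.comp hφ hφΩ) fun z hz => h.norm_lt_one _ (hφΩ hz)
    rw [hωφ.deriv, hφ0] at hsp
    set a₂ := deriv (dslope (fun z => φ z / 2) 0) 0
    set b₂ := deriv (dslope (fun z => Ψ (φ z) / 2) 0) 0
    have hb₂ : b₂ = -(ω 0 * (deriv ω 0 * deriv φ 0) * (deriv φ 0 / 2)) - ω 0 ^ 2 * a₂ := by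
      simp only [hφ0] at hsecond_g
      norm_num at hsecond_g
      rw [hφ0] at hsecond_g
      linear_combination hsecond_g / 2 + ω 0 ^ 2 / 2 * hsecond_h
    have ha₂ : ‖a₂‖ ≤ 1 := by
      rw [← c2]
      exact norm_circleCoeff_le_one _
    set a := ‖deriv φ 0 / 2‖ with ha
    have hapos : 0 < a := norm_pos_iff.2 (div_ne_zero hφ'0 two_ne_zero)
    have hb₂' : ‖b₂‖ ≤ ‖ω 0‖ * (1 - ‖ω 0‖ ^ 2) * a + ‖ω 0‖ ^ 2 := by
      rw [hb₂]
      refine (norm_sub_le _ _).trans ?_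
      rw [norm_neg, norm_mul, norm_mul (ω 0), norm_mul (ω 0 ^ 2), norm_pow]
      gcongr
      exact mul_le_of_le_one_right (by positivity) ha₂
    rw [c0, c1, cm1, cm2, (hdh 0 h0).deriv, (hdg 0 h0).deriv, norm_star, norm_star, hφ0,
      mul_div_assoc, norm_mul, norm_neg, norm_pow, ← ha, norm_zero] at hlow
    have hfin := four_mul_sq_le_of_coeff_bound (norm_nonneg _) hx.le hapos.le (norm_nonneg b₂) hb₂'
      (by linarith)
    have h2a : ‖deriv φ 0‖ = 2 * a := by
      rw [ha, norm_div, Complex.norm_two]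
      ring
    rw [norm_mul, h2a] at hsp
    have hsq : (‖deriv ω 0‖ * (2 * a)) ^ 2 ≤ (1 - ‖ω 0‖ ^ 2) ^ 2 :=
      pow_le_pow_left₀ (by positivity) hsp 2
    have ha2 : 0 < a ^ 2 := by positivity
    refine le_of_mul_le_mul_right ?_ ha2
    linarith

end IsIsothermalChart

end

section

open Filter Topology Metric

theorem isOpen_unitDisk : IsOpen unitDisk :=
  isOpen_lt (by fun_prop) continuous_const

/-- The first order directional derivatives of a `C²` function are differentiable. -/
theorem hasFDerivAt_lineDeriv {f : ℝ × ℝ → ℝ} {p : ℝ × ℝ} (hf : ContDiffAt ℝ 2 f p)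
    (v : ℝ × ℝ) :
    HasFDerivAt (fun x => lineDeriv ℝ f x v) ((fderiv ℝ (fderiv ℝ f) p).flip v) p := by
  have h1 : DifferentiableAt ℝ (fderiv ℝ f) p :=
    (hf.fderiv_right (m := 1) (by norm_num)).differentiableAt (by norm_num)
  have h2 : HasFDerivAt (fun x => fderiv ℝ f x v) ((fderiv ℝ (fderiv ℝ f) p).flip v) p := by
    simpa using h1.hasFDerivAt.clm_apply (hasFDerivAt_const v p)
  refine h2.congr_of_eventuallyEq ?_
  filter_upwards [hf.eventually (by simp)] with x hx
  exact (hx.differentiableAt (by norm_num)).lineDeriv_eq_fderiv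

theorem lineDeriv_lineDeriv_comm {f : ℝ × ℝ → ℝ} {p : ℝ × ℝ} (hf : ContDiffAt ℝ 2 f p)
    (v w : ℝ × ℝ) :
    lineDeriv ℝ (fun x => lineDeriv ℝ f x v) p w =
      lineDeriv ℝ (fun x => lineDeriv ℝ f x w) p v := by
  rw [(hasFDerivAt_lineDeriv hf v).hasLineDerivAt w |>.lineDeriv,
    (hasFDerivAt_lineDeriv hf w).hasLineDerivAt v |>.lineDeriv]
  exact hf.isSymmSndFDerivAt (by simp) w v

/-- Chain rule for the restriction of a directional derivative to a rescaled complex variable. -/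
theorem hasFDerivAt_lineDeriv_smul {f : ℝ × ℝ → ℝ} {r : ℝ} {z : ℂ}
    (hf : ContDiffAt ℝ 2 f (r * z.re, r * z.im)) (v : ℝ × ℝ) :
    HasFDerivAt (fun z : ℂ => lineDeriv ℝ f (r * z.re, r * z.im) v)
      (covec (r * lineDeriv ℝ (fun x => lineDeriv ℝ f x v) (r * z.re, r * z.im) (1, 0))
        (r * lineDeriv ℝ (fun x => lineDeriv ℝ f x v) (r * z.re, r * z.im) (0, 1))) z := by
  have hd := hasFDerivAt_lineDeriv hf v
  have hL : HasFDerivAt (fun z : ℂ => (r * z.re, r * z.im))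
      ((r • Complex.reCLM).prod (r • Complex.imCLM)) z :=
    (Complex.reCLM.hasFDerivAt.const_mul r).prodMk (Complex.imCLM.hasFDerivAt.const_mul r)
  have hc := hd.comp (f := fun z : ℂ => (r * z.re, r * z.im)) z hL
  refine hc.congr_fderiv (Eq.symm ?_)
  rw [(hd.hasLineDerivAt (1, 0)).lineDeriv, (hd.hasLineDerivAt (0, 1)).lineDeriv]
  ext w
  have hw : (r * w.re, r * w.im) =
      (r * w.re) • ((1, 0) : ℝ × ℝ) + (r * w.im) • ((0, 1) : ℝ × ℝ) := by
    simp
  rw [covec_apply, ContinuousLinearMap.comp_apply]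
  change _ = (fderiv ℝ (fderiv ℝ f) (r * z.re, r * z.im)).flip v (r * w.re, r * w.im)
  rw [hw, map_add, map_smul, map_smul, smul_eq_mul, smul_eq_mul]
  ring

/-- The gradient of a solution of the minimal surface equation, in a rescaled complex variable. -/
theorem MinimalSurfaceEq.isMinimalGradient {f : ℝ × ℝ → ℝ} (hmin : MinimalSurfaceEq f unitDisk)
    (hreg : ContDiffOn ℝ 2 f unitDisk) {r : ℝ} (hr : 0 < r) :
    IsMinimalGradient (1 / r) (fun z => pdu f (r * z.re, r * z.im))
      (fun z => pdv f (r * z.re, r * z.im)) (fun z => r * pdu (pdu f) (r * z.re, r * z.im))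
      (fun z => r * pdv (pdu f) (r * z.re, r * z.im))
      (fun z => r * pdv (pdv f) (r * z.re, r * z.im)) := by
  have hmem (z : ℂ) (hz : z ∈ ball (0 : ℂ) (1 / r)) : (r * z.re, r * z.im) ∈ unitDisk := by
    rw [mem_ball_zero_iff, lt_div_iff₀ hr] at hz
    have h1 : (‖z‖ * r) ^ 2 < 1 := pow_lt_one₀ (by positivity) hz two_ne_zero
    rw [mul_pow, Complex.sq_norm, Complex.normSq_apply] at h1
    change (r * z.re) ^ 2 + (r * z.im) ^ 2 < 1
    linarith
  have hcd (z : ℂ) (hz : z ∈ ball (0 : ℂ) (1 / r)) : ContDiffAt ℝ 2 f (r * z.re, r * z.im) :=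
    hreg.contDiffAt (isOpen_unitDisk.mem_nhds (hmem z hz))
  refine ⟨fun z hz => hasFDerivAt_lineDeriv_smul (hcd z hz) (1, 0), fun z hz => ?_,
    fun z hz => ?_⟩
  · have := hasFDerivAt_lineDeriv_smul (hcd z hz) (0, 1)
    rwa [lineDeriv_lineDeriv_comm (hcd z hz) (0, 1) (1, 0)] at this
  · linear_combination r * hmin _ (hmem z hz)

theorem sq_mul_abs_gaussCurv_le {f : ℝ × ℝ → ℝ} (hreg : ContDiffOn ℝ 2 f unitDisk)
    (hmin : MinimalSurfaceEq f unitDisk) {r : ℝ} (hr : 0 < r) (hr1 : r < 1) :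
    r ^ 2 * |gaussCurv f (0, 0)| ≤ 5.6995 := by
  have h := hmin.isMinimalGradient hreg hr
  obtain ⟨Ω, ζ, χ, Ψ, ω, hchart, hω, hderiv⟩ :=
    h.exists_isIsothermalChart ((one_lt_div hr).2 hr1)
  have hle := hchart.sixteen_mul_norm_deriv_sq_le
  have hWpos := areaElt_pos (fun z => pdu f (r * z.re, r * z.im))
    (fun z => pdv f (r * z.re, r * z.im)) 0
  have hWsq := areaElt_sq (fun z => pdu f (r * z.re, r * z.im))
    (fun z => pdv f (r * z.re, r * z.im)) 0
  rw [hω, norm_sq_gaussMap] at hle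
  set W := areaElt (fun z => pdu f (r * z.re, r * z.im)) (fun z => pdv f (r * z.re, r * z.im)) 0
  simp only [Complex.zero_re, Complex.zero_im, mul_zero] at hWsq hderiv
  have hsum : 1 + (W - 1) / (1 + W) = 2 * W / (1 + W) := by
    field_simp
    ring
  rw [hsum, div_pow, ← mul_div_assoc, le_div_iff₀ (by positivity)] at hle
  have hnum : 0 ≤ r ^ 2 * (pdv (pdu f) (0, 0) ^ 2 - pdu (pdu f) (0, 0) * pdv (pdv f) (0, 0)) := by
    nlinarith [mul_nonneg (sq_nonneg ‖deriv ω 0‖) (by positivity : 0 ≤ (1 + W) ^ 4)]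
  have hnum' : pdu (pdu f) (0, 0) * pdv (pdv f) (0, 0) - pdv (pdu f) (0, 0) ^ 2 ≤ 0 := by
    linarith [nonneg_of_mul_nonneg_right hnum (by positivity)]
  rw [gaussCurv, ← hWsq, abs_div, abs_of_nonpos hnum', abs_of_pos (by positivity),
    ← mul_div_assoc, div_le_iff₀ (by positivity)]
  nlinarith

end

/-- **Kalaj, Corollary (Heinz constant improvement).**  For any `C²` solution of the
minimal surface equation on the unit disk, the Gaussian curvature at the point above the
origin satisfies `|K| < 5.7`. -/
theorem curvature_lt_five_point_seven (f : ℝ × ℝ → ℝ)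
    (hreg : ContDiffOn ℝ 2 f unitDisk)
    (hmin : MinimalSurfaceEq f unitDisk) :
    |gaussCurv f (0, 0)| < 5.7 := by
  have h := sq_mul_abs_gaussCurv_le hreg hmin (r := 0.99999) (by norm_num) (by norm_num)
  norm_num at h ⊢
  linarith
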